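/- arXiv:2402.08350 — 2 statements merged into one kernel-verified Lean document; each statement's English description precedes it below -/
import Mathlib

section
/- Let σ ∈ 𝔖_s and let (Λ,t) ∈ E(r,s) be σ-stable. Then (Λ,t) lies in the Kirwan cone 𝒦(r,s) if and only if T(Λ) = r·t and for all d ∈ [r−1] and all σ-stable tuples 𝐉 ∈ Intersecting^0(d,r,s)^σ, T_𝐉(Λ) ≤ d·t. -/
open Module

noncomputable section

/-- A complete flag on `ℂ^m`: an increasing family of subspaces with
`dim (F i) = i + 1` (`0`-based indexing, so `F i` is the `i+1`-st step). -/
structure Flagg (m : ℕ) where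
  F : Fin m → Submodule ℂ (Fin m → ℂ)
  mono : Monotone F
  rank_eq : ∀ i : Fin m, finrank ℂ (F i) = (i : ℕ) + 1

/-- An `s`-tuple `J` of (strictly increasing) maps `[d] → [r]` is *intersecting* if
for every `s`-tuple of complete flags on `ℂ^r` the corresponding intersection of
Schubert varieties in the Grassmannian `Gr(d, ℂ^r)` is nonempty. -/
def Intersecting {s d r : ℕ} (J : Fin s → Fin d → Fin r) : Prop :=
  ∀ F : Fin s → Flagg r, ∃ V : Submodule ℂ (Fin r → ℂ), finrank ℂ V = d ∧
    ∀ (l : Fin s) (k : Fin d), (k : ℕ) + 1 ≤ finrank ℂ ↥(V ⊓ (F l).F (J l k))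

/-- `dim I = ∑_j (I(j) - j)`. -/
def dimI {d r : ℕ} (J : Fin d → Fin r) : ℤ := ∑ k, ((J k : ℤ) - (k : ℤ))

/-- Expected dimension of a tuple `J ∈ Subsets(d,r,s)`. -/
def edim {s d r : ℕ} (J : Fin s → Fin d → Fin r) : ℤ :=
  (d : ℤ) * ((r : ℤ) - (d : ℤ)) - ∑ l, ((d : ℤ) * ((r : ℤ) - (d : ℤ)) - dimI (J l))

/-- `dim` for raw `ℕ`-valued increasing sequences. -/
def dimN {d : ℕ} (f : Fin d → ℕ) : ℤ := ∑ k, ((f k : ℤ) - (k : ℤ))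

/-- Expected dimension for raw `ℕ`-valued tuples, with ambient dimension `n` explicit. -/
def edimN {s d : ℕ} (n : ℕ) (f : Fin s → Fin d → ℕ) : ℤ :=
  (d : ℤ) * ((n : ℤ) - (d : ℤ)) - ∑ l, ((d : ℤ) * ((n : ℤ) - (d : ℤ)) - dimN (f l))

/-- `T(Λ) = ∑_l ∑_j Λ_l(j)`. -/
def TT {s r : ℕ} (Λ : Fin s → Fin r → ℝ) : ℝ := ∑ l, ∑ j, Λ l j

/-- `T_J(Λ) = ∑_l ∑_{j ∈ J_l} Λ_l(j)`. -/
def TJ {s d r : ℕ} (J : Fin s → Fin d → Fin r) (Λ : Fin s → Fin r → ℝ) : ℝ :=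
  ∑ l, ∑ k, Λ l (J l k)

/-- `Γ(J)_l(k) = k - J_l(k) + (r - d)`, a weakly decreasing real `d`-tuple. -/
def GammaT {s d r : ℕ} (J : Fin s → Fin d → Fin r) : Fin s → Fin d → ℝ :=
  fun l k => (k : ℝ) - (J l k : ℝ) + ((r : ℝ) - (d : ℝ))

/-- Membership of `(Λ, t)` in the Kirwan cone `𝒦(r,s)`: each `Λ_l` is weakly
decreasing and there are Hermitian matrices `A_1, …, A_s` summing to `t·I_r`
whose decreasingly-ordered spectra are the `Λ_l`. -/
def KirwanMem {s r : ℕ} (Λ : Fin s → Fin r → ℝ) (t : ℝ) : Prop :=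
  (∀ l, Antitone (Λ l)) ∧
  ∃ (A : Fin s → Matrix (Fin r) (Fin r) ℂ) (hA : ∀ l, (A l).IsHermitian),
    (∑ l, A l) = (t : ℂ) • (1 : Matrix (Fin r) (Fin r) ℂ) ∧
    ∀ l, ∃ e : Equiv.Perm (Fin r), ∀ i, Λ l i = (hA l).eigenvalues (e i)

/-- The subspace of a flag with `k` elements (so `flagAt G 0 = ⊥`). -/
def flagAt {m : ℕ} (G : Flagg m) : ℕ → Submodule ℂ (Fin m → ℂ)
  | 0 => ⊥
  | (k + 1) => if h : k < m then G.F ⟨k, h⟩ else ⊤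

/-- The space `ℒ_I(F,G)` of linear maps `φ : ℂ^r → ℂ^q` with
`φ(F_l(j)) ⊆ G_l(I_l(j) - j)` for all `l, j`. -/
def LSpace {s r q : ℕ} (I : Fin s → Fin r → ℕ) (F : Fin s → Flagg r) (G : Fin s → Flagg q) :
    Submodule ℂ ((Fin r → ℂ) →ₗ[ℂ] (Fin q → ℂ)) where
  carrier := {φ | ∀ (l : Fin s) (j : Fin r), ∀ v ∈ (F l).F j,
    φ v ∈ flagAt (G l) (I l j - (j : ℕ))}
  add_mem' := by
    intro a b ha hb l j v hv
    simpa using add_mem (ha l j v hv) (hb l j v hv)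
  zero_mem' := by
    intro l j v hv
    simp
  smul_mem' := by
    intro c a ha l j v hv
    simpa using Submodule.smul_mem _ c (ha l j v hv)

/-- The true dimension `tdim I`, for a raw tuple `I ∈ Subsets(r, r + q, s)`
(here `q = n - r`). -/
def tdim {s : ℕ} (r q : ℕ) (I : Fin s → Fin r → ℕ) : ℕ :=
  sInf {m : ℕ | ∃ (F : Fin s → Flagg r) (G : Fin s → Flagg q), finrank ℂ (LSpace I F G) = m}

/-- The kernel dimension `kdim I`. -/
def kdim {s : ℕ} (r q : ℕ) (I : Fin s → Fin r → ℕ) : ℕ :=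
  sInf {m : ℕ | ∃ (F : Fin s → Flagg r) (G : Fin s → Flagg q)
      (φ : (Fin r → ℂ) →ₗ[ℂ] (Fin q → ℂ)), φ ∈ LSpace I F G ∧
      finrank ℂ (LSpace I F G) = tdim r q I ∧ finrank ℂ (LinearMap.ker φ) = m}

/-- The (`0`-based) Schubert position of a subspace `W` w.r.t. a flag:
`posN Fl W k` is the least `j` with `dim (Fl(j) ⊓ W) = k + 1`. -/
def posN {m : ℕ} (Fl : Flagg m) (W : Submodule ℂ (Fin m → ℂ)) (k : ℕ) : ℕ :=
  sInf {j : ℕ | ∃ h : j < m, finrank ℂ ↥(Fl.F ⟨j, h⟩ ⊓ W) = k + 1}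

/-- The (`0`-based, `ℕ`-valued) kernel position `kPos(I)_l(k)`. -/
def kPosFun {s : ℕ} (r q : ℕ) (I : Fin s → Fin r → ℕ) (l : Fin s) (k : ℕ) : ℕ :=
  sInf {p : ℕ | ∃ (F : Fin s → Flagg r) (G : Fin s → Flagg q)
      (φ : (Fin r → ℂ) →ₗ[ℂ] (Fin q → ℂ)), φ ∈ LSpace I F G ∧
      finrank ℂ (LSpace I F G) = tdim r q I ∧
      finrank ℂ (LinearMap.ker φ) = kdim r q I ∧ posN (F l) (LinearMap.ker φ) k = p}

/-- Apply an `r`-tuple of reals at a natural index (junk value `0` out of range). -/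
def applyI {r : ℕ} (f : Fin r → ℝ) (j : ℕ) : ℝ := if h : j < r then f ⟨j, h⟩ else 0

/-- Apply an `r`-tuple of naturals at a natural index (junk value `0` out of range). -/
def applyN {r : ℕ} (f : Fin r → ℕ) (j : ℕ) : ℕ := if h : j < r then f ⟨j, h⟩ else 0

/-- The slope `slope_θ(J) = (1/d) ∑_l ∑_{j ∈ J_l} θ_l(j)` of a tuple. -/
def slopeT {s d r : ℕ} (θ : Fin s → Fin r → ℝ) (J : Fin s → Fin d → Fin r) : ℝ :=
  ((d : ℝ))⁻¹ * ∑ l, ∑ k, θ l (J l k)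

/-- The slope `slope_θ(W, F) = slope_θ(Pos(W, F))` of a (nonzero) subspace. -/
def slopeW {s r : ℕ} (θ : Fin s → Fin r → ℝ) (F : Fin s → Flagg r)
    (W : Submodule ℂ (Fin r → ℂ)) : ℝ :=
  ((finrank ℂ W : ℝ))⁻¹ * ∑ l, ∑ k ∈ Finset.range (finrank ℂ W), applyI (θ l) (posN (F l) W k)

end

section
open Module
namespace KH

/-- Dichotomy for a polynomial map: either the image lies in a hypersurface, or it
contains a nonempty principal open set. -/
lemma dicho {ι κ : Type} [Finite ι] [Finite κ] (ψ : ι → MvPolynomial κ ℂ)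
    (hinj : ∀ p : MvPolynomial ι ℂ, MvPolynomial.aeval ψ p = 0 → p = 0) :
    ∃ f : MvPolynomial ι ℂ, f ≠ 0 ∧ ∀ m : ι → ℂ, MvPolynomial.eval m f ≠ 0 →
      ∃ x : κ → ℂ, ∀ i, MvPolynomial.eval x (ψ i) = m i := by
  classical
  set φ : MvPolynomial ι ℂ →ₐ[ℂ] MvPolynomial κ ℂ := MvPolynomial.aeval ψ with hφ
  have hφinj : Function.Injective φ := (injective_iff_map_eq_zero φ).2 hinj
  have hfp : (φ : MvPolynomial ι ℂ →+* MvPolynomial κ ℂ).FinitePresentation := by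
    have h1 : (φ : MvPolynomial ι ℂ →+* MvPolynomial κ ℂ).FiniteType := by
      apply RingHom.FiniteType.of_comp_finiteType
        (f := (MvPolynomial.C : ℂ →+* MvPolynomial ι ℂ))
      have : (φ : MvPolynomial ι ℂ →+* MvPolynomial κ ℂ).comp MvPolynomial.C
          = algebraMap ℂ (MvPolynomial κ ℂ) := by
        ext x : 1
        simp [hφ, MvPolynomial.algebraMap_eq]
      rw [this, RingHom.finiteType_algebraMap]
      infer_instance
    exact RingHom.FinitePresentation.of_finiteType.1 h1
  obtain ⟨S, hS⟩ := PrimeSpectrum.exists_constructibleSetData_iff.2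
    (PrimeSpectrum.isConstructible_range_comap hfp)
  have hbot : (⊥ : PrimeSpectrum (MvPolynomial ι ℂ)) ∈
      Set.range (PrimeSpectrum.comap (φ : MvPolynomial ι ℂ →+* MvPolynomial κ ℂ)) := by
    refine ⟨⊥, ?_⟩
    ext x
    simp only [PrimeSpectrum.comap_asIdeal, Ideal.mem_comap, PrimeSpectrum.asIdeal_bot,
      Ideal.mem_bot]
    exact map_eq_zero_iff _ hφinj
  rw [← hS] at hbot
  simp only [PrimeSpectrum.ConstructibleSetData.toSet, Set.mem_iUnion] at hbot
  obtain ⟨D, hD, hDb⟩ := hbot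
  have hg : ∀ i, D.g i = 0 := by
    intro i
    have := hDb.1
    rw [PrimeSpectrum.mem_zeroLocus] at this
    simpa using this (Set.mem_range_self i)
  have hf : D.f ≠ 0 := by
    intro h
    apply hDb.2
    rw [PrimeSpectrum.mem_zeroLocus, h]
    simp
  refine ⟨D.f, hf, fun m hm => ?_⟩
  have hmem : (MvPolynomial.pointToPoint (k := ℂ) m : PrimeSpectrum (MvPolynomial ι ℂ)) ∈
      Set.range (PrimeSpectrum.comap (φ : MvPolynomial ι ℂ →+* MvPolynomial κ ℂ)) := by
    rw [← hS]
    simp only [PrimeSpectrum.ConstructibleSetData.toSet, Set.mem_iUnion]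
    refine ⟨D, hD, ?_, ?_⟩
    · rw [PrimeSpectrum.mem_zeroLocus]
      rintro _ ⟨i, rfl⟩
      rw [hg i]; exact zero_mem _
    · rw [PrimeSpectrum.mem_zeroLocus, Set.singleton_subset_iff]
      intro h
      apply hm
      have := (MvPolynomial.mem_vanishingIdeal_singleton_iff (k := ℂ) m D.f).1 h
      rw [← MvPolynomial.coe_aeval_eq_eval]; exact this
  obtain ⟨q, hq⟩ := hmem
  obtain ⟨I, hI, hqI⟩ := Ideal.exists_le_maximal q.asIdeal q.2.ne_top
  obtain ⟨x, hx⟩ := MvPolynomial.eq_vanishingIdeal_singleton_of_isMaximal ℂ hI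
  refine ⟨x, fun i => ?_⟩
  have h1 : (MvPolynomial.X i - MvPolynomial.C (m i) : MvPolynomial ι ℂ) ∈
      (MvPolynomial.pointToPoint (k := ℂ) m).asIdeal := by
    apply (MvPolynomial.mem_vanishingIdeal_singleton_iff (k := ℂ) m _).2
    simp
  rw [← hq] at h1
  have h2 : ψ i - MvPolynomial.C (m i) ∈ I := by
    apply hqI
    have h3 : φ (MvPolynomial.X i - MvPolynomial.C (m i)) ∈ q.asIdeal := h1
    simpa [hφ, MvPolynomial.algebraMap_eq] using h3
  rw [hx, MvPolynomial.mem_vanishingIdeal_singleton_iff] at h2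
  simpa [sub_eq_zero, MvPolynomial.aeval_def, ← MvPolynomial.eval₂_id] using h2

lemma card_le_of_inj {ι κ : Type} [Fintype ι] [Fintype κ] (ψ : ι → MvPolynomial κ ℂ)
    (hinj : ∀ p : MvPolynomial ι ℂ, MvPolynomial.aeval ψ p = 0 → p = 0) :
    Fintype.card ι ≤ Fintype.card κ := by
  have h : AlgebraicIndependent ℂ ψ := by
    rw [algebraicIndependent_iff]; exact hinj
  have := h.cardinalMk_le_trdeg
  rw [MvPolynomial.trdeg_of_isDomain] at this
  simpa using this

/-- The nonvanishing locus of a nonzero polynomial is dense. -/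
lemma dense_ne {ι : Type} [Finite ι] (f : MvPolynomial ι ℂ) (hf : f ≠ 0) :
    Dense {m : ι → ℂ | MvPolynomial.eval m f ≠ 0} := by
  obtain ⟨n, hn⟩ : ∃ n : ι → ℂ, MvPolynomial.eval n f ≠ 0 := by
    by_contra h
    push Not at h
    exact hf (MvPolynomial.funext (by simpa using h))
  intro m
  let g : Polynomial ℂ := MvPolynomial.aeval
    (fun i => Polynomial.C (m i) + Polynomial.X * Polynomial.C (n i - m i)) f
  have hg : ∀ z : ℂ, g.eval z = MvPolynomial.eval (fun i => m i + z * (n i - m i)) f := by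
    intro z
    have : (Polynomial.aeval z).comp (MvPolynomial.aeval
      (fun i => Polynomial.C (m i) + Polynomial.X * Polynomial.C (n i - m i)))
      = (MvPolynomial.aeval (fun i => m i + z * (n i - m i)) : MvPolynomial ι ℂ →ₐ[ℂ] ℂ) := by
      ext i; simp
    have h2 := congrArg (fun F => F f) this
    simpa [g, Polynomial.coe_aeval_eq_eval, MvPolynomial.coe_aeval_eq_eval] using h2
  have hg0 : g ≠ 0 := by
    intro h
    have := hg 1
    rw [h] at this
    simp at this
    exact hn this.symm
  have hfin : {z : ℂ | g.eval z = 0}.Finite := by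
    refine (g.roots.toFinset.finite_toSet).subset ?_
    intro z hz
    simp [hg0]; exact hz
  have hd : Dense {z : ℂ | g.eval z = 0}ᶜ := hfin.countable.dense_compl ℂ
  have hc : Continuous (fun z : ℂ => (fun i => m i + z * (n i - m i))) := by fun_prop
  have h0 : (0 : ℂ) ∈ closure ({z : ℂ | g.eval z = 0}ᶜ) := hd 0
  have := image_closure_subset_closure_image hc (Set.mem_image_of_mem _ h0)
  simp only [zero_mul, add_zero] at this
  refine closure_mono ?_ this
  rintro _ ⟨z, hz, rfl⟩
  simpa [← hg] using hz

end KH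
end

section
open Module
namespace KH

section HN
variable {W : Type} [AddCommGroup W] [Module ℂ W] [FiniteDimensional ℂ W]

lemma rank_split {X : Type} [AddCommGroup X] [Module ℂ X] (f : W →ₗ[ℂ] X)
    (p : Submodule ℂ W) :
    finrank ℂ (p.map f) + finrank ℂ ↥(p ⊓ LinearMap.ker f) = finrank ℂ p := by
  have h := LinearMap.finrank_range_add_finrank_ker (f.domRestrict p)
  have h1 : LinearMap.range (f.domRestrict p) = p.map f := by
    rw [LinearMap.range_domRestrict]
  have h2 : finrank ℂ (LinearMap.ker (f.domRestrict p)) = finrank ℂ ↥(p ⊓ LinearMap.ker f) := by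
    rw [LinearMap.ker_domRestrict, ← Submodule.map_comap_subtype]
    exact (LinearEquiv.finrank_eq (Submodule.equivMapOfInjective _ p.injective_subtype _))
  rw [h1, h2] at h
  exact h

variable {ι : Type} [Fintype ι]

/-- Weighted degree of a subspace. -/
noncomputable def deg (c : ι → ℝ) (F : ι → Submodule ℂ W) (V : Submodule ℂ W) : ℝ :=
  ∑ i, c i * (finrank ℂ ↥(V ⊓ F i) : ℝ)

lemma deg_super (c : ι → ℝ) (hc : ∀ i, 0 ≤ c i) (F : ι → Submodule ℂ W)
    (V U : Submodule ℂ W) :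
    deg c F V + deg c F U ≤ deg c F (V ⊔ U) + deg c F (V ⊓ U) := by
  unfold deg
  rw [← Finset.sum_add_distrib, ← Finset.sum_add_distrib]
  apply Finset.sum_le_sum
  intro i _
  rw [← mul_add, ← mul_add]
  apply mul_le_mul_of_nonneg_left _ (hc i)
  have h1 := Submodule.finrank_sup_add_finrank_inf_eq (V ⊓ F i) (U ⊓ F i)
  have h2 : finrank ℂ ↥((V ⊓ F i) ⊔ (U ⊓ F i)) ≤ finrank ℂ ↥((V ⊔ U) ⊓ F i) := by
    apply Submodule.finrank_mono
    exact sup_le (inf_le_inf_right _ le_sup_left) (inf_le_inf_right _ le_sup_right)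
  have h3 : (V ⊓ F i) ⊓ (U ⊓ F i) = (V ⊓ U) ⊓ F i := by
    rw [inf_inf_inf_comm, inf_idem]
  rw [h3] at h1
  exact_mod_cast (by omega)

lemma deg_bot (c : ι → ℝ) (F : ι → Submodule ℂ W) : deg c F ⊥ = 0 := by
  unfold deg
  refine Finset.sum_eq_zero fun i _ => ?_
  rw [bot_inf_eq]; simp

/-- Maximal destabilizing subspace. -/
lemma exists_HN (c : ι → ℝ) (F : ι → Submodule ℂ W) (t : ℝ)
    (h : ∃ V : Submodule ℂ W, t * finrank ℂ V < deg c F V) :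
    ∃ (V : Submodule ℂ W) (μ : ℝ), t < μ ∧ 0 < finrank ℂ V ∧ deg c F V = μ * finrank ℂ V ∧
      (∀ U, deg c F U ≤ μ * finrank ℂ U) ∧
      (∀ U, deg c F U = μ * finrank ℂ U → finrank ℂ U ≤ finrank ℂ V) := by
  classical
  obtain ⟨V0, hV0⟩ := h
  have hV0pos : 0 < finrank ℂ V0 := by
    rcases Nat.eq_zero_or_pos (finrank ℂ V0) with h0 | h0
    · rw [Submodule.finrank_eq_zero.1 h0] at hV0
      simp [deg_bot] at hV0
    · exact h0
  let slope : Submodule ℂ W → ℝ := fun V => deg c F V / finrank ℂ V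
  have hfin : (Set.range slope).Finite := by
    let n := finrank ℂ W
    let g : (ι → Fin (n+1)) × Fin (n+1) → ℝ := fun x => (∑ i, c i * ((x.1 i : ℕ) : ℝ)) / ((x.2 : ℕ) : ℝ)
    refine (Set.finite_range g).subset ?_
    rintro _ ⟨V, rfl⟩
    refine ⟨(fun i => ⟨finrank ℂ ↥(V ⊓ F i), Nat.lt_succ_of_le (Submodule.finrank_le _)⟩,
      ⟨finrank ℂ V, Nat.lt_succ_of_le (Submodule.finrank_le _)⟩), ?_⟩
    simp [g, slope, deg]
  have hfin2 : (slope '' {V | 0 < finrank ℂ V}).Finite := hfin.subset (Set.image_subset_range _ _)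
  obtain ⟨μ, ⟨V1, hV1, hV1μ⟩, hμ⟩ := hfin2.exists_maximal ⟨_, V0, hV0pos, rfl⟩
  have hmax : ∀ U, deg c F U ≤ μ * finrank ℂ U := by
    intro U
    rcases Nat.eq_zero_or_pos (finrank ℂ U) with h0 | h0
    · rw [Submodule.finrank_eq_zero.1 h0]
      simp [deg_bot]
    · have : slope U ≤ μ := by
        rcases le_total μ (slope U) with h1 | h1
        · exact hμ ⟨U, h0, rfl⟩ h1
        · exact h1
      rwa [div_le_iff₀ (by exact_mod_cast h0)] at this
  have hex : ∃ n, ∃ V, deg c F V = μ * finrank ℂ V ∧ finrank ℂ V = n ∧ 0 < n := by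
    refine ⟨_, V1, ?_, rfl, hV1⟩
    rw [← hV1μ]
    have : (finrank ℂ V1 : ℝ) ≠ 0 := by exact_mod_cast (ne_of_gt hV1)
    simp only [slope]; field_simp
  let P : ℕ → Prop := fun n => ∃ V, deg c F V = μ * finrank ℂ V ∧ finrank ℂ V = n ∧ 0 < n
  have hPb : ∀ n, P n → n ≤ finrank ℂ W := by
    rintro n ⟨V, _, rfl, _⟩; exact Submodule.finrank_le _
  obtain ⟨n0, hn0⟩ := hex
  have hspec := Nat.findGreatest_spec (P := P) (hPb _ hn0) hn0
  obtain ⟨V, hV, hVn, hVpos⟩ := hspec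
  refine ⟨V, μ, ?_, by omega, hV, hmax, ?_⟩
  · have h1 := lt_of_lt_of_le hV0 (hmax V0)
    have h2 : (0:ℝ) < finrank ℂ V0 := by exact_mod_cast hV0pos
    exact lt_of_mul_lt_mul_right h1 h2.le
  · intro U hU
    rcases Nat.eq_zero_or_pos (finrank ℂ U) with h0 | h0
    · omega
    · rw [hVn]
      exact Nat.le_findGreatest (P := P) (Submodule.finrank_le _) ⟨U, hU, rfl, h0⟩

lemma HN_unique (c : ι → ℝ) (hc : ∀ i, 0 ≤ c i) (F : ι → Submodule ℂ W) (μ : ℝ)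
    (V U : Submodule ℂ W) (hV : deg c F V = μ * finrank ℂ V)
    (hmax : ∀ U, deg c F U ≤ μ * finrank ℂ U)
    (hdim : ∀ U, deg c F U = μ * finrank ℂ U → finrank ℂ U ≤ finrank ℂ V)
    (hU : μ * finrank ℂ U ≤ deg c F U) (hUV : finrank ℂ U = finrank ℂ V) : U = V := by
  have h1 := deg_super c hc F V U
  have h2 : (finrank ℂ ↥(V ⊔ U) : ℝ) + finrank ℂ ↥(V ⊓ U) = finrank ℂ V + finrank ℂ U := by
    exact_mod_cast Submodule.finrank_sup_add_finrank_inf_eq V U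
  have h3 := hmax (V ⊔ U)
  have h4 := hmax (V ⊓ U)
  have h5 : deg c F (V ⊔ U) = μ * finrank ℂ ↥(V ⊔ U) := by
    apply le_antisymm h3
    have : μ * ((finrank ℂ ↥(V ⊔ U) : ℝ) + finrank ℂ ↥(V ⊓ U)) = μ * (finrank ℂ V + finrank ℂ U) := by
      rw [h2]
    nlinarith
  have h6 := hdim _ h5
  have h7 : V = V ⊔ U := Submodule.eq_of_le_of_finrank_le le_sup_left h6
  have h8 : U ≤ V := by rw [h7]; exact le_sup_right
  exact Submodule.eq_of_le_of_finrank_le h8 hUV.ge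

lemma HN_hom (c : ι → ℝ) (hc : ∀ i, 0 ≤ c i) (F : ι → Submodule ℂ W) (μ : ℝ)
    (V : Submodule ℂ W) (hV : deg c F V = μ * finrank ℂ V)
    (hmax : ∀ U, deg c F U ≤ μ * finrank ℂ U)
    (hdim : ∀ U, deg c F U = μ * finrank ℂ U → finrank ℂ U ≤ finrank ℂ V)
    (φ : V →ₗ[ℂ] W ⧸ V)
    (hφ : ∀ i, ∀ v : V, (v : W) ∈ F i → φ v ∈ (F i).map V.mkQ) : φ = 0 := by
  by_contra hne
  set K : Submodule ℂ W := (LinearMap.ker φ).map V.subtype with hK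
  set U : Submodule ℂ W := (LinearMap.range φ).comap V.mkQ with hU
  have hVU : V ≤ U := by
    intro v hv
    rw [hU, Submodule.mem_comap]
    rw [(Submodule.Quotient.mk_eq_zero V).2 hv |> (show V.mkQ v = 0 from ·)]
    exact zero_mem _
  have hKdim : finrank ℂ K = finrank ℂ (LinearMap.ker φ) :=
    (LinearEquiv.finrank_eq (Submodule.equivMapOfInjective _ V.injective_subtype _)).symm
  have hUV : finrank ℂ (LinearMap.range φ) + finrank ℂ V = finrank ℂ U := by
    have := rank_split V.mkQ U
    rw [hU, Submodule.map_comap_eq_of_surjective V.mkQ_surjective, Submodule.ker_mkQ,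
      ← hU, inf_eq_right.2 hVU] at this
    exact this
  have hrk := LinearMap.finrank_range_add_finrank_ker φ
  have hrpos : 0 < finrank ℂ (LinearMap.range φ) := by
    rw [Nat.pos_iff_ne_zero]
    intro h0
    exact hne (LinearMap.range_eq_bot.1 (Submodule.finrank_eq_zero.1 h0))
  have key : deg c F V + deg c F V ≤ deg c F K + deg c F U := by
    unfold deg
    rw [← Finset.sum_add_distrib, ← Finset.sum_add_distrib]
    apply Finset.sum_le_sum
    intro i _
    rw [← mul_add, ← mul_add]
    apply mul_le_mul_of_nonneg_left _ (hc i)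
    let p : Submodule ℂ V := (F i).comap V.subtype
    have e1 := rank_split φ p
    have e2 : finrank ℂ p = finrank ℂ ↥(V ⊓ F i) := by
      rw [← Submodule.map_comap_subtype]
      exact (LinearEquiv.finrank_eq (Submodule.equivMapOfInjective _ V.injective_subtype _))
    have e3 : finrank ℂ ↥(p ⊓ LinearMap.ker φ) = finrank ℂ ↥(K ⊓ F i) := by
      have : K ⊓ F i = (p ⊓ LinearMap.ker φ).map V.subtype := by
        ext x
        simp only [hK, p, Submodule.mem_inf, Submodule.mem_map, Submodule.mem_comap]
        constructor
        · rintro ⟨⟨y, hy, rfl⟩, h2⟩; exact ⟨y, ⟨h2, hy⟩, rfl⟩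
        · rintro ⟨y, ⟨h2, hy⟩, rfl⟩; exact ⟨⟨y, hy, rfl⟩, h2⟩
      rw [this]
      exact (LinearEquiv.finrank_eq (Submodule.equivMapOfInjective _ V.injective_subtype _))
    have e4 := rank_split V.mkQ (U ⊓ F i)
    have e5 : (U ⊓ F i) ⊓ LinearMap.ker V.mkQ = V ⊓ F i := by
      rw [Submodule.ker_mkQ, inf_right_comm, inf_eq_right.2 hVU]
    rw [e5] at e4
    have e6 : finrank ℂ (p.map φ) ≤ finrank ℂ ((U ⊓ F i).map V.mkQ) := by
      apply Submodule.finrank_mono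
      rintro _ ⟨v, hv, rfl⟩
      obtain ⟨f, hf, hfv⟩ := hφ i v hv
      refine ⟨f, ⟨?_, hf⟩, hfv⟩
      show f ∈ U
      rw [hU, Submodule.mem_comap, hfv]
      exact LinearMap.mem_range_self φ v
    exact_mod_cast (by omega)
  have hUs : deg c F U < μ * finrank ℂ U := by
    refine lt_of_le_of_ne (hmax U) fun h => ?_
    have := hdim U h
    omega
  have hKs := hmax K
  have hsum : (finrank ℂ K : ℝ) + finrank ℂ U = finrank ℂ V + finrank ℂ V := by
    exact_mod_cast (by omega)
  have : μ * ((finrank ℂ K : ℝ) + finrank ℂ U) = μ * (finrank ℂ V + finrank ℂ V) := by rw [hsum]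
  nlinarith

end HN

/-- Standard coordinate flag. -/
def Cs (r j : ℕ) : Submodule ℂ (Fin r → ℂ) where
  carrier := {y | ∀ i : Fin r, j ≤ (i : ℕ) → y i = 0}
  add_mem' := by
    intro a b ha hb i hi
    simp [ha i hi, hb i hi]
  zero_mem' := by intro i _; rfl
  smul_mem' := by
    intro c a ha i hi
    simp [ha i hi]

lemma mem_Cs {r j : ℕ} {y : Fin r → ℂ} : y ∈ Cs r j ↔ ∀ i : Fin r, j ≤ (i : ℕ) → y i = 0 :=
  Iff.rfl

lemma Cs_top {r j : ℕ} (h : r ≤ j) : Cs r j = ⊤ := by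
  rw [eq_top_iff]; intro y _ i hi
  have := i.2; omega

lemma Cs_zero {r : ℕ} : Cs r 0 = ⊥ := by
  rw [eq_bot_iff]; intro y hy
  rw [Submodule.mem_bot]; ext i; exact hy i (Nat.zero_le _)

lemma Cs_mono {r j k : ℕ} (h : j ≤ k) : Cs r j ≤ Cs r k := fun _ hy i hi => hy i (h.trans hi)

lemma jump {r : ℕ} (V : Submodule ℂ (Fin r → ℂ)) :
    ∃ S : Finset (Fin r), (∀ j, finrank ℂ ↥(V ⊓ Cs r j) = (S.filter (fun i : Fin r => (i : ℕ) < j)).card) ∧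
      (∀ v ∈ V, ∀ i : Fin r, v i ≠ 0 → (∀ i', i < i' → v i' = 0) → i ∈ S) := by
  classical
  let S : Finset (Fin r) := Finset.univ.filter fun j => ∃ v ∈ V ⊓ Cs r (j+1), v j ≠ 0
  refine ⟨S, ?_, ?_⟩
  · intro j
    induction j with
    | zero => simp [Cs_zero]
    | succ j ih =>
      by_cases hj : j < r
      · let f : (Fin r → ℂ) →ₗ[ℂ] ℂ := LinearMap.proj ⟨j, hj⟩
        have h1 := rank_split f (V ⊓ Cs r (j+1))
        have h2 : (V ⊓ Cs r (j+1)) ⊓ LinearMap.ker f = V ⊓ Cs r j := by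
          ext y
          simp only [Submodule.mem_inf, LinearMap.mem_ker, f, LinearMap.proj_apply, mem_Cs]
          constructor
          · rintro ⟨⟨a, b⟩, c⟩
            refine ⟨a, fun i hi => ?_⟩
            rcases Nat.eq_or_lt_of_le hi with h | h
            · rw [← c]; congr 1; ext; exact h.symm
            · exact b i h
          · rintro ⟨a, b⟩
            exact ⟨⟨a, fun i hi => b i (by omega)⟩, b _ le_rfl⟩
        rw [h2, ih] at h1
        rw [← h1, add_comm]
        by_cases hS : (⟨j, hj⟩ : Fin r) ∈ S
        · have h3 : finrank ℂ ((V ⊓ Cs r (j+1)).map f) = 1 := by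
            have hx := hS
            simp only [S, Finset.mem_filter, Finset.mem_univ, true_and] at hx
            obtain ⟨v, hv, hv0⟩ := hx
            have : (V ⊓ Cs r (j+1)).map f = ⊤ := by
              rw [eq_top_iff]
              intro z _
              refine ⟨(z / v ⟨j, hj⟩) • v, Submodule.smul_mem _ _ hv, ?_⟩
              simp [f, hv0]
            rw [this]; simp
          have h4 : S.filter (fun i : Fin r => (i : ℕ) < j + 1)
              = insert ⟨j, hj⟩ (S.filter (fun i : Fin r => (i : ℕ) < j)) := by
            ext i
            simp only [Finset.mem_filter, Finset.mem_insert, Fin.ext_iff]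
            constructor
            · rintro ⟨a, b⟩
              rcases Nat.lt_succ_iff_lt_or_eq.1 b with h | h
              · exact Or.inr ⟨a, h⟩
              · exact Or.inl h
            · rintro (h | ⟨a, b⟩)
              · refine ⟨?_, by omega⟩
                have : i = ⟨j, hj⟩ := Fin.ext h
                rwa [this]
              · exact ⟨a, by omega⟩
          rw [h3, h4, Finset.card_insert_of_notMem (by simp)]
        · have h3 : (V ⊓ Cs r (j+1)).map f = ⊥ := by
            rw [eq_bot_iff]
            rintro _ ⟨v, hv, rfl⟩
            by_contra h
            apply hS
            simp only [S, Finset.mem_filter, Finset.mem_univ, true_and]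
            exact ⟨v, hv, fun h0 => h (by simpa [f] using h0)⟩
          have h4 : S.filter (fun i : Fin r => (i : ℕ) < j + 1) = S.filter (fun i : Fin r => (i : ℕ) < j) := by
            ext i
            simp only [Finset.mem_filter]
            constructor
            · rintro ⟨a, b⟩
              refine ⟨a, ?_⟩
              rcases Nat.lt_succ_iff_lt_or_eq.1 b with h | h
              · exact h
              · have : i = ⟨j, hj⟩ := Fin.ext h
                rw [this] at a; exact absurd a hS
            · rintro ⟨a, b⟩; exact ⟨a, by omega⟩
          rw [h3, h4]; simp
      · have h1 : Cs r (j+1) = Cs r j := by rw [Cs_top (by omega), Cs_top (by omega)]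
        rw [h1, ih]
        congr 1
        ext i
        have := i.2
        simp only [Finset.mem_filter]
        constructor <;> rintro ⟨a, b⟩ <;> exact ⟨a, by omega⟩
  · intro v hv i hi h
    simp only [S, Finset.mem_filter, Finset.mem_univ, true_and]
    exact ⟨v, ⟨hv, fun i' hi' => h i' (by exact Fin.lt_def.2 hi')⟩, hi⟩

lemma jump_inj {r : ℕ} {V : Submodule ℂ (Fin r → ℂ)} {S : Finset (Fin r)}
    (hS : ∀ v ∈ V, ∀ i : Fin r, v i ≠ 0 → (∀ i', i < i' → v i' = 0) → i ∈ S)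
    (v : Fin r → ℂ) (hv : v ∈ V) (j : ℕ) (h : ∀ i ∈ S, j ≤ (i : ℕ) → v i = 0) : v ∈ Cs r j := by
  classical
  by_contra hne
  rw [mem_Cs] at hne
  push Not at hne
  have hT : (Finset.univ.filter fun i : Fin r => j ≤ (i : ℕ) ∧ v i ≠ 0).Nonempty := by
    obtain ⟨i, h1, h2⟩ := hne
    exact ⟨i, by simp [h1, h2]⟩
  obtain ⟨i, hi, hmax⟩ := Finset.exists_maximal hT
  simp only [Finset.mem_filter, Finset.mem_univ, true_and] at hi hmax
  refine hi.2 (h i (hS v hv i hi.2 fun i' hi' => ?_) hi.1)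
  by_contra h0
  have := hmax (y := i') ⟨hi.1.trans (le_of_lt hi'), h0⟩ (le_of_lt hi')
  exact absurd hi' (not_lt.2 this)

end KH
end

section
open Module
namespace KH

/-- The flag spanned by the columns of a matrix. -/
noncomputable def fl {r : ℕ} (M : Matrix (Fin r) (Fin r) ℂ) (j : ℕ) : Submodule ℂ (Fin r → ℂ) :=
  (Cs r j).map M.mulVecLin

lemma mem_fl {r : ℕ} {M : Matrix (Fin r) (Fin r) ℂ} (hM : IsUnit M.det) {j : ℕ} {x : Fin r → ℂ} :
    x ∈ fl M j ↔ ∀ i : Fin r, j ≤ (i : ℕ) → (M⁻¹.mulVec x) i = 0 := by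
  constructor
  · rintro ⟨y, hy, rfl⟩ i hi
    rw [Matrix.mulVecLin_apply, Matrix.mulVec_mulVec, Matrix.nonsing_inv_mul _ hM, Matrix.one_mulVec]
    exact hy i hi
  · intro h
    refine ⟨M⁻¹.mulVec x, h, ?_⟩
    rw [Matrix.mulVecLin_apply, Matrix.mulVec_mulVec, Matrix.mul_nonsing_inv _ hM, Matrix.one_mulVec]

lemma mulVec_inj {r : ℕ} {M : Matrix (Fin r) (Fin r) ℂ} (hM : IsUnit M.det) :
    Function.Injective M.mulVecLin := by
  intro x y h
  have h2 := congrArg (fun z => M⁻¹.mulVec z) h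
  simpa [Matrix.mulVec_mulVec, Matrix.nonsing_inv_mul _ hM] using h2

lemma fl_mono {r : ℕ} (M : Matrix (Fin r) (Fin r) ℂ) {j k : ℕ} (h : j ≤ k) : fl M j ≤ fl M k :=
  Submodule.map_mono (Cs_mono h)

lemma fl_top {r : ℕ} {M : Matrix (Fin r) (Fin r) ℂ} (hM : IsUnit M.det) {j : ℕ} (h : r ≤ j) :
    fl M j = ⊤ := by
  rw [eq_top_iff]; intro x _; rw [mem_fl hM]; intro i hi; have := i.2; omega

lemma finrank_Cs {r j : ℕ} (hj : j ≤ r) : finrank ℂ (Cs r j) = j := by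
  classical
  induction j with
  | zero => rw [Cs_zero]; simp
  | succ j ih =>
    have hj' : j < r := hj
    let f : (Fin r → ℂ) →ₗ[ℂ] ℂ := LinearMap.proj ⟨j, hj'⟩
    have h1 := rank_split f (Cs r (j+1))
    have h2 : (Cs r (j+1)) ⊓ LinearMap.ker f = Cs r j := by
      ext y
      simp only [Submodule.mem_inf, LinearMap.mem_ker, f, LinearMap.proj_apply, mem_Cs]
      constructor
      · rintro ⟨b, c⟩ i hi
        rcases Nat.eq_or_lt_of_le hi with h | h
        · rw [← c]; congr 1; ext; exact h.symm
        · exact b i h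
      · intro b
        exact ⟨fun i hi => b i (by omega), b _ le_rfl⟩
    have h3 : (Cs r (j+1)).map f = ⊤ := by
      rw [eq_top_iff]
      intro z _
      refine ⟨Pi.single ⟨j, hj'⟩ z, ?_, by simp [f]⟩
      intro i hi
      rw [Pi.single_eq_of_ne]
      intro h; rw [h] at hi; simp at hi
    rw [h2, h3, ih (by omega)] at h1
    simp at h1
    omega

lemma finrank_fl {r : ℕ} {M : Matrix (Fin r) (Fin r) ℂ} (hM : IsUnit M.det) {j : ℕ} (hj : j ≤ r) :
    finrank ℂ (fl M j) = j := by
  exact ((LinearEquiv.finrank_eq (Submodule.equivMapOfInjective M.mulVecLin (mulVec_inj hM)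
    (Cs r j))).symm).trans (finrank_Cs hj)

lemma pos_exists {r d : ℕ} {M : Matrix (Fin r) (Fin r) ℂ} (hM : IsUnit M.det)
    (V : Submodule ℂ (Fin r → ℂ)) (hd : finrank ℂ V = d) :
    ∃ J : Fin d → Fin r, StrictMono J ∧
      (∀ j : ℕ, finrank ℂ ↥(V ⊓ fl M j) = (Finset.univ.filter fun k : Fin d => (J k : ℕ) < j).card) ∧
      ∃ v : Fin d → Fin r → ℂ, (∀ k, v k ∈ V) ∧
        (∀ k i, J k < i → (M⁻¹.mulVec (v k)) i = 0) ∧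
        (∀ k k', (M⁻¹.mulVec (v k)) (J k') = if k = k' then 1 else 0) ∧
        ∀ x ∈ V, x = ∑ k, (M⁻¹.mulVec x) (J k) • v k := by
  classical
  set V' : Submodule ℂ (Fin r → ℂ) := V.comap M.mulVecLin with hV'
  have hsurj : Function.Surjective M.mulVecLin := by
    intro x
    refine ⟨M⁻¹.mulVec x, ?_⟩
    rw [Matrix.mulVecLin_apply, Matrix.mulVec_mulVec, Matrix.mul_nonsing_inv _ hM, Matrix.one_mulVec]
  have hmap : ∀ j, finrank ℂ ↥(V ⊓ fl M j) = finrank ℂ ↥(V' ⊓ Cs r j) := by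
    intro j
    have : V ⊓ fl M j = (V' ⊓ Cs r j).map M.mulVecLin := by
      rw [Submodule.map_inf _ (mulVec_inj hM), hV', Submodule.map_comap_eq_of_surjective hsurj]
      rfl
    rw [this]
    exact (LinearEquiv.finrank_eq (Submodule.equivMapOfInjective _ (mulVec_inj hM) _)).symm
  have hdV' : finrank ℂ V' = d := by
    have := hmap r
    rw [fl_top hM le_rfl, Cs_top le_rfl, inf_top_eq, inf_top_eq] at this
    omega
  obtain ⟨S, hS1, hS2⟩ := jump V'
  have hcard : S.card = d := by
    have := hS1 r
    rw [Cs_top le_rfl, inf_top_eq, hdV'] at this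
    rw [this]
    congr 1
    ext i; simp
  let J : Fin d → Fin r := S.orderEmbOfFin hcard
  have hJm : StrictMono J := (S.orderEmbOfFin hcard).strictMono
  have hJS : ∀ k, J k ∈ S := fun k => S.orderEmbOfFin_mem hcard k
  have hJsurj : ∀ i ∈ S, ∃ k, J k = i := by
    intro i hi
    have := S.range_orderEmbOfFin hcard
    have h2 : i ∈ Set.range (S.orderEmbOfFin hcard) := by rw [this]; exact hi
    exact h2
  let P : V' →ₗ[ℂ] (Fin d → ℂ) := LinearMap.pi fun k => (LinearMap.proj (J k)).comp V'.subtype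
  have hPinj : Function.Injective P := by
    rw [← LinearMap.ker_eq_bot, LinearMap.ker_eq_bot']
    intro m hm
    have h0 : (m : Fin r → ℂ) ∈ Cs r 0 := by
      apply jump_inj hS2 _ m.2
      intro i hi _
      obtain ⟨k, rfl⟩ := hJsurj i hi
      exact congrFun hm k
    rw [Cs_zero] at h0
    exact Subtype.ext (by simpa using h0)
  have hPsurj : Function.Surjective P := by
    have := (LinearMap.injective_iff_surjective_of_finrank_eq_finrank (f := P) (by simp [hdV'])).1 hPinj
    exact this
  choose w hw using fun k : Fin d => hPsurj (Pi.single k 1)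
  have hinvM : ∀ y : Fin r → ℂ, M⁻¹.mulVec (M.mulVecLin y) = y := by
    intro y
    rw [Matrix.mulVecLin_apply, Matrix.mulVec_mulVec, Matrix.nonsing_inv_mul _ hM, Matrix.one_mulVec]
  have hMinv : ∀ y : Fin r → ℂ, M.mulVecLin (M⁻¹.mulVec y) = y := by
    intro y
    rw [Matrix.mulVecLin_apply, Matrix.mulVec_mulVec, Matrix.mul_nonsing_inv _ hM, Matrix.one_mulVec]
  have hwJ : ∀ k k', (w k : Fin r → ℂ) (J k') = if k = k' then 1 else 0 := by
    intro k k'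
    have := congrFun (hw k) k'
    have h2 : (w k : Fin r → ℂ) (J k') = (Pi.single k 1 : Fin d → ℂ) k' := this
    rw [h2, Pi.single_apply]
    simp [eq_comm]
  refine ⟨J, hJm, ?_, fun k => M.mulVecLin (w k), ?_, ?_, ?_, ?_⟩
  · intro j
    rw [hmap, hS1]
    symm
    refine Finset.card_bij (fun k _ => J k) ?_ ?_ ?_
    · intro k hk
      simp only [Finset.mem_filter, Finset.mem_univ, true_and] at hk ⊢
      exact ⟨hJS k, hk⟩
    · intro a _ b _ h; exact hJm.injective h
    · intro i hi
      simp only [Finset.mem_filter] at hi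
      obtain ⟨k, rfl⟩ := hJsurj i hi.1
      exact ⟨k, by simpa using hi.2, rfl⟩
  · intro k; exact (w k).2
  · intro k i hi
    rw [hinvM]
    have : (w k : Fin r → ℂ) ∈ Cs r (J k + 1) := by
      apply jump_inj hS2 _ (w k).2
      intro i hi hi2
      obtain ⟨k', rfl⟩ := hJsurj i hi
      rw [hwJ, if_neg]
      rintro rfl
      omega
    exact this i hi
  · intro k k'
    rw [hinvM]; exact hwJ k k'
  · intro x hx
    have hx' : M⁻¹.mulVec x ∈ V' := by
      rw [hV', Submodule.mem_comap, hMinv]; exact hx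
    have h1 : (⟨M⁻¹.mulVec x, hx'⟩ : V') = ∑ k, (M⁻¹.mulVec x) (J k) • w k := by
      apply hPinj
      rw [map_sum]
      ext k'
      simp only [map_smul, hw, Finset.sum_apply, Pi.smul_apply, Pi.single_apply, smul_eq_mul,
        mul_ite, mul_one, mul_zero, Finset.sum_ite_eq, Finset.mem_univ, if_true]
      rfl
    have h2 := congrArg (fun z : V' => M.mulVecLin (z : Fin r → ℂ)) h1
    simp only [hMinv, AddSubmonoidClass.coe_finsetSum, map_sum, SetLike.val_smul, map_smul] at h2
    exact h2

/-- Telescoping weights. -/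
noncomputable def cw {r : ℕ} (L : Fin r → ℝ) (j : Fin r) : ℝ :=
  L j - (if h : (j : ℕ) + 1 < r then L ⟨j + 1, h⟩ else 0)

lemma cw_nonneg {r : ℕ} {L : Fin r → ℝ} (h : Antitone L) (h0 : ∀ i, 0 ≤ L i) (j : Fin r) :
    0 ≤ cw L j := by
  unfold cw
  split_ifs with h1
  · have : L ⟨j + 1, h1⟩ ≤ L j := h (by rw [Fin.le_def]; simp)
    linarith
  · simpa using h0 j

lemma cw_tele {r : ℕ} (L : Fin r → ℝ) (i : Fin r) :
    ∑ j, (if i ≤ j then cw L j else 0) = L i := by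
  let E : ℕ → ℝ := fun n => if h : n < r then L ⟨n, h⟩ else 0
  have h1 : ∀ j : Fin r, (if i ≤ j then cw L j else 0)
      = (fun n : ℕ => if (i : ℕ) ≤ n then E n - E (n+1) else 0) (j : ℕ) := by
    intro j
    simp [E, cw]
  rw [Finset.sum_congr rfl (fun j _ => h1 j)]
  rw [Fin.sum_univ_eq_sum_range (fun n : ℕ => if (i : ℕ) ≤ n then E n - E (n+1) else 0) r]
  rw [← Finset.sum_filter]
  have h2 : (Finset.range r).filter (fun n => (i : ℕ) ≤ n) = Finset.Ico (i : ℕ) r := by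
    ext n; simp; tauto
  rw [h2]
  have h4 : ∀ n, (i : ℕ) ≤ n → ∑ x ∈ Finset.Ico (i : ℕ) n, (E x - E (x+1)) = E i - E n := by
    intro n hn
    induction n, hn using Nat.le_induction with
    | base => simp
    | succ n hn ih => rw [Finset.sum_Ico_succ_top hn, ih]; ring
  rw [h4 r i.2.le]
  simp [E]

lemma cw_count {r d : ℕ} (L : Fin r → ℝ) (J : Fin d → Fin r) :
    ∑ j : Fin r, cw L j * ((Finset.univ.filter fun k : Fin d => (J k : ℕ) < (j : ℕ) + 1).card : ℝ)
      = ∑ k, L (J k) := by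
  have h : ∀ j : Fin r, cw L j *
      ((Finset.univ.filter fun k : Fin d => (J k : ℕ) < (j : ℕ) + 1).card : ℝ)
      = ∑ k, if J k ≤ j then cw L j else 0 := by
    intro j
    rw [Finset.card_filter]
    push_cast
    rw [Finset.mul_sum]
    refine Finset.sum_congr rfl fun k _ => ?_
    simp [Nat.lt_succ_iff]
  rw [Finset.sum_congr rfl (fun j _ => h j), Finset.sum_comm]
  exact Finset.sum_congr rfl fun k _ => cw_tele L (J k)

lemma count_le {r d : ℕ} (J : Fin d → Fin r) (g : ℕ → ℕ) (hg : Monotone g)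
    (h : ∀ k : Fin d, (k : ℕ) + 1 ≤ g (J k + 1)) (j : ℕ) :
    (Finset.univ.filter fun k : Fin d => (J k : ℕ) < j + 1).card ≤ g (j + 1) := by
  classical
  rcases (Finset.univ.filter fun k : Fin d => (J k : ℕ) < j + 1).eq_empty_or_nonempty with h0 | h0
  · rw [h0]; simp
  · obtain ⟨k, hk, hmax⟩ := Finset.exists_maximal h0
    simp only [Finset.mem_filter, Finset.mem_univ, true_and] at hk hmax
    have h1 : (Finset.univ.filter fun k : Fin d => (J k : ℕ) < j + 1) ⊆ Finset.Iic k := by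
      intro k' hk'
      simp only [Finset.mem_filter, Finset.mem_univ, true_and] at hk'
      rw [Finset.mem_Iic]
      rcases le_total k' k with h2 | h2
      · exact h2
      · exact hmax hk' h2
    have h2 := Finset.card_le_card h1
    rw [Fin.card_Iic] at h2
    exact h2.trans ((h k).trans (hg (by omega)))

lemma count_eq {r d : ℕ} {J : Fin d → Fin r} (hJ : StrictMono J) (k : Fin d) :
    (Finset.univ.filter fun k' : Fin d => (J k' : ℕ) < (J k : ℕ) + 1).card = k + 1 := by
  rw [← Fin.card_Iic k]
  congr 1
  ext k'
  simp only [Finset.mem_filter, Finset.mem_univ, true_and, Finset.mem_Iic]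
  rw [Nat.lt_succ_iff, ← Fin.le_def, hJ.le_iff_le]

/-- degree with respect to a tuple of matrices -/
noncomputable def dg {s r : ℕ} (Λ : Fin s → Fin r → ℝ) (M : Fin s → Matrix (Fin r) (Fin r) ℂ)
    (V : Submodule ℂ (Fin r → ℂ)) : ℝ :=
  deg (fun p : Fin s × Fin r => cw (Λ p.1) p.2) (fun p => fl (M p.1) (p.2 + 1)) V

lemma dg_eq {s r d : ℕ} (Λ : Fin s → Fin r → ℝ) (M : Fin s → Matrix (Fin r) (Fin r) ℂ)
    (V : Submodule ℂ (Fin r → ℂ)) (J : Fin s → Fin d → Fin r)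
    (h : ∀ l, ∀ j : ℕ, finrank ℂ ↥(V ⊓ fl (M l) j)
      = (Finset.univ.filter fun k : Fin d => (J l k : ℕ) < j).card) :
    dg Λ M V = TJ J Λ := by
  unfold dg deg TJ
  rw [Fintype.sum_prod_type]
  refine Finset.sum_congr rfl fun l _ => ?_
  rw [← cw_count]
  refine Finset.sum_congr rfl fun j _ => ?_
  rw [h]

lemma dg_ge {s r d : ℕ} (Λ : Fin s → Fin r → ℝ) (hc : ∀ l j, 0 ≤ cw (Λ l) j)
    (M : Fin s → Matrix (Fin r) (Fin r) ℂ)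
    (V : Submodule ℂ (Fin r → ℂ)) (J : Fin s → Fin d → Fin r)
    (h : ∀ l, ∀ k : Fin d, (k : ℕ) + 1 ≤ finrank ℂ ↥(V ⊓ fl (M l) (J l k + 1))) :
    TJ J Λ ≤ dg Λ M V := by
  unfold dg deg TJ
  rw [Fintype.sum_prod_type]
  refine Finset.sum_le_sum fun l _ => ?_
  rw [← cw_count]
  refine Finset.sum_le_sum fun j _ => ?_
  refine mul_le_mul_of_nonneg_left ?_ (hc l j)
  have := count_le (J l) (fun j => finrank ℂ ↥(V ⊓ fl (M l) j))
    (fun a b hab => Submodule.finrank_mono (inf_le_inf_left _ (fl_mono _ hab))) (h l) j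
  exact_mod_cast this

end KH
end

section
open Module
namespace KH

/-- `J` is the Schubert position of `V` with respect to the column flag of `M`. -/
def IsPos {r d : ℕ} (M : Matrix (Fin r) (Fin r) ℂ) (V : Submodule ℂ (Fin r → ℂ))
    (J : Fin d → Fin r) : Prop :=
  StrictMono J ∧
      (∀ j : ℕ, finrank ℂ ↥(V ⊓ fl M j) = (Finset.univ.filter fun k : Fin d => (J k : ℕ) < j).card) ∧
      ∃ v : Fin d → Fin r → ℂ, (∀ k, v k ∈ V) ∧
        (∀ k i, J k < i → (M⁻¹.mulVec (v k)) i = 0) ∧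
        (∀ k k', (M⁻¹.mulVec (v k)) (J k') = if k = k' then 1 else 0) ∧
        ∀ x ∈ V, x = ∑ k, (M⁻¹.mulVec x) (J k) • v k

lemma edim_nonpos {s r d : ℕ} (Λ : Fin s → Fin r → ℝ) (hc : ∀ l j, 0 ≤ cw (Λ l) j)
    (M : Fin s → Matrix (Fin r) (Fin r) ℂ) (hM : ∀ l, IsUnit (M l).det)
    (V : Submodule ℂ (Fin r → ℂ)) (hd : finrank ℂ V = d) (μ : ℝ)
    (hV : dg Λ M V = μ * finrank ℂ V)
    (hmax : ∀ U, dg Λ M U ≤ μ * finrank ℂ U)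
    (hdim : ∀ U, dg Λ M U = μ * finrank ℂ U → finrank ℂ U ≤ finrank ℂ V)
    (J : Fin s → Fin d → Fin r) (hJ : ∀ l, IsPos (M l) V (J l)) : edim J ≤ 0 := by
  classical
  by_contra hpos
  push Not at hpos
  choose hJm hcnt v hvV hv1 hv2 hv3 using hJ
  let Y : Fin s × Fin d → Submodule ℂ (Fin r → ℂ) := fun p => V ⊔ fl (M p.1) (J p.1 p.2 + 1)
  let Θ : (V →ₗ[ℂ] (Fin r → ℂ) ⧸ V) →ₗ[ℂ] (∀ p : Fin s × Fin d, (Fin r → ℂ) ⧸ Y p) :=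
    LinearMap.pi fun p => (Submodule.factor (le_sup_left : V ≤ Y p)).comp
      (LinearMap.applyₗ (⟨v p.1 p.2, hvV p.1 p.2⟩ : V))
  have hq : (finrank ℂ ((Fin r → ℂ) ⧸ V) : ℤ) = r - d := by
    have := Submodule.finrank_quotient_add_finrank V
    rw [hd] at this
    simp at this
    omega
  have hYf : ∀ p, (finrank ℂ ((Fin r → ℂ) ⧸ Y p) : ℤ) = (r:ℤ) - d - ((J p.1 p.2 : ℤ) - p.2) := by
    intro p
    have h1 := Submodule.finrank_quotient_add_finrank (Y p)
    have h2 := Submodule.finrank_sup_add_finrank_inf_eq V (fl (M p.1) (J p.1 p.2 + 1))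
    rw [hcnt, count_eq (hJm p.1), hd, finrank_fl (hM p.1) (J p.1 p.2).2] at h2
    simp at h1
    have h3 : finrank ℂ ↥(Y p) = finrank ℂ ↥(V ⊔ fl (M p.1) (J p.1 p.2 + 1)) := rfl
    omega
  have hlt : finrank ℂ (∀ p : Fin s × Fin d, (Fin r → ℂ) ⧸ Y p)
      < finrank ℂ (V →ₗ[ℂ] (Fin r → ℂ) ⧸ V) := by
    rw [Module.finrank_pi_fintype, Module.finrank_linearMap, hd]
    zify
    rw [hq, Finset.sum_congr rfl (fun p _ => hYf p), Fintype.sum_prod_type]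
    unfold edim dimI at hpos
    have : ∑ x : Fin s, ∑ y : Fin d, ((r:ℤ) - d - ((J x y : ℤ) - y))
      = ∑ l : Fin s, ((d : ℤ) * ((r : ℤ) - (d : ℤ)) - ∑ k : Fin d, ((J l k : ℤ) - (k : ℤ))) := by
      refine Finset.sum_congr rfl fun l _ => ?_
      rw [Finset.sum_sub_distrib]
      simp
      ring
    rw [this]
    linarith
  have hker := LinearMap.ker_ne_bot_of_finrank_lt (f := Θ) hlt
  obtain ⟨φ, hφ, hφ0⟩ := Submodule.exists_mem_ne_zero_of_ne_bot hker
  apply hφ0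
  have hφk : ∀ l k, φ ⟨v l k, hvV l k⟩ ∈ (fl (M l) (J l k + 1)).map V.mkQ := by
    intro l k
    have h1 : Submodule.factor (le_sup_left : V ≤ Y (l,k)) (φ ⟨v l k, hvV l k⟩) = 0 :=
      congrFun (LinearMap.mem_ker.1 hφ) (l,k)
    obtain ⟨w, hw⟩ := V.mkQ_surjective (φ ⟨v l k, hvV l k⟩)
    rw [← hw] at h1 ⊢
    have h2 : w ∈ Y (l,k) := by
      have : (Submodule.Quotient.mk w : (Fin r → ℂ) ⧸ Y (l,k)) = 0 := h1
      exact (Submodule.Quotient.mk_eq_zero _).1 this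
    obtain ⟨a, ha, b, hb, rfl⟩ := Submodule.mem_sup.1 h2
    refine ⟨b, hb, ?_⟩
    have : V.mkQ a = 0 := by simpa using ha
    rw [map_add, this, zero_add]
  refine HN_hom (fun p : Fin s × Fin r => cw (Λ p.1) p.2) (fun p => hc p.1 p.2)
    (fun p => fl (M p.1) (p.2 + 1)) μ V hV hmax hdim φ ?_
  rintro ⟨l, j⟩ x hx
  have hx1 := hv3 l x x.2
  have hx2 : x = ∑ k, ((M l)⁻¹.mulVec (x : Fin r → ℂ)) (J l k) • (⟨v l k, hvV l k⟩ : V) := by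
    apply Subtype.ext
    rw [AddSubmonoidClass.coe_finsetSum]
    exact hx1
  rw [hx2, map_sum]
  refine Submodule.sum_mem _ fun k _ => ?_
  rw [map_smul]
  by_cases hk : (j : ℕ) + 1 ≤ J l k
  · rw [(mem_fl (hM l)).1 hx _ hk, zero_smul]; exact Submodule.zero_mem _
  · apply Submodule.smul_mem
    exact Submodule.map_mono (fl_mono _ (by show (J l k : ℕ) + 1 ≤ (j : ℕ) + 1; omega)) (hφk l k)

end KH
end

section
open Module
namespace KH

/-- Parameter type. -/
abbrev Par {s r d : ℕ} (J : Fin s → Fin d → Fin r) (e : Fin d → Fin r) : Type :=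
  ({b : Fin r // b ∉ Set.range e} × Fin d) ⊕
    (Σ l : Fin s, (({j : Fin r // j ∉ Set.range (J l)} × Fin r) ⊕ (Fin d × Fin d)) ⊕
      (Σ k : Fin d, {i : Fin r // i ∉ Set.range (J l) ∧ i < J l k}))

open Classical in
noncomputable def parN {s r d : ℕ} (J : Fin s → Fin d → Fin r) (e : Fin d → Fin r)
    (l : Fin s) (j i : Fin r) : MvPolynomial (Par J e) ℂ :=
  if h : j ∉ Set.range (J l) then MvPolynomial.X (Sum.inr ⟨l, Sum.inl (Sum.inl (⟨j, h⟩, i))⟩) else 0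

noncomputable def parY {s r d : ℕ} (J : Fin s → Fin d → Fin r) (e : Fin d → Fin r)
    (l : Fin s) (k a : Fin d) : MvPolynomial (Par J e) ℂ :=
  MvPolynomial.X (Sum.inr ⟨l, Sum.inl (Sum.inr (k, a))⟩)

open Classical in
noncomputable def parC {s r d : ℕ} (J : Fin s → Fin d → Fin r) (e : Fin d → Fin r)
    (l : Fin s) (k : Fin d) (i : Fin r) : MvPolynomial (Par J e) ℂ :=
  if h : i ∉ Set.range (J l) ∧ i < J l k then MvPolynomial.X (Sum.inr ⟨l, Sum.inr ⟨k, ⟨i, h⟩⟩⟩) else 0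

open Classical in
noncomputable def parB {s r d : ℕ} (J : Fin s → Fin d → Fin r) (e : Fin d → Fin r)
    (b : Fin r) (a : Fin d) : MvPolynomial (Par J e) ℂ :=
  if h : b ∉ Set.range e then MvPolynomial.X (Sum.inl (⟨b, h⟩, a)) else if b = e a then 1 else 0

/-- The parametrization. -/
noncomputable def psi {s r d : ℕ} (J : Fin s → Fin d → Fin r) (e : Fin d → Fin r)
    (p : Fin s × Fin r × Fin r) : MvPolynomial (Par J e) ℂ :=
  parN J e p.1 p.2.2 p.2.1 + ∑ k, if p.2.2 = J p.1 k then
    ((∑ a, parB J e p.2.1 a * parY J e p.1 k a) + ∑ i, parC J e p.1 k i * parN J e p.1 i p.2.1) else 0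

lemma card_aux {r d : ℕ} {J : Fin d → Fin r} (hJ : StrictMono J) (k : Fin d) :
    (Nat.card {i : Fin r // i ∉ Set.range J ∧ i < J k} : ℤ) = (J k : ℤ) - k := by
  classical
  rw [Nat.card_eq_fintype_card, Fintype.card_subtype]
  have h1 : Finset.univ.filter (fun i : Fin r => i ∉ Set.range J ∧ i < J k)
      = Finset.Iio (J k) \ (Finset.Iio k).image J := by
    ext i
    simp only [Finset.mem_filter, Finset.mem_univ, true_and, Finset.mem_sdiff, Finset.mem_Iio,
      Finset.mem_image, Set.mem_range]
    constructor
    · rintro ⟨a, b⟩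
      exact ⟨b, fun ⟨k', _, h⟩ => a ⟨k', h⟩⟩
    · rintro ⟨a, b⟩
      refine ⟨?_, a⟩
      rintro ⟨k', rfl⟩
      exact b ⟨k', hJ.lt_iff_lt.1 a, rfl⟩
  have hsub : (Finset.Iio k).image J ⊆ Finset.Iio (J k) := by
    intro i hi
    simp only [Finset.mem_image, Finset.mem_Iio] at hi ⊢
    obtain ⟨k', h, rfl⟩ := hi
    exact hJ h
  have h2 := Finset.card_sdiff_add_card_eq_card hsub
  rw [Finset.card_image_of_injective _ hJ.injective, Fin.card_Iio, Fin.card_Iio] at h2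
  rw [h1]
  omega

lemma card_compl {r d : ℕ} {J : Fin d → Fin r} (hJ : Function.Injective J) :
    (Nat.card {j : Fin r // j ∉ Set.range J} : ℤ) = (r : ℤ) - d := by
  classical
  have h := Fintype.card_subtype_compl (fun j : Fin r => j ∈ Set.range J)
  have h1 : Fintype.card {j : Fin r // j ∈ Set.range J} = d := by
    have := Set.card_range_of_injective hJ
    rw [Fintype.card_fin] at this
    exact (Fintype.card_congr (Equiv.refl _)).trans this
  rw [Nat.card_eq_fintype_card]
  have h2 := Fintype.card_le_of_injective _ hJ
  simp only [Fintype.card_fin] at h h2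
  rw [h1] at h
  rw [h]
  omega

lemma card_Par {s r d : ℕ} {J : Fin s → Fin d → Fin r} (hJ : ∀ l, StrictMono (J l))
    {e : Fin d → Fin r} (he : Function.Injective e) :
    (Nat.card (Par J e) : ℤ) = s * r * r + edim J := by
  classical
  rw [Nat.card_sum, Nat.card_prod, Nat.card_sigma]
  simp only [Nat.card_sum, Nat.card_prod, Nat.card_sigma]
  push_cast
  simp only [card_compl he, card_compl (hJ _).injective, card_aux (hJ _), Nat.card_fin]
  unfold edim dimI
  simp only [Finset.sum_add_distrib, Finset.sum_sub_distrib, Finset.sum_const, Finset.card_univ,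
    Fintype.card_fin, nsmul_eq_mul]
  ring

/-- `J` is realized at `M`. -/
def Rea {s r d : ℕ} (M : Fin s → Matrix (Fin r) (Fin r) ℂ) (J : Fin s → Fin d → Fin r) : Prop :=
  ∃ V : Submodule ℂ (Fin r → ℂ), finrank ℂ V = d ∧
    ∀ (l : Fin s) (k : Fin d), (k : ℕ) + 1 ≤ finrank ℂ ↥(V ⊓ fl (M l) (J l k + 1))

lemma sum_dJ {r d : ℕ} {J : Fin d → Fin r} (hJ : StrictMono J) (j : Fin r) (f : Fin d → ℂ) (k : Fin d)
    (h : j = J k) : (∑ k', if j = J k' then f k' else 0) = f k := by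
  subst h
  rw [Finset.sum_eq_single k]
  · simp
  · intro b _ hb; rw [if_neg]; intro h; exact hb (hJ.injective h).symm
  · simp

lemma rea_of_image {s r d : ℕ} {J : Fin s → Fin d → Fin r} (hJ : ∀ l, StrictMono (J l))
    {e : Fin d → Fin r} (he : Function.Injective e) (M : Fin s → Matrix (Fin r) (Fin r) ℂ)
    (hM : ∀ l, IsUnit (M l).det) (x : Par J e → ℂ)
    (hx : ∀ p, MvPolynomial.eval x (psi J e p) = M p.1 p.2.1 p.2.2) : Rea M J := by
  classical
  set N : Fin s → Fin r → Fin r → ℂ := fun l j i => MvPolynomial.eval x (parN J e l j i) with hN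
  set Y : Fin s → Fin d → Fin d → ℂ := fun l j i => MvPolynomial.eval x (parY J e l j i) with hY
  set C : Fin s → Fin d → Fin r → ℂ := fun l j i => MvPolynomial.eval x (parC J e l j i) with hC
  let B : Matrix (Fin r) (Fin d) ℂ := Matrix.of fun b a => MvPolynomial.eval x (parB J e b a)
  have hM1 : ∀ l i j, M l i j = N l j i + ∑ k, if j = J l k then
      (∑ a, B i a * Y l k a) + ∑ i', C l k i' * N l i' i else 0 := by
    intro l i j
    rw [← hx (l,i,j)]
    simp only [psi, map_add, map_sum]
    congr 1
    refine Finset.sum_congr rfl fun k _ => ?_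
    split_ifs
    · simp only [map_add, map_sum, map_mul]; rfl
    · simp
  have hBe : ∀ a a', B (e a) a' = if a = a' then 1 else 0 := by
    intro a a'
    simp only [B, Matrix.of_apply, parB]
    rw [dif_neg (by simp)]
    by_cases h : a = a'
    · simp [h]
    · rw [if_neg h, if_neg (fun h2 => h (he h2)), map_zero]
  have hBinj : Function.Injective B.mulVecLin := by
    intro y z h
    ext a
    have := congrFun h (e a)
    simpa [Matrix.mulVec, dotProduct, hBe] using this
  have hNz : ∀ l k i, N l (J l k) i = 0 := by
    intro l k i; simp only [hN, parN]; rw [dif_neg (by simp), map_zero]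
  have hCz : ∀ l k i, ¬ (i ∉ Set.range (J l) ∧ i < J l k) → C l k i = 0 := by
    intro l k i h; simp only [hC, parC]; rw [dif_neg h, map_zero]
  have hMN : ∀ l j i, j ∉ Set.range (J l) → M l i j = N l j i := by
    intro l j i h
    rw [hM1, Finset.sum_eq_zero, add_zero]
    intro k _
    rw [if_neg]; rintro rfl; exact h ⟨k, rfl⟩
  have hMJ : ∀ l k i, M l i (J l k) = (B.mulVecLin (Y l k)) i + ∑ i', C l k i' * M l i i' := by
    intro l k i
    rw [hM1, hNz, zero_add, sum_dJ (hJ l) _ _ k rfl]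
    congr 1
    refine Finset.sum_congr rfl fun i' _ => ?_
    by_cases h : i' ∈ Set.range (J l)
    · rw [hCz _ _ _ (fun h2 => h2.1 h)]; simp
    · rw [hMN _ _ _ h]
  -- coordinates
  have hBy : ∀ l k, (M l)⁻¹.mulVec (B.mulVecLin (Y l k)) = fun i => (if i = J l k then 1 else 0) - C l k i := by
    intro l k
    have h1 : B.mulVecLin (Y l k) = (M l).mulVec (fun i => (if i = J l k then 1 else 0) - C l k i) := by
      ext i
      simp only [Matrix.mulVec, dotProduct, mul_sub, Finset.sum_sub_distrib, mul_ite, mul_one, mul_zero,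
        Finset.sum_ite_eq', Finset.mem_univ, if_true, hMJ]
      have : ∑ i', C l k i' * M l i i' = ∑ i', M l i i' * C l k i' :=
        Finset.sum_congr rfl fun _ _ => mul_comm _ _
      rw [this]; ring
    rw [h1, Matrix.mulVec_mulVec, Matrix.nonsing_inv_mul _ (hM l), Matrix.one_mulVec]
  refine ⟨LinearMap.range B.mulVecLin, ?_, ?_⟩
  · rw [LinearMap.finrank_range_of_inj hBinj]; simp
  · intro l k
    let u : Fin (k+1) → Fin r → ℂ := fun q => B.mulVecLin (Y l ⟨q, by omega⟩)
    have hu : ∀ q, u q ∈ LinearMap.range B.mulVecLin ⊓ fl (M l) (J l k + 1) := by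
      intro q
      refine ⟨⟨_, rfl⟩, ?_⟩
      refine (mem_fl (hM l)).2 ?_
      intro i hi
      have hle : J l ⟨q, by omega⟩ ≤ J l k := (hJ l).monotone (by rw [Fin.le_def]; simp; omega)
      simp only [u, hBy]
      rw [hCz, if_neg]
      · simp
      · rintro rfl; rw [Fin.le_def] at hle; omega
      · rintro ⟨_, h⟩; rw [Fin.le_def] at hle; rw [Fin.lt_def] at h; omega
    have hli : LinearIndependent ℂ u := by
      rw [Fintype.linearIndependent_iff]
      intro g hg q
      have h1 := congrArg (fun z => (M l)⁻¹.mulVec z (J l ⟨q, by omega⟩)) hg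
      have h2 : ∀ q' : Fin (k+1), (M l)⁻¹.mulVec (u q') (J l ⟨q, by omega⟩) = if q' = q then 1 else 0 := by
        intro q'
        simp only [u, hBy]
        rw [hCz _ _ _ (by simp), sub_zero]
        simp only [(hJ l).injective.eq_iff, Fin.mk.injEq]
        simp [Fin.ext_iff, eq_comm]
      simp only [Matrix.mulVec_sum, Matrix.mulVec_smul, Finset.sum_apply, Pi.smul_apply, h2,
        Matrix.mulVec_zero] at h1
      simpa using h1
    let u' : Fin (k+1) → ↥(LinearMap.range B.mulVecLin ⊓ fl (M l) (J l k + 1)) := fun q => ⟨u q, hu q⟩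
    have hli' : LinearIndependent ℂ u' :=
      LinearIndependent.of_comp (Submodule.subtype _) hli
    have := hli'.fintype_card_le_finrank
    simpa using this

lemma image_of_pos {s r d : ℕ} {J : Fin s → Fin d → Fin r}
    (M : Fin s → Matrix (Fin r) (Fin r) ℂ)
    (hM : ∀ l, IsUnit (M l).det) (V : Submodule ℂ (Fin r → ℂ)) (hd : finrank ℂ V = d)
    (hV : ∀ l, IsPos (M l) V (J l)) : ∃ e : Fin d → Fin r, Function.Injective e ∧ ∃ x : Par J e → ℂ,
    ∀ p, MvPolynomial.eval x (psi J e p) = M p.1 p.2.1 p.2.2 := by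
  classical
  choose hJm hcnt v hvV hv1 hv2 hv3 using hV
  obtain ⟨e, he, -, w, hwV, -, hw2, hw3⟩ := pos_exists (M := 1) (by simp) V hd
  simp only [inv_one, Matrix.one_mulVec] at hw2 hw3
  refine ⟨e, he.injective, Sum.elim (fun q => w q.2 q.1) (fun q => Sum.elim (Sum.elim
    (fun z => M q.1 z.2 z.1) (fun z => v q.1 z.1 (e z.2)))
    (fun z => - (M q.1)⁻¹.mulVec (v q.1 z.1) z.2) q.2), ?_⟩
  rintro ⟨l, i, j⟩
  simp only [psi, map_add, map_sum]
  by_cases hj : j ∈ Set.range (J l)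
  · obtain ⟨k, rfl⟩ := hj
    simp only [apply_ite (MvPolynomial.eval _), map_zero]
    rw [sum_dJ (hJm l) _ _ k rfl]
    simp only [parN, parB, parY, parC]
    rw [dif_neg (by simp)]
    simp only [map_add, map_sum, map_mul, map_zero, zero_add, apply_dite (MvPolynomial.eval _),
      MvPolynomial.eval_X, Sum.elim_inl, Sum.elim_inr, apply_ite (MvPolynomial.eval _), map_one]
    have h1 : ∀ a, (if h : i ∉ Set.range e then w a i else if i = e a then (1:ℂ) else 0) = w a i := by
      intro a
      split_ifs with h h2
      · rw [h2, hw2]; simp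
      · obtain ⟨a', rfl⟩ := h
        rw [hw2, if_neg]
        rintro rfl; exact h2 rfl
      · rfl
    simp only [h1]
    have h2 : ∑ a, w a i * v l k (e a) = v l k i := by
      have := congrFun (hw3 _ (hvV l k)) i
      rw [this]
      simp [Finset.sum_apply, mul_comm]
    rw [h2]
    have h3 : v l k i = ∑ j, M l i j * ((M l)⁻¹.mulVec (v l k)) j := by
      have : v l k = (M l).mulVec ((M l)⁻¹.mulVec (v l k)) := by
        rw [Matrix.mulVec_mulVec, Matrix.mul_nonsing_inv _ (hM l), Matrix.one_mulVec]
      exact congrFun this i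
    rw [h3, ← Finset.sum_add_distrib, Finset.sum_eq_single (J l k)]
    · rw [hv2]; simp
    · intro j _ hj
      split_ifs with ha hb hb
      · exact absurd hb ha.1
      · ring
      · obtain ⟨k', rfl⟩ := hb
        rw [hv2, if_neg]
        · simp
        · rintro rfl; exact hj rfl
      · rw [not_and_or, not_not] at ha
        have hlt : J l k < j := by
          rcases ha with ha | ha
          · exact absurd ha hb
          · exact lt_of_le_of_ne (not_lt.1 ha) (Ne.symm hj)
        rw [hv1 l k j hlt]; simp
    · simp
  · rw [Finset.sum_eq_zero, add_zero]
    · simp [parN, hj]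
    · intro k _
      rw [if_neg]
      · simp
      · rintro rfl; exact hj ⟨k, rfl⟩

/-- the point of affine space given by a tuple of matrices -/
def pt {s r : ℕ} (M : Fin s → Matrix (Fin r) (Fin r) ℂ) : Fin s × Fin r × Fin r → ℂ :=
  fun p => M p.1 p.2.1 p.2.2

lemma generic {s r d : ℕ} (J : Fin s → Fin d → Fin r) (hJ : ∀ l, StrictMono (J l)) :
    ∃ f : MvPolynomial (Fin s × Fin r × Fin r) ℂ, f ≠ 0 ∧
      ∀ M : Fin s → Matrix (Fin r) (Fin r) ℂ, (∀ l, IsUnit (M l).det) →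
        MvPolynomial.eval (pt M) f ≠ 0 →
        ∀ V : Submodule ℂ (Fin r → ℂ), finrank ℂ V = d → (∀ l, IsPos (M l) V (J l)) →
          0 ≤ edim J ∧ ∀ M' : Fin s → Matrix (Fin r) (Fin r) ℂ, (∀ l, IsUnit (M' l).det) →
            MvPolynomial.eval (pt M') f ≠ 0 → Rea M' J := by
  classical
  have key : ∀ e : {e : Fin d → Fin r // Function.Injective e},
      ∃ f : MvPolynomial (Fin s × Fin r × Fin r) ℂ, f ≠ 0 ∧
      ∀ M : Fin s → Matrix (Fin r) (Fin r) ℂ,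
        MvPolynomial.eval (pt M) f ≠ 0 →
        (∃ x : Par J e.1 → ℂ, ∀ p, MvPolynomial.eval x (psi J e.1 p) = M p.1 p.2.1 p.2.2) →
          0 ≤ edim J ∧ ∀ M' : Fin s → Matrix (Fin r) (Fin r) ℂ, (∀ l, IsUnit (M' l).det) →
            MvPolynomial.eval (pt M') f ≠ 0 → Rea M' J := by
    rintro ⟨e, he⟩
    by_cases hinj : ∀ p : MvPolynomial (Fin s × Fin r × Fin r) ℂ, MvPolynomial.aeval (psi J e) p = 0 → p = 0
    · obtain ⟨f, hf, hf2⟩ := dicho (psi J e) hinj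
      refine ⟨f, hf, fun M _ _ => ⟨?_, ?_⟩⟩
      · have h1 := card_le_of_inj (psi J e) hinj
        have h2 := card_Par hJ he
        rw [Nat.card_eq_fintype_card] at h2
        simp only [Fintype.card_prod, Fintype.card_fin] at h1
        have h3 : ((s * (r * r) : ℕ) : ℤ) ≤ (Fintype.card (Par J e) : ℤ) := by exact_mod_cast h1
        rw [h2] at h3
        push_cast at h3
        linarith
      · intro M' hM' hfM'
        obtain ⟨x, hx⟩ := hf2 _ hfM'
        exact rea_of_image hJ he M' hM' x hx
    · push Not at hinj
      obtain ⟨p, hp, hp0⟩ := hinj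
      refine ⟨p, hp0, ?_⟩
      rintro M hM ⟨x, hx⟩
      exfalso
      apply hM
      have h1 := congrArg (MvPolynomial.eval x) hp
      rw [map_zero] at h1
      rw [← h1]
      have h2 : pt M = fun p => MvPolynomial.eval x (psi J e p) := by
        funext p; rw [hx]; rfl
      rw [h2, ← MvPolynomial.coe_aeval_eq_eval]
      have h3 : (MvPolynomial.eval x) ((MvPolynomial.aeval (psi J e)) p)
        = MvPolynomial.aeval (fun q => MvPolynomial.eval x (psi J e q)) p := by
        rw [← MvPolynomial.coe_aeval_eq_eval, MvPolynomial.aeval_def, MvPolynomial.aeval_def,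
          ]
        simp only [RingHom.coe_coe]
        have := MvPolynomial.comp_aeval (R := ℂ) (psi J e) (MvPolynomial.aeval x : MvPolynomial (Par J e) ℂ →ₐ[ℂ] ℂ)
        exact DFunLike.congr_fun this p
      rw [h3]; rfl
  choose f hf hf2 using key
  refine ⟨∏ e, f e, Finset.prod_ne_zero_iff.2 fun e _ => hf e, ?_⟩
  intro M hM hfM V hd hV
  obtain ⟨e, he, hx⟩ := image_of_pos M hM V hd hV
  simp only [map_prod, Finset.prod_ne_zero_iff] at hfM ⊢
  obtain ⟨h1, h2⟩ := hf2 ⟨e, he⟩ M (hfM _ (Finset.mem_univ _)) hx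
  exact ⟨h1, fun M' hM' hfM' => h2 M' hM' (hfM' _ (Finset.mem_univ _))⟩

end KH
end

section
open Module
namespace KH

lemma star_dot_self {r : ℕ} (v : Fin r → ℂ) : star v ⬝ᵥ v = ((∑ i, ‖v i‖ ^ 2 : ℝ) : ℂ) := by
  simp only [dotProduct, Pi.star_apply, RCLike.star_def]
  push_cast
  refine Finset.sum_congr rfl fun i _ => ?_
  rw [Complex.conj_mul']

lemma star_dot_comm {r : ℕ} (a b : Fin r → ℂ) : star (star a ⬝ᵥ b) = star b ⬝ᵥ a := by
  simp only [dotProduct, star_sum, star_mul, Pi.star_apply, star_star]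

lemma exists_unit {r : ℕ} (v : Fin r → ℂ) (hv : v ≠ 0) : ∃ c : ℂ, star (c • v) ⬝ᵥ (c • v) = 1 := by
  set S : ℝ := ∑ i, ‖v i‖ ^ 2 with hS
  have hpos : 0 < S := by
    obtain ⟨i, hi⟩ := Function.ne_iff.1 hv
    refine Finset.sum_pos' (fun _ _ => by positivity) ⟨i, Finset.mem_univ _, ?_⟩
    have : 0 < ‖v i‖ := norm_pos_iff.2 hi
    positivity
  refine ⟨((Real.sqrt S)⁻¹ : ℝ), ?_⟩
  rw [star_smul, smul_dotProduct, dotProduct_smul, star_dot_self, ← hS]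
  simp only [smul_eq_mul, RCLike.star_def, Complex.conj_ofReal]
  rw [← Complex.ofReal_mul, ← Complex.ofReal_mul]
  have h2 : Real.sqrt S * Real.sqrt S = S := Real.mul_self_sqrt hpos.le
  have h3 : Real.sqrt S ≠ 0 := (Real.sqrt_pos.2 hpos).ne'
  norm_cast
  field_simp
  nlinarith

lemma adapt_aux {r : ℕ} : ∀ (d : ℕ) (G : Fin d → Submodule ℂ (Fin r → ℂ)),
    (∀ k : Fin d, (k : ℕ) + 1 ≤ finrank ℂ (G k)) →
    ∃ u : Fin d → Fin r → ℂ, (∀ k, u k ∈ G k) ∧ ∀ k k', star (u k) ⬝ᵥ u k' = if k = k' then 1 else 0 := by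
  intro d
  induction d with
  | zero => intro G _; exact ⟨fun k => k.elim0, fun k => k.elim0, fun k => k.elim0⟩
  | succ d ih =>
    intro G hG
    obtain ⟨u, hu, ho⟩ := ih (fun k => G k.castSucc) (fun k => by simpa using hG k.castSucc)
    let f : G (Fin.last d) →ₗ[ℂ] (Fin d → ℂ) := LinearMap.pi fun k =>
      (dotProductBilin ℂ ℂ (star (u k))).comp (G (Fin.last d)).subtype
    have hlt : finrank ℂ (Fin d → ℂ) < finrank ℂ (G (Fin.last d)) := by
      have := hG (Fin.last d)
      simp at this ⊢
      omega
    obtain ⟨w, hw, hw0⟩ := Submodule.exists_mem_ne_zero_of_ne_bot (LinearMap.ker_ne_bot_of_finrank_lt (f := f) hlt)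
    have hw1 : ∀ k, star (u k) ⬝ᵥ (w : Fin r → ℂ) = 0 := fun k => congrFun (LinearMap.mem_ker.1 hw) k
    obtain ⟨c, hc⟩ := exists_unit (w : Fin r → ℂ) (fun h => hw0 (Subtype.ext h))
    have hw2 : ∀ k, star (u k) ⬝ᵥ (c • (w : Fin r → ℂ)) = 0 := fun k => by
      rw [dotProduct_smul, hw1, smul_zero]
    have hw3 : ∀ k, star (c • (w : Fin r → ℂ)) ⬝ᵥ u k = 0 := fun k => by
      have := congrArg star (hw2 k)
      rw [star_zero, star_dot_comm] at this
      exact this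
    refine ⟨Fin.snoc u (c • (w : Fin r → ℂ)), ?_, ?_⟩
    · intro k
      refine Fin.lastCases ?_ (fun k => ?_) k
      · simpa using Submodule.smul_mem _ c w.2
      · simpa using hu k
    · intro k k'
      refine Fin.lastCases ?_ (fun k => ?_) k
      · refine Fin.lastCases ?_ (fun k' => ?_) k'
        · simpa using hc
        · rw [Fin.snoc_last, Fin.snoc_castSucc, hw3, if_neg]
          exact (Fin.castSucc_lt_last k').ne'
      · refine Fin.lastCases ?_ (fun k' => ?_) k'
        · rw [Fin.snoc_last, Fin.snoc_castSucc, hw2, if_neg]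
          exact (Fin.castSucc_lt_last k).ne
        · rw [Fin.snoc_castSucc, Fin.snoc_castSucc, ho]
          simp

lemma adapt {r d : ℕ} (G : Fin d → Submodule ℂ (Fin r → ℂ))
    (hG : ∀ k : Fin d, (k : ℕ) + 1 ≤ finrank ℂ (G k)) :
    ∃ Q : Matrix (Fin r) (Fin d) ℂ, Q.conjTranspose * Q = 1 ∧ ∀ k, (fun i => Q i k) ∈ G k := by
  obtain ⟨u, hu, ho⟩ := adapt_aux d G hG
  refine ⟨Matrix.of fun i k => u k i, ?_, hu⟩
  ext k k'
  rw [Matrix.one_apply, ← ho k k']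
  rfl

lemma iso_inj {r d : ℕ} {Q : Matrix (Fin r) (Fin d) ℂ} (hQ : Q.conjTranspose * Q = 1) :
    Function.Injective Q.mulVecLin := by
  intro x y h
  have := congrArg (fun z => Q.conjTranspose.mulVec z) h
  simpa [Matrix.mulVec_mulVec, hQ] using this

lemma mulVec_cols {r d : ℕ} (Q : Matrix (Fin r) (Fin d) ℂ) (y : Fin d → ℂ) :
    Q.mulVec y = ∑ k, y k • (fun i => Q i k) := by
  ext i
  simp [Matrix.mulVec, dotProduct, mul_comm]

lemma range_iso {r d : ℕ} {Q : Matrix (Fin r) (Fin d) ℂ} (hQ : Q.conjTranspose * Q = 1)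
    (V : Submodule ℂ (Fin r → ℂ)) (hV : finrank ℂ V = d) (h : ∀ k, (fun i => Q i k) ∈ V) :
    LinearMap.range Q.mulVecLin = V := by
  apply Submodule.eq_of_le_of_finrank_eq
  · rintro _ ⟨y, rfl⟩
    rw [Matrix.mulVecLin_apply, mulVec_cols]
    exact Submodule.sum_mem _ fun k _ => Submodule.smul_mem _ _ (h k)
  · rw [LinearMap.finrank_range_of_inj (iso_inj hQ), hV]; simp

lemma proj_fix {r d d' : ℕ} {Q : Matrix (Fin r) (Fin d) ℂ} (hQ : Q.conjTranspose * Q = 1)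
    (R : Matrix (Fin r) (Fin d') ℂ) (h : ∀ k, (fun i => R i k) ∈ LinearMap.range Q.mulVecLin) :
    Q * Q.conjTranspose * R = R := by
  ext i k
  obtain ⟨y, hy⟩ := h k
  have h1 : (Q * Q.conjTranspose).mulVec (fun i => R i k) = fun i => R i k := by
    rw [← hy, Matrix.mulVecLin_apply, Matrix.mulVec_mulVec, Matrix.mul_assoc, hQ, Matrix.mul_one]
  exact congrFun h1 i

lemma proj_eq {r d : ℕ} {Q R : Matrix (Fin r) (Fin d) ℂ} (hQ : Q.conjTranspose * Q = 1)
    (hR : R.conjTranspose * R = 1)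
    (V : Submodule ℂ (Fin r → ℂ)) (hV : finrank ℂ V = d) (h : ∀ k, (fun i => Q i k) ∈ V)
    (h' : ∀ k, (fun i => R i k) ∈ V) : Q * Q.conjTranspose = R * R.conjTranspose := by
  have h1 := proj_fix hQ R (by rw [range_iso hQ V hV h]; exact h')
  have h2 := proj_fix hR Q (by rw [range_iso hR V hV h']; exact h)
  have h3 : Q * Q.conjTranspose * (R * R.conjTranspose) = R * R.conjTranspose := by
    rw [← Matrix.mul_assoc, h1]
  have h4 : R * R.conjTranspose * (Q * Q.conjTranspose) = Q * Q.conjTranspose := by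
    rw [← Matrix.mul_assoc, h2]
  have h5 := congrArg Matrix.conjTranspose h3
  simp only [Matrix.conjTranspose_mul, Matrix.conjTranspose_conjTranspose, Matrix.mul_assoc] at h5
  rw [← h4, Matrix.mul_assoc, h5]

lemma iso_compact (r d : ℕ) : IsCompact {Q : Matrix (Fin r) (Fin d) ℂ | Q.conjTranspose * Q = 1} := by
  have h1 : IsCompact (Set.pi Set.univ fun _ : Fin r => Set.pi Set.univ
      fun _ : Fin d => Metric.closedBall (0:ℂ) 1) :=
    isCompact_univ_pi fun _ => isCompact_univ_pi fun _ => isCompact_closedBall _ _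
  refine h1.of_isClosed_subset ?_ ?_
  · refine isClosed_eq ?_ continuous_const
    fun_prop
  · intro Q hQ i _ k _
    rw [mem_closedBall_zero_iff]
    have h2 : star (fun i => Q i k) ⬝ᵥ (fun i => Q i k) = 1 := by
      have := congrFun (congrFun hQ k) k
      rw [Matrix.one_apply_eq] at this
      exact this
    rw [star_dot_self] at h2
    have h3 : ∑ i, ‖Q i k‖ ^ 2 = 1 := by exact_mod_cast h2
    have h4 : ‖Q i k‖ ^ 2 ≤ 1 := by
      rw [← h3]
      exact Finset.single_le_sum (f := fun i => ‖Q i k‖ ^ 2) (fun _ _ => by positivity) (Finset.mem_univ i)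
    have := norm_nonneg (Q i k)
    nlinarith

lemma finrank_ge_cols {r d : ℕ} {Q : Matrix (Fin r) (Fin d) ℂ} (hQ : Q.conjTranspose * Q = 1)
    (k : Fin d) (G : Submodule ℂ (Fin r → ℂ)) (h : ∀ k' ≤ k, (fun i => Q i k') ∈ G) :
    (k : ℕ) + 1 ≤ finrank ℂ G := by
  have hli : LinearIndependent ℂ (fun k i => Q i k) := by
    rw [Fintype.linearIndependent_iff]
    intro g hg q
    rw [← mulVec_cols] at hg
    have : g = 0 := iso_inj hQ (by simpa using hg)
    rw [this]; rfl
  let u' : Finset.Iic k → G := fun q => ⟨fun i => Q i q, h q (Finset.mem_Iic.1 q.2)⟩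
  have hli' : LinearIndependent ℂ u' :=
    LinearIndependent.of_comp (Submodule.subtype _) (hli.comp (Subtype.val : Finset.Iic k → Fin d) Subtype.val_injective)
  have := hli'.fintype_card_le_finrank
  rw [Fintype.card_coe, Fin.card_Iic] at this
  exact this

lemma fl_eq_flag {r : ℕ} (F : Flagg r) : ∃ U : Matrix (Fin r) (Fin r) ℂ, U.conjTranspose * U = 1 ∧
    IsUnit U.det ∧ ∀ j : Fin r, fl U (j + 1) = F.F j := by
  obtain ⟨U, hU, hc⟩ := adapt F.F (fun k => (F.rank_eq k).ge)
  have hdet : IsUnit U.det := by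
    have := congrArg Matrix.det hU
    rw [Matrix.det_mul, Matrix.det_one] at this
    exact IsUnit.of_mul_eq_one_right _ this
  refine ⟨U, hU, hdet, fun j => ?_⟩
  apply Submodule.eq_of_le_of_finrank_eq
  · rintro _ ⟨y, hy, rfl⟩
    rw [Matrix.mulVecLin_apply, mulVec_cols]
    refine Submodule.sum_mem _ fun k _ => ?_
    by_cases hk : k ≤ j
    · exact Submodule.smul_mem _ _ (F.mono hk (hc k))
    · rw [hy k (by rw [Fin.le_def] at hk; omega), zero_smul]; exact Submodule.zero_mem _
  · rw [finrank_fl hdet j.2, F.rank_eq]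

/-- inverse of `pt` -/
def unpt {s r : ℕ} (m : Fin s × Fin r × Fin r → ℂ) : Fin s → Matrix (Fin r) (Fin r) ℂ :=
  fun l => Matrix.of fun i j => m (l, i, j)

lemma pt_unpt {s r : ℕ} (m : Fin s × Fin r × Fin r → ℂ) : pt (unpt m) = m := rfl

lemma unpt_pt {s r : ℕ} (M : Fin s → Matrix (Fin r) (Fin r) ℂ) : unpt (pt M) = M := rfl

/-- product of all determinants -/
noncomputable def detP (s r : ℕ) : MvPolynomial (Fin s × Fin r × Fin r) ℂ :=
  ∏ l : Fin s, Matrix.det (Matrix.of fun i j : Fin r => MvPolynomial.X (R := ℂ) (l, i, j))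

lemma eval_detP {s r : ℕ} (m : Fin s × Fin r × Fin r → ℂ) :
    MvPolynomial.eval m (detP s r) = ∏ l, (unpt m l).det := by
  unfold detP
  rw [map_prod]
  refine Finset.prod_congr rfl fun l _ => ?_
  rw [RingHom.map_det]
  congr 1
  ext i j
  simp [unpt]

lemma detP_ne (s r : ℕ) : detP s r ≠ 0 := by
  intro h
  have h1 := eval_detP (pt (fun _ : Fin s => (1 : Matrix (Fin r) (Fin r) ℂ)))
  rw [h, unpt_pt] at h1
  simp at h1

lemma detP_unit {s r : ℕ} {M : Fin s → Matrix (Fin r) (Fin r) ℂ}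
    (h : MvPolynomial.eval (pt M) (detP s r) ≠ 0) (l : Fin s) : IsUnit (M l).det := by
  rw [eval_detP, unpt_pt, Finset.prod_ne_zero_iff] at h
  exact isUnit_iff_ne_zero.2 (h l (Finset.mem_univ _))

lemma intersecting_of {s r d : ℕ} (hs : 0 < s) (J : Fin s → Fin d → Fin r) (hJ : ∀ l, StrictMono (J l))
    (f : MvPolynomial (Fin s × Fin r × Fin r) ℂ) (hf : f ≠ 0)
    (h : ∀ M' : Fin s → Matrix (Fin r) (Fin r) ℂ, (∀ l, IsUnit (M' l).det) →
            MvPolynomial.eval (pt M') f ≠ 0 → Rea M' J) : Intersecting J := by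
  let l0 : Fin s := ⟨0, hs⟩
  let K : Set (Fin s → Matrix (Fin r) (Fin d) ℂ) := Set.pi Set.univ fun _ => {Q | Q.conjTranspose * Q = 1}
  have hK : IsCompact K := isCompact_univ_pi fun _ => iso_compact r d
  have : CompactSpace K := isCompact_iff_compactSpace.1 hK
  let C : Set ((Fin s × Fin r × Fin r → ℂ) × K) := {p | (∀ l, p.2.1 l * (p.2.1 l).conjTranspose
      = p.2.1 l0 * (p.2.1 l0).conjTranspose) ∧
      ∀ l k i, J l k < i → ((unpt p.1 l).adjugate * p.2.1 l) i k = 0}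
  have hunpt : Continuous (unpt : (Fin s × Fin r × Fin r → ℂ) → (Fin s → Matrix (Fin r) (Fin r) ℂ)) := by
    refine continuous_pi fun l => continuous_matrix fun i j => ?_
    exact continuous_apply _
  have hC : IsClosed C := by
    have hc2 : ∀ l, Continuous fun p : (Fin s × Fin r × Fin r → ℂ) × K => p.2.1 l := fun l =>
      (continuous_apply l).comp (continuous_subtype_val.comp continuous_snd)
    have hc1 : ∀ l, Continuous fun p : (Fin s × Fin r × Fin r → ℂ) × K => (unpt p.1 l).adjugate := fun l =>
      Continuous.matrix_adjugate ((continuous_apply l).comp (hunpt.comp continuous_fst))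
    have e : C = (⋂ l, {p | p.2.1 l * (p.2.1 l).conjTranspose
      = p.2.1 l0 * (p.2.1 l0).conjTranspose}) ∩ ⋂ l, ⋂ k, ⋂ i, ⋂ (_ : J l k < i),
        {p | ((unpt p.1 l).adjugate * p.2.1 l) i k = 0} := by
      ext p; simp [C]
    rw [e]
    refine IsClosed.inter (isClosed_iInter fun l => ?_) (isClosed_iInter fun l => isClosed_iInter fun k =>
      isClosed_iInter fun i => isClosed_iInter fun _ => ?_)
    · exact isClosed_eq ((hc2 l).matrix_mul (hc2 l).matrix_conjTranspose)
        ((hc2 l0).matrix_mul (hc2 l0).matrix_conjTranspose)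
    · exact isClosed_eq (((hc1 l).matrix_mul (hc2 l)).matrix_elem i k) continuous_const
  have hZ : IsClosed (Prod.fst '' C) := isClosedMap_fst_of_compactSpace _ hC
  have hdense := dense_ne (f * detP s r) (mul_ne_zero hf (detP_ne s r))
  have hall : Prod.fst '' C = Set.univ := by
    rw [← hZ.closure_eq]
    apply Dense.closure_eq
    refine hdense.mono ?_
    intro m hm
    have hm' : MvPolynomial.eval (pt (unpt m)) (f * detP s r) ≠ 0 := hm
    rw [map_mul] at hm'
    have hM := detP_unit (right_ne_zero_of_mul hm')
    obtain ⟨V, hVd, hV⟩ := h (unpt m) hM (left_ne_zero_of_mul hm')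
    choose Q hQ hQV using fun l => adapt (fun k => V ⊓ fl (unpt m l) (J l k + 1)) (hV l)
    refine ⟨(m, ⟨Q, fun l _ => hQ l⟩), ⟨?_, ?_⟩, rfl⟩
    · intro l
      exact proj_eq (hQ l) (hQ l0) V hVd (fun k => (hQV l k).1) (fun k => (hQV l0 k).1)
    · intro l k i hi
      have h1 := (mem_fl (hM l)).1 (hQV l k).2 i hi
      have h2 : ((unpt m l).adjugate * Q l) i k = (unpt m l).det * ((unpt m l)⁻¹.mulVec (fun i => Q l i k)) i := by
        have : (unpt m l).adjugate = (unpt m l).det • (unpt m l)⁻¹ := by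
          rw [Matrix.inv_def, smul_smul, Ring.mul_inverse_cancel _ (hM l), one_smul]
        rw [this, Matrix.smul_mul, Matrix.smul_apply]
        rfl
      rw [h1, mul_zero] at h2
      exact h2
  intro F
  choose U hU hUd hUF using fun l => fl_eq_flag (F l)
  have hmem : pt U ∈ Prod.fst '' C := by rw [hall]; trivial
  obtain ⟨⟨m, ⟨Q, hQ⟩⟩, ⟨h1, h2⟩, hm⟩ := hmem
  simp only at hm h1 h2
  subst hm
  have hQ' : ∀ l, (Q l).conjTranspose * Q l = 1 := fun l => hQ l trivial
  have hcol : ∀ l k, (fun i => Q l i k) ∈ (F l).F (J l k) := by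
    intro l k
    rw [← hUF, mem_fl (hUd l)]
    intro i hi
    have h3 := h2 l k i hi
    rw [unpt_pt] at h3
    have : (U l)⁻¹.mulVec (fun i => Q l i k) i = ((U l)⁻¹ * Q l) i k := rfl
    rw [this, Matrix.inv_def, Matrix.smul_mul, Matrix.smul_apply, h3, smul_zero]
  refine ⟨LinearMap.range (Q l0).mulVecLin, ?_, ?_⟩
  · rw [LinearMap.finrank_range_of_inj (iso_inj (hQ' l0))]; simp
  · intro l k
    refine finrank_ge_cols (hQ' l) k _ fun k' hk' => ⟨?_, (F l).mono ((hJ l).monotone hk') (hcol l k')⟩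
    have h4 : Q l0 * ((Q l0).conjTranspose * Q l) = Q l := by
      rw [← Matrix.mul_assoc, ← h1 l, Matrix.mul_assoc, hQ' l, Matrix.mul_one]
    refine ⟨fun i => ((Q l0).conjTranspose * Q l) i k', ?_⟩
    ext i
    exact congrFun (congrFun h4 i) k'

end KH
end

section
open Module
namespace KH

lemma le_of_count {r d : ℕ} {J : Fin d → Fin r} (hJ : StrictMono J) (k : Fin d) (i : Fin r)
    (h : (k : ℕ) + 1 ≤ (Finset.univ.filter fun k' : Fin d => (J k' : ℕ) < (i : ℕ) + 1).card) :
    J k ≤ i := by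
  by_contra hlt
  push Not at hlt
  have h1 : (Finset.univ.filter fun k' : Fin d => (J k' : ℕ) < (i : ℕ) + 1) ⊆ Finset.Iio k := by
    intro k' hk'
    simp only [Finset.mem_filter, Finset.mem_univ, true_and, Finset.mem_Iio] at hk' ⊢
    by_contra h2
    push Not at h2
    have := hJ.monotone h2
    rw [Fin.le_def] at this
    rw [Fin.lt_def] at hlt
    omega
  have h2 := Finset.card_le_card h1
  rw [Fin.card_Iio] at h2
  omega

lemma dg_top {s r : ℕ} (Λ : Fin s → Fin r → ℝ) (M : Fin s → Matrix (Fin r) (Fin r) ℂ)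
    (hM : ∀ l, IsUnit (M l).det) : dg Λ M ⊤ = TT Λ := by
  have h := dg_eq Λ M ⊤ (fun _ => id) ?_
  · rw [h]; rfl
  · intro l j
    rw [top_inf_eq]
    rcases le_total j r with hj | hj
    · rw [finrank_fl (hM l) hj]
      simp only [id]
      have : (Finset.univ.filter fun k : Fin r => (k : ℕ) < j).card = j := by
        rw [Fin.card_filter_val_lt, min_eq_right hj]
      exact this.symm
    · rw [fl_top (hM l) hj]
      simp only [id]
      rw [Finset.filter_true_of_mem]
      · simp
      · intro k _; omega

lemma exists_semistable {s r : ℕ} (hs : 0 < s) (σ : Equiv.Perm (Fin s))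
    (Λ : Fin s → Fin r → ℝ) (t : ℝ) (hc : ∀ l j, 0 ≤ cw (Λ l) j)
    (hσ : (fun l => Λ (σ⁻¹ l)) = Λ) (hT : TT Λ = (r : ℝ) * t)
    (hH : ∀ (d : ℕ), 1 ≤ d → d < r →
          ∀ J : Fin s → Fin d → Fin r, (∀ l, StrictMono (J l)) →
            (fun l => J (σ⁻¹ l)) = J → Intersecting J → edim J = 0 →
            TJ J Λ ≤ (d : ℝ) * t) :
    ∃ M : Fin s → Matrix (Fin r) (Fin r) ℂ, (∀ l, IsUnit (M l).det) ∧
      ∀ V, dg Λ M V ≤ t * finrank ℂ V := by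
  classical
  choose f hf hf2 using fun (d : Fin (r+1)) (J : {J : Fin s → Fin d → Fin r // ∀ l, StrictMono (J l)}) =>
    generic J.1 J.2
  let ρ : Fin s × Fin r × Fin r → Fin s × Fin r × Fin r := fun p => (σ⁻¹ p.1, p.2)
  have hρ : Function.Injective ρ := by
    rintro ⟨a, b⟩ ⟨c, d⟩ h
    simp only [ρ, Prod.mk.injEq, EmbeddingLike.apply_eq_iff_eq] at h
    ext1 <;> simp [h]
  let g : MvPolynomial (Fin s × Fin r × Fin r) ℂ :=
    detP s r * ∏ d, ∏ J, (f d J * MvPolynomial.rename ρ (f d J))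
  have hg : g ≠ 0 := by
    refine mul_ne_zero (detP_ne s r) ?_
    refine Finset.prod_ne_zero_iff.2 fun d _ => Finset.prod_ne_zero_iff.2 fun J _ => mul_ne_zero (hf d J) ?_
    intro h
    exact hf d J (MvPolynomial.rename_injective ρ hρ (by rw [h, map_zero]))
  obtain ⟨m, hm⟩ := (dense_ne g hg).nonempty
  set M := unpt m with hMdef
  have hm' : MvPolynomial.eval (pt M) g ≠ 0 := hm
  simp only [g, map_mul, map_prod] at hm'
  have hM := detP_unit (left_ne_zero_of_mul hm')
  have hfM := right_ne_zero_of_mul hm'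
  simp only [Finset.prod_ne_zero_iff, Finset.mem_univ, true_implies] at hfM
  have hf3 : ∀ d J, MvPolynomial.eval (pt M) (f d J) ≠ 0 := fun d J => left_ne_zero_of_mul (hfM d J)
  have hf4 : ∀ d J, MvPolynomial.eval (pt (fun l => M (σ⁻¹ l))) (f d J) ≠ 0 := fun d J => by
    have := right_ne_zero_of_mul (hfM d J)
    rw [MvPolynomial.eval_rename] at this
    exact this
  refine ⟨M, hM, ?_⟩
  by_contra hneg
  push Not at hneg
  obtain ⟨V, μ, hμ, hpos, hV, hmax, hdim⟩ := exists_HN _ _ t hneg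
  obtain ⟨d, hd⟩ : ∃ d, finrank ℂ V = d := ⟨_, rfl⟩
  have hdr : d ≤ r := by
    rw [← hd]; have := Submodule.finrank_le V; simpa using this
  choose J hJ using fun l => pos_exists (hM l) V hd
  have hJp : ∀ l, IsPos (M l) V (J l) := hJ
  have hVJ : dg Λ M V = TJ J Λ := dg_eq Λ M V J (fun l => (hJ l).2.1)
  have hV' : dg Λ M V = μ * d := by rw [← hd]; exact hV
  have hdlt : d < r := by
    rcases Nat.eq_or_lt_of_le hdr with h | h
    · exfalso
      have : V = ⊤ := Submodule.eq_top_of_finrank_eq (by rw [hd, h]; simp)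
      rw [this, dg_top Λ M hM, hT, h] at hV'
      have : (0:ℝ) < r := by rw [← h, ← hd]; exact_mod_cast hpos
      nlinarith
    · exact h
  have hJm : ∀ l, StrictMono (J l) := fun l => (hJ l).1
  have he1 := edim_nonpos Λ hc M hM V hd μ hV hmax hdim J hJp
  obtain ⟨he2, hrea⟩ := hf2 ⟨d, by omega⟩ ⟨J, hJm⟩ M hM (hf3 _ _) V hd hJp
  have hInter := intersecting_of hs J hJm _ (hf ⟨d, by omega⟩ ⟨J, hJm⟩) hrea
  -- the permuted tuple
  let J' : Fin s → Fin d → Fin r := fun l => J (σ⁻¹ l)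
  have hJ'm : ∀ l, StrictMono (J' l) := fun l => hJm _
  obtain ⟨-, hrea'⟩ := hf2 ⟨d, by omega⟩ ⟨J', hJ'm⟩ (fun l => M (σ⁻¹ l)) (fun l => hM _) (hf4 _ _) V hd
    (fun l => hJp _)
  obtain ⟨V', hV'd, hV'J⟩ := hrea' M hM (hf3 _ _)
  have hge : TJ J' Λ ≤ dg Λ M V' := dg_ge Λ hc M V' J' hV'J
  have hTJ : TJ J' Λ = TJ J Λ := by
    unfold TJ
    rw [← Equiv.sum_comp σ⁻¹ (fun l => ∑ k, Λ l (J l k))]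
    refine Finset.sum_congr rfl fun l _ => Finset.sum_congr rfl fun k _ => ?_
    rw [congrFun hσ l]
  have hVV : V' = V := by
    refine HN_unique _ (fun p : Fin s × Fin r => hc p.1 p.2) _ μ V V' hV hmax hdim ?_ (by rw [hd]; exact hV'd)
    change μ * (finrank ℂ V' : ℝ) ≤ dg Λ M V'
    have : (finrank ℂ V' : ℝ) = d := by exact_mod_cast hV'd
    rw [this, ← hV', hVJ, ← hTJ]
    exact hge
  have hle : ∀ l k, J l k ≤ J' l k := by
    intro l k
    apply le_of_count (hJm l)
    rw [← (hJ l).2.1, ← hVV]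
    exact hV'J l k
  have hJeq : (fun l => J (σ⁻¹ l)) = J := by
    funext l k
    have hsum : ∑ l, (J l k : ℕ) = ∑ l, (J' l k : ℕ) :=
      (Equiv.sum_comp σ⁻¹ (fun l => (J l k : ℕ))).symm
    have := (Finset.sum_eq_sum_iff_of_le (fun l _ => (Fin.le_def.1 (hle l k)))).1 hsum l (Finset.mem_univ _)
    exact Fin.ext this.symm
  have hfin := hH d (by omega) hdlt J hJm hJeq hInter (le_antisymm he1 he2)
  rw [← hVJ, hV'] at hfin
  have : (0:ℝ) < d := by rw [← hd]; exact_mod_cast hpos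
  nlinarith

end KH
end

section
open Module Matrix
open scoped ComplexOrder
namespace KH

lemma spec {r : ℕ} {A : Matrix (Fin r) (Fin r) ℂ} (hA : A.IsHermitian) :
    ∃ U : Matrix (Fin r) (Fin r) ℂ, Uᴴ * U = 1 ∧ U * Uᴴ = 1 ∧
      A = U * diagonal (fun i => (hA.eigenvalues i : ℂ)) * Uᴴ := by
  have h := hA.spectral_theorem
  rw [Unitary.conjStarAlgAut_apply] at h
  refine ⟨hA.eigenvectorUnitary, ?_, ?_, ?_⟩
  · exact Unitary.coe_star_mul_self _
  · exact Unitary.coe_mul_star_self _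
  · exact h

lemma one_le_det_one_add {n : ℕ} {B : Matrix (Fin n) (Fin n) ℂ} (hB : B.PosSemidef) :
    1 ≤ (1 + B).det.re := by
  obtain ⟨U, h1, h2, h3⟩ := spec hB.1
  set β := hB.1.eigenvalues
  have h4 : 1 + B = U * diagonal (fun i => ((1 + β i : ℝ) : ℂ)) * Uᴴ := by
    have : diagonal (fun i => ((1 + β i : ℝ) : ℂ)) = 1 + diagonal (fun i => (β i : ℂ)) := by
      rw [← diagonal_one, diagonal_add]; simp
    rw [this, Matrix.mul_add, Matrix.add_mul, Matrix.mul_one, h2, ← h3]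
  have h5 : (1 + B).det = ((∏ i, (1 + β i) : ℝ) : ℂ) := by
    rw [h4, det_mul, det_mul, mul_right_comm, ← det_mul, h2, det_one, one_mul, det_diagonal]
    push_cast; rfl
  rw [h5, Complex.ofReal_re]
  have h6 : ∀ i, 0 ≤ β i := hB.eigenvalues_nonneg
  calc (1:ℝ) = ∏ i : Fin n, 1 := by simp
    _ ≤ _ := Finset.prod_le_prod (fun _ _ => zero_le_one) (fun i _ => by linarith [h6 i])

lemma det_ge {n : ℕ} {C B : Matrix (Fin n) (Fin n) ℂ} (hC : C.det ≠ 0) (hB : B.PosSemidef) :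
    Complex.normSq C.det ≤ (Cᴴ * C + B).det.re := by
  have hu : IsUnit C.det := isUnit_iff_ne_zero.2 hC
  have h1 : Cᴴ * C + B = Cᴴ * (1 + (C⁻¹)ᴴ * B * C⁻¹) * C := by
    have h2 : Cᴴ * (C⁻¹)ᴴ = 1 := by
      rw [← conjTranspose_mul, nonsing_inv_mul _ hu, conjTranspose_one]
    have h3 : C⁻¹ * C = 1 := nonsing_inv_mul _ hu
    rw [Matrix.mul_add, Matrix.add_mul, Matrix.mul_one]
    congr 1
    calc B = (Cᴴ * (C⁻¹)ᴴ) * B * (C⁻¹ * C) := by rw [h2, h3]; simp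
      _ = _ := by simp only [Matrix.mul_assoc]
  have h4 := one_le_det_one_add (hB.conjTranspose_mul_mul_same (C⁻¹))
  rw [h1, det_mul, det_mul, det_conjTranspose, mul_right_comm, RCLike.star_def, mul_comm _ C.det,
    Complex.mul_conj, Complex.re_ofReal_mul]
  nlinarith [Complex.normSq_nonneg C.det]

/-- log of the real part of the determinant. -/
noncomputable def ld {n : ℕ} (A : Matrix (Fin n) (Fin n) ℂ) : ℝ := Real.log A.det.re

lemma det_deriv {n : ℕ} {A B : Matrix (Fin n) (Fin n) ℂ} (hA : A.PosDef) :
    HasDerivAt (fun z : ℝ => ld (A + (z : ℂ) • B)) ((A⁻¹ * B).trace.re) 0 := by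
  have hpos : 0 < A.det := hA.det_pos
  have hre : 0 < A.det.re := (Complex.pos_iff.1 hpos).1
  have him : A.det.im = 0 := (Complex.pos_iff.1 hpos).2.symm
  have hu : IsUnit A.det := isUnit_iff_ne_zero.2 hpos.ne'
  set P : Polynomial ℂ := det (1 + (Polynomial.X : Polynomial ℂ) • (A⁻¹ * B).map Polynomial.C) with hP
  have h1 : ∀ z : ℂ, (A + z • B).det = A.det * P.eval z := by
    intro z
    have h2 : A + z • B = A * (1 + z • (A⁻¹ * B)) := by
      rw [Matrix.mul_add, Matrix.mul_one, Matrix.mul_smul, ← Matrix.mul_assoc, mul_nonsing_inv _ hu,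
        Matrix.one_mul]
    rw [h2, det_mul, hP, ← Polynomial.coe_evalRingHom, RingHom.map_det]
    congr 2
    ext i j
    generalize A⁻¹ * B = D
    by_cases hij : i = j <;> simp [hij] <;> ring
  have h3 : HasDerivAt (fun z : ℂ => (A + z • B).det) (A.det * (A⁻¹ * B).trace) 0 := by
    have := (P.hasDerivAt (0:ℂ)).const_mul A.det
    rw [hP, derivative_det_one_add_X_smul, ← hP] at this
    refine this.congr_of_eventuallyEq (Filter.Eventually.of_forall fun z => h1 z)
  have h3' : HasDerivAt (fun z : ℂ => (A + z • B).det) (A.det * (A⁻¹ * B).trace) ((0:ℝ):ℂ) := by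
    simpa using h3
  have h4 := h3'.real_of_complex
  have h5 := h4.log (by simpa using hre.ne')
  have h6 : (A⁻¹ * B).trace.re
      = (A.det * (A⁻¹ * B).trace).re / (A + ((0:ℝ):ℂ) • B).det.re := by
    rw [Complex.ofReal_zero, zero_smul, add_zero, Complex.mul_re, him, zero_mul, sub_zero]
    field_simp
  rw [h6]
  exact h5

lemma ld_smul {n : ℕ} {A : Matrix (Fin n) (Fin n) ℂ} (hA : A.PosDef) {c : ℝ} (hc : 0 < c) :
    ld ((c : ℂ) • A) = n * Real.log c + ld A := by
  have hre : 0 < A.det.re := (Complex.pos_iff.1 hA.det_pos).1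
  unfold ld
  rw [det_smul, Fintype.card_fin, ← Complex.ofReal_pow, Complex.re_ofReal_mul,
    Real.log_mul (by positivity) hre.ne', Real.log_pow]

lemma abel {r : ℕ} (x m : Fin r → ℝ) (hx : Monotone x)
    (hm : ∀ k : ℕ, ∑ i : Fin r, (if (i : ℕ) < k then m i else 0) ≤ 0) (h0 : ∑ i, m i = 0) :
    0 ≤ ∑ i, x i * m i := by
  rcases Nat.eq_zero_or_pos r with h | hr
  · subst h; simp
  have key : ∀ k : ℕ, ∀ hk : k < r,
      x ⟨k, hk⟩ * ∑ i : Fin r, (if (i : ℕ) < k + 1 then m i else 0)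
        ≤ ∑ i : Fin r, (if (i : ℕ) < k + 1 then x i * m i else 0) := by
    have step : ∀ (f : Fin r → ℝ) (k : ℕ) (hk : k < r),
        ∑ i : Fin r, (if (i : ℕ) < k + 1 then f i else 0)
          = ∑ i : Fin r, (if (i : ℕ) < k then f i else 0) + f ⟨k, hk⟩ := by
      intro f k hk
      have : f ⟨k, hk⟩ = ∑ i : Fin r, if i = ⟨k, hk⟩ then f i else 0 := by simp
      rw [this, ← Finset.sum_add_distrib]
      refine Finset.sum_congr rfl fun i _ => ?_
      by_cases h1 : (i : ℕ) < k
      · rw [if_pos (by omega), if_pos h1, if_neg (by rw [Fin.ext_iff]; simp; omega), add_zero]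
      · by_cases h2 : (i : ℕ) = k
        · rw [if_pos (by omega), if_neg h1, if_pos (Fin.ext h2), zero_add]
        · rw [if_neg (by omega), if_neg h1, if_neg (by rw [Fin.ext_iff]; exact h2), add_zero]
    intro k
    induction k with
    | zero => intro hk; rw [step _ 0 hk, step _ 0 hk]; simp
    | succ k ih =>
      intro hk
      rw [step _ (k+1) hk, step (fun i => x i * m i) (k+1) hk]
      have h1 := ih (by omega)
      have h2 := hm (k+1)
      have h3 : x ⟨k, by omega⟩ ≤ x ⟨k+1, hk⟩ := hx (by rw [Fin.le_def]; simp)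
      nlinarith
  have h1 := key (r-1) (by omega)
  have h2 : ∀ f : Fin r → ℝ, ∑ i : Fin r, (if (i : ℕ) < r - 1 + 1 then f i else 0) = ∑ i, f i := by
    intro f
    refine Finset.sum_congr rfl fun i _ => ?_
    rw [if_pos (by omega)]
  rw [h2, h2 (fun i => x i * m i), h0, mul_zero] at h1
  exact h1

end KH
end

section
open Module Matrix
open scoped ComplexOrder
namespace KH

lemma minor {r n : ℕ} (K : Matrix (Fin r) (Fin n) ℂ) (hK : Function.Injective K.mulVecLin) :
    ∃ (S : Finset (Fin r)) (e : Fin n → Fin r), Function.Injective e ∧ Finset.univ.image e = S ∧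
      (∀ j, finrank ℂ ↥(LinearMap.range K.mulVecLin ⊓ Cs r j)
        = (S.filter (fun i : Fin r => (i : ℕ) < j)).card) ∧
      (K.submatrix e id).det ≠ 0 := by
  obtain ⟨S, h1, h2⟩ := jump (LinearMap.range K.mulVecLin)
  have hc : S.card = n := by
    have := h1 r
    rw [Cs_top le_rfl, inf_top_eq, LinearMap.finrank_range_of_inj hK, finrank_fin_fun,
      Finset.filter_true_of_mem (fun i _ => i.2)] at this
    exact this.symm
  refine ⟨S, S.orderEmbOfFin hc, (S.orderEmbOfFin hc).injective, ?_, h1, ?_⟩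
  · ext i
    have := Finset.range_orderEmbOfFin S hc
    have h := Set.ext_iff.1 this i
    simpa using h
  · intro h0
    obtain ⟨v, hv, hz⟩ := Matrix.exists_mulVec_eq_zero_iff.2 h0
    have h3 := jump_inj h2 (K.mulVecLin v) ⟨v, rfl⟩ 0 (by
      intro i hi _
      have := Finset.range_orderEmbOfFin S hc
      have h := (Set.ext_iff.1 this i).2 hi
      obtain ⟨k, rfl⟩ := h
      exact congrFun hz k)
    rw [Cs_zero, Submodule.mem_bot] at h3
    exact hv (hK (by rw [h3, map_zero]))

lemma ld_ge {r n : ℕ} (K : Matrix (Fin r) (Fin n) ℂ) (x : Fin r → ℝ) (e : Fin n → Fin r)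
    (he : Function.Injective e) {δ : ℝ} (hδ : 0 < δ)
    (h : δ ≤ Complex.normSq (K.submatrix e id).det) :
    ∑ k, x (e k) + Real.log δ ≤ ld (Kᴴ * diagonal (fun i => (Real.exp (x i) : ℂ)) * K) := by
  classical
  set C : Matrix (Fin n) (Fin n) ℂ :=
    diagonal (fun k => (Real.exp (x (e k) / 2) : ℂ)) * K.submatrix e id with hC
  set S : Finset (Fin r) := Finset.univ.image e
  set B : Matrix (Fin n) (Fin n) ℂ :=
    Kᴴ * diagonal (fun i => ((if i ∈ S then 0 else Real.exp (x i) : ℝ) : ℂ)) * K with hB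
  have hdet : Complex.normSq C.det
      = Real.exp (∑ k, x (e k)) * Complex.normSq (K.submatrix e id).det := by
    rw [hC, det_mul, map_mul, det_diagonal, ← Complex.ofReal_prod, Complex.normSq_ofReal,
      ← Finset.prod_mul_distrib, Real.exp_sum]
    congr 1
    refine Finset.prod_congr rfl fun k _ => ?_
    rw [← Real.exp_add]; congr 1; ring
  have hBp : B.PosSemidef := by
    apply PosSemidef.conjTranspose_mul_mul_same
    rw [posSemidef_diagonal_iff]
    intro i
    rw [Complex.zero_le_real]
    split_ifs
    · exact le_rfl
    · exact (Real.exp_pos _).le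
  have hsum : Kᴴ * diagonal (fun i => (Real.exp (x i) : ℂ)) * K = Cᴴ * C + B := by
    ext i j
    rw [Matrix.add_apply, hB, Matrix.mul_apply, Matrix.mul_apply, Matrix.mul_apply]
    simp only [mul_diagonal, conjTranspose_apply, hC, diagonal_mul, submatrix_apply, id]
    have h1 : ∑ k, star ((Real.exp (x (e k) / 2) : ℂ) * K (e k) i) * ((Real.exp (x (e k) / 2) : ℂ) * K (e k) j)
        = ∑ m ∈ S, star (K m i) * (Real.exp (x m) : ℂ) * K m j := by
      rw [Finset.sum_image (fun a _ b _ hab => he hab)]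
      refine Finset.sum_congr rfl fun k _ => ?_
      have : (Real.exp (x (e k)) : ℂ) = (Real.exp (x (e k) / 2) : ℂ) * (Real.exp (x (e k) / 2) : ℂ) := by
        rw [← Complex.ofReal_mul, ← Real.exp_add]; congr 2; ring
      rw [this, star_mul, RCLike.star_def, Complex.conj_ofReal]
      ring
    have h2 : ∑ m ∈ S, star (K m i) * (Real.exp (x m) : ℂ) * K m j
        = ∑ m, if m ∈ S then star (K m i) * (Real.exp (x m) : ℂ) * K m j else 0 := by
      rw [Finset.sum_ite_mem, Finset.univ_inter]
    rw [h1, h2, ← Finset.sum_add_distrib]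
    refine Finset.sum_congr rfl fun m _ => ?_
    by_cases hm : m ∈ S <;> simp [hm]
  have hpos : 0 < Complex.normSq C.det := by
    rw [hdet]; exact mul_pos (Real.exp_pos _) (hδ.trans_le h)
  have hge := det_ge (fun h0 => by rw [h0] at hpos; simp at hpos) hBp
  rw [← hsum] at hge
  unfold ld
  rw [← Real.log_exp (∑ k, x (e k)), ← Real.log_mul (Real.exp_pos _).ne' hδ.ne']
  apply Real.log_le_log (mul_pos (Real.exp_pos _) hδ)
  refine le_trans ?_ hge
  rw [hdet]
  exact mul_le_mul_of_nonneg_left h (Real.exp_pos _).le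

end KH
end

section
open Module Matrix
open scoped ComplexOrder
namespace KH

section
variable {r : ℕ} {ι : Type} [Fintype ι] {n : ι → ℕ} (c : ι → ℝ)
  (N : ∀ a, Matrix (Fin r) (Fin (n a)) ℂ) (t : ℝ)

lemma rank_transport {m : ℕ} {U : Matrix (Fin r) (Fin r) ℂ} (hU : Uᴴ * U = 1) (hU' : U * Uᴴ = 1)
    (A : Matrix (Fin r) (Fin m) ℂ) (j : ℕ) :
    finrank ℂ ↥(LinearMap.range (Uᴴ * A).mulVecLin ⊓ Cs r j)
      = finrank ℂ ↥(fl U j ⊓ LinearMap.range A.mulVecLin) := by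
  have h : fl U j ⊓ LinearMap.range A.mulVecLin
      = (LinearMap.range (Uᴴ * A).mulVecLin ⊓ Cs r j).map U.mulVecLin := by
    ext v
    constructor
    · rintro ⟨⟨y, hy, rfl⟩, ⟨z, hz⟩⟩
      refine ⟨y, ⟨⟨z, ?_⟩, hy⟩, rfl⟩
      rw [mulVecLin_apply] at hz ⊢
      rw [← mulVec_mulVec, hz, mulVecLin_apply, mulVec_mulVec, hU, one_mulVec]
    · rintro ⟨y, ⟨⟨z, hz⟩, hy⟩, rfl⟩
      refine ⟨⟨y, hy, rfl⟩, ⟨z, ?_⟩⟩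
      rw [← hz, mulVecLin_apply, mulVecLin_apply, mulVecLin_apply, mulVec_mulVec, ← Matrix.mul_assoc,
        hU', Matrix.one_mul]
  rw [h]
  exact (LinearEquiv.finrank_eq (Submodule.equivMapOfInjective _ (iso_inj hU) _))

lemma lower_aux (hN : ∀ a, Function.Injective (N a).mulVecLin) (hc : ∀ a, 0 ≤ c a)
    (hss : ∀ V : Submodule ℂ (Fin r → ℂ),
      ∑ a, c a * (finrank ℂ ↥(V ⊓ LinearMap.range (N a).mulVecLin) : ℝ) ≤ t * finrank ℂ V)
    (hT : ∑ a, c a * (n a : ℝ) = t * r) :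
    ∃ C : ℝ, ∀ U ∈ {U : Matrix (Fin r) (Fin r) ℂ | Uᴴ * U = 1}, ∀ x : Fin r → ℝ, Monotone x →
      C ≤ ∑ a, c a * ld ((Uᴴ * N a)ᴴ * diagonal (fun i => (Real.exp (x i) : ℂ)) * (Uᴴ * N a))
        - t * ∑ i, x i := by
  classical
  refine (iso_compact r r).induction_on (p := fun T => ∃ C : ℝ, ∀ U ∈ T, ∀ x : Fin r → ℝ, Monotone x →
      C ≤ ∑ a, c a * ld ((Uᴴ * N a)ᴴ * diagonal (fun i => (Real.exp (x i) : ℂ)) * (Uᴴ * N a))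
        - t * ∑ i, x i) ?_ ?_ ?_ ?_
  · exact ⟨0, fun U hU => hU.elim⟩
  · rintro S T hST ⟨C, hC⟩
    exact ⟨C, fun U hU => hC U (hST hU)⟩
  · rintro S T ⟨C, hC⟩ ⟨C', hC'⟩
    refine ⟨min C C', fun U hU x hx => ?_⟩
    rcases hU with h | h
    · exact (min_le_left _ _).trans (hC U h x hx)
    · exact (min_le_right _ _).trans (hC' U h x hx)
  · intro U0 hU0
    have hU0' : U0 * U0ᴴ = 1 := mul_eq_one_comm.1 hU0
    have hinj : ∀ a, Function.Injective (U0ᴴ * N a).mulVecLin := by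
      intro a
      rw [mulVecLin_mul]
      exact (iso_inj (Q := U0ᴴ) (by rw [conjTranspose_conjTranspose]; exact hU0')).comp (hN a)
    choose S e he hS hfr hdet using fun a => minor _ (hinj a)
    set D : ι → Matrix (Fin r) (Fin r) ℂ → ℝ := fun a U =>
      Complex.normSq ((Uᴴ * N a).submatrix (e a) id).det with hD
    have hDc : ∀ a, Continuous (D a) := by
      intro a
      refine Complex.continuous_normSq.comp ?_
      refine Continuous.matrix_det ?_
      refine Continuous.matrix_submatrix ?_ _ _
      exact (continuous_id.matrix_conjTranspose).matrix_mul continuous_const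
    have hD0 : ∀ a, 0 < D a U0 := fun a => Complex.normSq_pos.2 (hdet a)
    refine ⟨{U | ∀ a, D a U0 / 2 < D a U}, ?_, ∑ a, c a * Real.log (D a U0 / 2), ?_⟩
    · apply mem_nhdsWithin_of_mem_nhds
      have : {U | ∀ a, D a U0 / 2 < D a U} = ⋂ a, {U | D a U0 / 2 < D a U} := by ext; simp
      rw [this]
      refine (isOpen_iInter_of_finite fun a => isOpen_lt continuous_const (hDc a)).mem_nhds ?_
      simp only [Set.mem_iInter, Set.mem_ofPred_eq]
      intro a; linarith [hD0 a]
    · intro U hU x hx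
      set m : Fin r → ℝ := fun i => ∑ a, c a * (if i ∈ S a then 1 else 0) - t with hm
      have hcard : ∀ a, (S a).card = n a := by
        intro a
        rw [← hS a, Finset.card_image_of_injective _ (he a), Finset.card_univ, Fintype.card_fin]
      have h0 : ∑ i, m i = 0 := by
        rw [hm, Finset.sum_sub_distrib, Finset.sum_comm]
        simp only [← Finset.mul_sum]
        simp only [Finset.sum_ite_mem, Finset.univ_inter, Finset.sum_const, nsmul_eq_mul, mul_one,
          hcard, hT, Finset.card_univ, Fintype.card_fin]
        ring
      have hpart : ∀ k : ℕ, ∑ i : Fin r, (if (i : ℕ) < k then m i else 0) ≤ 0 := by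
        intro k
        rcases le_or_gt r k with hk | hk
        · refine le_of_eq (Eq.trans ?_ h0)
          exact Finset.sum_congr rfl fun i _ => if_pos (lt_of_lt_of_le i.2 hk)
        · have h1 : ∑ i : Fin r, (if (i : ℕ) < k then m i else 0)
              = ∑ a, c a * (((S a).filter (fun i : Fin r => (i : ℕ) < k)).card : ℝ) - t * k := by
            have h2 : ∀ i : Fin r, (if (i : ℕ) < k then m i else 0)
                = ∑ a, c a * (if (i ∈ S a ∧ (i : ℕ) < k) then 1 else 0) - (if (i : ℕ) < k then t else 0) := by
              intro i
              by_cases hi : (i : ℕ) < k <;> simp [hi, hm]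
            rw [Finset.sum_congr rfl fun i _ => h2 i, Finset.sum_sub_distrib, Finset.sum_comm]
            congr 1
            · refine Finset.sum_congr rfl fun a _ => ?_
              rw [← Finset.mul_sum, Finset.sum_boole]
              congr 3
              ext i; simp
            · rw [← Finset.sum_filter, Finset.sum_const, Fin.card_filter_val_lt, nsmul_eq_mul,
                min_eq_right hk.le, mul_comm]
          rw [h1]
          have h3 := hss (fl U0 k)
          have hdu : IsUnit U0.det := by
            have := congrArg Matrix.det hU0'
            rw [det_mul, det_one] at this
            exact IsUnit.of_mul_eq_one _ this
          rw [finrank_fl hdu hk.le] at h3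
          have h4 : ∑ a, c a * (((S a).filter (fun i : Fin r => (i : ℕ) < k)).card : ℝ)
              = ∑ a, c a * (finrank ℂ ↥(fl U0 k ⊓ LinearMap.range (N a).mulVecLin) : ℝ) := by
            refine Finset.sum_congr rfl fun a _ => ?_
            rw [← hfr a k, rank_transport hU0 hU0']
          rw [h4]; linarith
      have hab := abel x m hx hpart h0
      have hsum : ∑ i, x i * m i = ∑ a, c a * ∑ k, x (e a k) - t * ∑ i, x i := by
        simp only [hm, mul_sub, Finset.sum_sub_distrib, Finset.mul_sum]
        rw [Finset.sum_comm]
        congr 1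
        · refine Finset.sum_congr rfl fun a _ => ?_
          rw [← Finset.mul_sum, ← Finset.sum_image (f := fun i => x i) (s := Finset.univ) (g := e a) (fun _ _ _ _ h => he a h), hS a,
            Finset.mul_sum, ← Finset.univ_inter (S a), ← Finset.sum_ite_mem]
          refine Finset.sum_congr rfl fun i _ => ?_
          by_cases hi : i ∈ S a <;> simp [hi, mul_comm]
        · exact Finset.sum_congr rfl fun i _ => mul_comm _ _
      have hge : ∑ a, c a * (∑ k, x (e a k) + Real.log (D a U0 / 2))
          ≤ ∑ a, c a * ld ((Uᴴ * N a)ᴴ * diagonal (fun i => (Real.exp (x i) : ℂ)) * (Uᴴ * N a)) := by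
        refine Finset.sum_le_sum fun a _ => mul_le_mul_of_nonneg_left ?_ (hc a)
        exact ld_ge _ x (e a) (he a) (by linarith [hD0 a]) (hU a).le
      simp only [mul_add, Finset.sum_add_distrib] at hge
      linarith

/-- The Kempf-Ness type functional. -/
noncomputable def Phi (H : Matrix (Fin r) (Fin r) ℂ) : ℝ :=
  ∑ a, c a * ld ((N a)ᴴ * H * N a) - t * ld H

lemma sorted_spec {H : Matrix (Fin r) (Fin r) ℂ} (hH : H.PosDef) :
    ∃ (U : Matrix (Fin r) (Fin r) ℂ) (x : Fin r → ℝ), Uᴴ * U = 1 ∧ Monotone x ∧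
      H = U * diagonal (fun i => (Real.exp (x i) : ℂ)) * Uᴴ := by
  obtain ⟨U, h1, h2, h3⟩ := spec hH.1
  set y : Fin r → ℝ := fun i => Real.log (hH.1.eigenvalues i) with hy
  have hy' : ∀ i, Real.exp (y i) = hH.1.eigenvalues i := fun i => Real.exp_log (hH.eigenvalues_pos i)
  set π := Tuple.sort y
  refine ⟨U.submatrix id π, y ∘ π, ?_, Tuple.monotone_sort y, ?_⟩
  · rw [conjTranspose_submatrix]
    refine (submatrix_mul_equiv Uᴴ U π (Equiv.refl _) π).trans ?_
    rw [h1]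
    exact submatrix_one_equiv π
  · have h4 : diagonal (fun i => (Real.exp ((y ∘ π) i) : ℂ))
        = (diagonal (fun i => (hH.1.eigenvalues i : ℂ))).submatrix π π := by
      rw [submatrix_diagonal_equiv]
      congr 1; ext i; simp [hy']
    rw [h4, conjTranspose_submatrix, submatrix_mul_equiv, submatrix_mul_equiv, submatrix_id_id]
    exact h3

lemma lower (hN : ∀ a, Function.Injective (N a).mulVecLin) (hc : ∀ a, 0 ≤ c a)
    (hss : ∀ V : Submodule ℂ (Fin r → ℂ),
      ∑ a, c a * (finrank ℂ ↥(V ⊓ LinearMap.range (N a).mulVecLin) : ℝ) ≤ t * finrank ℂ V)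
    (hT : ∑ a, c a * (n a : ℝ) = t * r) :
    ∃ C : ℝ, ∀ H : Matrix (Fin r) (Fin r) ℂ, H.PosDef → C ≤ Phi c N t H := by
  obtain ⟨C, hC⟩ := lower_aux c N t hN hc hss hT
  refine ⟨C, fun H hH => ?_⟩
  obtain ⟨U, x, hU, hx, rfl⟩ := sorted_spec hH
  have h := hC U hU x hx
  have hU' : U * Uᴴ = 1 := mul_eq_one_comm.1 hU
  have h1 : ld (U * diagonal (fun i => (Real.exp (x i) : ℂ)) * Uᴴ) = ∑ i, x i := by
    unfold ld
    rw [det_mul, det_mul, mul_right_comm, ← det_mul, hU', det_one, one_mul, det_diagonal,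
      ← Complex.ofReal_prod, Complex.ofReal_re, ← Real.exp_sum, Real.log_exp]
  unfold Phi
  rw [h1]
  convert h using 5
  simp only [conjTranspose_mul, conjTranspose_conjTranspose, Matrix.mul_assoc]

end
end KH
end

section
open Module Matrix
open scoped ComplexOrder
namespace KH

section
variable {r : ℕ} {ι : Type} [Fintype ι] {n : ι → ℕ} (c : ι → ℝ)
  (N : ∀ a, Matrix (Fin r) (Fin (n a)) ℂ) (t : ℝ)

/-- Perturbed functional. -/
noncomputable def PhiE (ε : ℝ) (H : Matrix (Fin r) (Fin r) ℂ) : ℝ :=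
  Phi c N t H + ε * (r * Real.log H.trace.re - ld H)

lemma detre_pos {m : ℕ} {A : Matrix (Fin m) (Fin m) ℂ} (hA : A.PosDef) : 0 < A.det.re :=
  (Complex.pos_iff.1 hA.det_pos).1

lemma tracere_pos {A : Matrix (Fin r) (Fin r) ℂ} (hr : 0 < r) (hA : A.PosDef) : 0 < A.trace.re := by
  have : Nonempty (Fin r) := ⟨⟨0, hr⟩⟩
  exact (Complex.pos_iff.1 hA.trace_pos).1

lemma PhiE_smul (hN : ∀ a, Function.Injective (N a).mulVecLin)
    (hT : ∑ a, c a * (n a : ℝ) = t * r) (hr : 0 < r) (ε : ℝ) {H : Matrix (Fin r) (Fin r) ℂ} (hH : H.PosDef)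
    {τ : ℝ} (hτ : 0 < τ) : PhiE c N t ε ((τ : ℂ) • H) = PhiE c N t ε H := by
  have h1 : ∀ a, ld ((N a)ᴴ * ((τ : ℂ) • H) * N a) = n a * Real.log τ + ld ((N a)ᴴ * H * N a) := by
    intro a
    rw [Matrix.mul_smul, Matrix.smul_mul, ld_smul (hH.conjTranspose_mul_mul_same (hN a)) hτ]
  unfold PhiE Phi
  simp only [h1]
  rw [ld_smul hH hτ, trace_smul, smul_eq_mul, Complex.re_ofReal_mul,
    Real.log_mul hτ.ne' (tracere_pos hr hH).ne']
  simp only [mul_add, Finset.sum_add_distrib, ← mul_assoc]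
  rw [← Finset.sum_mul, hT]
  ring

lemma posDef_gram {g : Matrix (Fin r) (Fin r) ℂ} (hg : IsUnit g.det) : (gᴴ * g).PosDef :=
  PosDef.conjTranspose_mul_self g (mulVec_inj hg)

lemma exists_gram {H : Matrix (Fin r) (Fin r) ℂ} (hH : H.PosDef) :
    ∃ g : Matrix (Fin r) (Fin r) ℂ, IsUnit g.det ∧ H = gᴴ * g := by
  obtain ⟨U, x, hU, -, hx⟩ := sorted_spec hH
  have h : H = (diagonal (fun i => (Real.exp (x i / 2) : ℂ)) * Uᴴ)ᴴ *
      (diagonal (fun i => (Real.exp (x i / 2) : ℂ)) * Uᴴ) := by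
    rw [conjTranspose_mul, conjTranspose_conjTranspose, diagonal_conjTranspose, hx, Matrix.mul_assoc,
      Matrix.mul_assoc]
    congr 1
    rw [← Matrix.mul_assoc, diagonal_mul_diagonal]
    congr 2
    ext i
    rw [Pi.star_apply, RCLike.star_def, Complex.conj_ofReal, ← Complex.ofReal_mul, ← Real.exp_add]
    congr 2; ring
  refine ⟨_, ?_, h⟩
  have h2 := hH.det_pos.ne'
  rw [h, det_mul] at h2
  exact isUnit_iff_ne_zero.2 (right_ne_zero_of_mul h2)

lemma trace_gram (g : Matrix (Fin r) (Fin r) ℂ) : (gᴴ * g).trace.re = ∑ j, ∑ i, ‖g i j‖ ^ 2 := by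
  rw [trace, Complex.re_sum]
  refine Finset.sum_congr rfl fun j _ => ?_
  rw [diag_apply, Matrix.mul_apply, Complex.re_sum]
  refine Finset.sum_congr rfl fun i _ => ?_
  rw [conjTranspose_apply, RCLike.star_def, Complex.conj_mul', ← Complex.ofReal_pow, Complex.ofReal_re]

lemma entry_le {g : Matrix (Fin r) (Fin r) ℂ} (h : (gᴴ * g).trace.re = 1) (i j : Fin r) : ‖g i j‖ ≤ 1 := by
  rw [trace_gram] at h
  have h1 : ‖g i j‖ ^ 2 ≤ ∑ i, ‖g i j‖ ^ 2 :=
    Finset.single_le_sum (f := fun i => ‖g i j‖ ^ 2) (fun _ _ => by positivity) (Finset.mem_univ i)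
  have h2 : ∑ i, ‖g i j‖ ^ 2 ≤ ∑ j, ∑ i, ‖g i j‖ ^ 2 :=
    Finset.single_le_sum (f := fun j => ∑ i, ‖g i j‖ ^ 2) (fun _ _ => by positivity) (Finset.mem_univ j)
  nlinarith [norm_nonneg (g i j)]

lemma minim (hr : 0 < r) (hN : ∀ a, Function.Injective (N a).mulVecLin)
    (hT : ∑ a, c a * (n a : ℝ) = t * r) {C : ℝ}
    (hC : ∀ H : Matrix (Fin r) (Fin r) ℂ, H.PosDef → C ≤ Phi c N t H) {ε : ℝ} (hε : 0 < ε) :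
    ∃ g : Matrix (Fin r) (Fin r) ℂ, IsUnit g.det ∧ (gᴴ * g).trace.re = 1 ∧
      ∀ H : Matrix (Fin r) (Fin r) ℂ, H.PosDef → PhiE c N t ε (gᴴ * g) ≤ PhiE c N t ε H := by
  set m0 := PhiE c N t ε 1 with hm0
  set δ := Real.exp ((C - m0) / ε) with hδ
  have hδ0 : 0 < δ := Real.exp_pos _
  set K : Set (Matrix (Fin r) (Fin r) ℂ) := {g | (gᴴ * g).trace.re = 1 ∧ δ ≤ (gᴴ * g).det.re} with hK
  have hgc : Continuous fun g : Matrix (Fin r) (Fin r) ℂ => gᴴ * g :=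
    continuous_id.matrix_conjTranspose.matrix_mul continuous_id
  have hcompact : IsCompact K := by
    have h1 : IsCompact (Set.pi Set.univ fun _ : Fin r => Set.pi Set.univ
        fun _ : Fin r => Metric.closedBall (0:ℂ) 1) :=
      isCompact_univ_pi fun _ => isCompact_univ_pi fun _ => isCompact_closedBall _ _
    refine h1.of_isClosed_subset ?_ ?_
    · exact (isClosed_eq (Complex.continuous_re.comp hgc.matrix_trace) continuous_const).inter
        (isClosed_le continuous_const (Complex.continuous_re.comp hgc.matrix_det))
    · rintro g ⟨hg, -⟩ i _ j _
      rw [mem_closedBall_zero_iff]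
      exact entry_le hg i j
  have hunit : ∀ g ∈ K, IsUnit g.det := by
    rintro g ⟨-, hg⟩
    refine isUnit_iff_ne_zero.2 fun h0 => ?_
    rw [det_mul, h0, mul_zero, Complex.zero_re] at hg
    linarith
  -- any PosDef of trace one with value at most m0 comes from K
  have hmem : ∀ g : Matrix (Fin r) (Fin r) ℂ, IsUnit g.det → (gᴴ * g).trace.re = 1 →
      PhiE c N t ε (gᴴ * g) ≤ m0 → g ∈ K := by
    intro g hg h1 h2
    refine ⟨h1, ?_⟩
    have hp := posDef_gram hg
    have h3 := hC _ hp
    unfold PhiE at h2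
    rw [h1, Real.log_one, mul_zero, zero_sub] at h2
    have h4 : (C - m0) / ε ≤ ld (gᴴ * g) := by
      rw [div_le_iff₀ hε]; nlinarith
    rw [hδ, ← Real.exp_log (detre_pos hp)]
    exact Real.exp_le_exp.2 h4
  have hred : ∀ H : Matrix (Fin r) (Fin r) ℂ, H.PosDef → ∃ g : Matrix (Fin r) (Fin r) ℂ,
      IsUnit g.det ∧ (gᴴ * g).trace.re = 1 ∧ PhiE c N t ε (gᴴ * g) = PhiE c N t ε H := by
    intro H hH
    have htr := tracere_pos hr hH
    have hp : (((H.trace.re)⁻¹ : ℝ) : ℂ) • H |>.PosDef := by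
      refine PosDef.smul hH ?_
      rw [Complex.zero_lt_real]; positivity
    obtain ⟨g, hg, hge⟩ := exists_gram hp
    refine ⟨g, hg, ?_, ?_⟩
    · rw [← hge, trace_smul, smul_eq_mul, Complex.re_ofReal_mul, inv_mul_cancel₀ htr.ne']
    · rw [← hge, PhiE_smul c N t hN hT hr ε hH (by positivity)]
  obtain ⟨g1, hg1, hg1', hg1''⟩ := hred 1 PosDef.one
  have hcont : ContinuousOn (fun g => PhiE c N t ε (gᴴ * g)) K := by
    unfold PhiE Phi
    have hld : ∀ {m : ℕ} (A : Matrix (Fin r) (Fin r) ℂ → Matrix (Fin m) (Fin m) ℂ), Continuous A →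
        (∀ g ∈ K, (A g).PosDef) → ContinuousOn (fun g => ld (A g)) K := by
      intro m A hA hp
      unfold ld
      refine ContinuousOn.log (Complex.continuous_re.comp hA.matrix_det).continuousOn ?_
      intro g hg
      exact (detre_pos (hp g hg)).ne'
    have h1 := hld (fun g => gᴴ * g) hgc (fun g hg => posDef_gram (hunit g hg))
    refine ContinuousOn.add (ContinuousOn.sub ?_ (continuousOn_const.mul h1))
      (continuousOn_const.mul (ContinuousOn.sub (continuousOn_const.mul ?_) h1))
    · refine continuousOn_finsetSum _ fun a _ => continuousOn_const.mul ?_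
      refine hld (fun g => (N a)ᴴ * (gᴴ * g) * N a) ?_ ?_
      · exact (continuous_const.matrix_mul hgc).matrix_mul continuous_const
      · intro g hg
        exact (posDef_gram (hunit g hg)).conjTranspose_mul_mul_same (hN a)
    · refine ContinuousOn.log (Complex.continuous_re.comp hgc.matrix_trace).continuousOn ?_
      intro g hg
      exact (tracere_pos hr (posDef_gram (hunit g hg))).ne'
  obtain ⟨g, hgK, hmin⟩ := hcompact.exists_isMinOn ⟨g1, hmem g1 hg1 hg1' hg1''.le⟩ hcont
  refine ⟨g, hunit g hgK, hgK.1, fun H hH => ?_⟩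
  obtain ⟨g2, h2, h2', h2''⟩ := hred H hH
  rw [← h2'']
  by_cases hle : PhiE c N t ε (g2ᴴ * g2) ≤ m0
  · exact hmin (hmem g2 h2 h2' hle)
  · have := hmin (hmem g1 hg1 hg1' hg1''.le)
    simp only [Set.mem_ofPred_eq] at this
    rw [hg1''] at this
    linarith

end
end KH
end

section
open Module Matrix
open scoped ComplexOrder
namespace KH

section
variable {r : ℕ} {ι : Type} [Fintype ι] {n : ι → ℕ} (c : ι → ℝ)
  (N : ∀ a, Matrix (Fin r) (Fin (n a)) ℂ) (t : ℝ)

lemma eventually_posDef {g X : Matrix (Fin r) (Fin r) ℂ} (hg : IsUnit g.det) (hX : X.IsHermitian) :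
    ∀ᶠ z : ℝ in nhds 0, (gᴴ * g + (z : ℂ) • (gᴴ * X * g)).PosDef := by
  obtain ⟨U, h1, h2, h3⟩ := spec hX
  set β := hX.eigenvalues
  have hev : ∀ᶠ z : ℝ in nhds 0, ∀ i, 0 < 1 + z * β i := by
    rw [Filter.eventually_all]
    intro i
    have hc : Continuous fun z : ℝ => 1 + z * β i := by fun_prop
    refine hc.continuousAt.eventually (lt_mem_nhds ?_)
    simp
  filter_upwards [hev] with z hz
  have h4 : gᴴ * g + (z : ℂ) • (gᴴ * X * g)
      = (Uᴴ * g)ᴴ * diagonal (fun i => ((1 + z * β i : ℝ) : ℂ)) * (Uᴴ * g) := by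
    have h5 : diagonal (fun i => ((1 + z * β i : ℝ) : ℂ)) = 1 + (z : ℂ) • diagonal (fun i => (β i : ℂ)) := by
      rw [← diagonal_one, ← diagonal_smul, diagonal_add]
      congr 1; ext i; simp
    have h6 : U * (1 + (z : ℂ) • diagonal (fun i => (β i : ℂ))) * Uᴴ = 1 + (z : ℂ) • X := by
      rw [Matrix.mul_add, Matrix.add_mul, Matrix.mul_one, h2, Matrix.mul_smul, Matrix.smul_mul, ← h3]
    rw [h5, conjTranspose_mul, conjTranspose_conjTranspose]
    calc gᴴ * g + (z : ℂ) • (gᴴ * X * g) = gᴴ * (1 + (z : ℂ) • X) * g := by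
          rw [Matrix.mul_add, Matrix.add_mul, Matrix.mul_one, Matrix.mul_smul, Matrix.smul_mul]
      _ = _ := by rw [← h6]; simp only [Matrix.mul_assoc]
  rw [h4]
  refine PosDef.conjTranspose_mul_mul_same ?_ ?_
  · rw [posDef_diagonal_iff]
    intro i; rw [Complex.zero_lt_real]; exact hz i
  · have : IsUnit (Uᴴ * g).det := by
      rw [det_mul]
      refine IsUnit.mul ?_ hg
      have := congrArg Matrix.det h1
      rw [det_mul, det_one] at this
      exact IsUnit.of_mul_eq_one _ this
    exact mulVec_inj this

/-- Orthogonal projector on the column space. -/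
noncomputable def Pr {m : ℕ} (K : Matrix (Fin r) (Fin m) ℂ) : Matrix (Fin r) (Fin r) ℂ :=
  K * (Kᴴ * K)⁻¹ * Kᴴ

lemma Pr_herm {m : ℕ} (K : Matrix (Fin r) (Fin m) ℂ) : (Pr K)ᴴ = Pr K := by
  unfold Pr
  rw [conjTranspose_mul, conjTranspose_mul, conjTranspose_nonsing_inv, conjTranspose_mul,
    conjTranspose_conjTranspose, Matrix.mul_assoc]

lemma critical (hN : ∀ a, Function.Injective (N a).mulVecLin) {ε : ℝ}
    {g : Matrix (Fin r) (Fin r) ℂ} (hg : IsUnit g.det) (htr : (gᴴ * g).trace.re = 1)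
    (hmin : ∀ H : Matrix (Fin r) (Fin r) ℂ, H.PosDef → PhiE c N t ε (gᴴ * g) ≤ PhiE c N t ε H) :
    ∑ a, (c a : ℂ) • Pr (g * N a) = ((t + ε : ℝ) : ℂ) • 1 - ((ε * r : ℝ) : ℂ) • (g * gᴴ) := by
  have hp := posDef_gram hg
  have hder : ∀ X : Matrix (Fin r) (Fin r) ℂ, X.IsHermitian →
      ∑ a, c a * (Pr (g * N a) * X).trace.re - t * X.trace.re
        + ε * (r * ((g * gᴴ) * X).trace.re - X.trace.re) = 0 := by
    intro X hX
    have hloc : IsLocalMin (fun z : ℝ => PhiE c N t ε (gᴴ * g + (z : ℂ) • (gᴴ * X * g))) 0 := by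
      filter_upwards [eventually_posDef hg hX] with z hz
      simpa using hmin _ hz
    refine hloc.hasDerivAt_eq_zero ?_
    have d1 : HasDerivAt (fun z : ℝ => ld (gᴴ * g + (z : ℂ) • (gᴴ * X * g))) X.trace.re 0 := by
      have := det_deriv (B := gᴴ * X * g) hp
      have h2 : ((gᴴ * g)⁻¹ * (gᴴ * X * g)).trace = X.trace := by
        have hg' : IsUnit gᴴ.det := by rw [det_conjTranspose]; exact hg.star
        rw [Matrix.mul_inv_rev, Matrix.mul_assoc, ← Matrix.mul_assoc gᴴ⁻¹, ← Matrix.mul_assoc gᴴ⁻¹,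
          nonsing_inv_mul _ hg', Matrix.one_mul, trace_mul_comm, Matrix.mul_assoc,
          mul_nonsing_inv _ hg, Matrix.mul_one]
      rwa [h2] at this
    have d2 : ∀ a, HasDerivAt (fun z : ℝ => ld ((N a)ᴴ * (gᴴ * g + (z : ℂ) • (gᴴ * X * g)) * N a))
        (Pr (g * N a) * X).trace.re 0 := by
      intro a
      have := det_deriv (B := (N a)ᴴ * (gᴴ * X * g) * N a) (hp.conjTranspose_mul_mul_same (hN a))
      have h2 : (((N a)ᴴ * (gᴴ * g) * N a)⁻¹ * ((N a)ᴴ * (gᴴ * X * g) * N a)).trace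
          = (Pr (g * N a) * X).trace := by
        unfold Pr
        have e1 : (N a)ᴴ * (gᴴ * g) * N a = (g * N a)ᴴ * (g * N a) := by
          rw [conjTranspose_mul]; simp only [Matrix.mul_assoc]
        have e2 : (N a)ᴴ * (gᴴ * X * g) * N a = (g * N a)ᴴ * X * (g * N a) := by
          rw [conjTranspose_mul]; simp only [Matrix.mul_assoc]
        rw [e1, e2, ← Matrix.mul_assoc, trace_mul_comm]
        simp only [Matrix.mul_assoc]
      rw [h2] at this
      convert this using 2 with z
      congr 1
      rw [Matrix.mul_add, Matrix.add_mul, Matrix.mul_smul, Matrix.smul_mul]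
    have d3 : HasDerivAt (fun z : ℝ => Real.log (gᴴ * g + (z : ℂ) • (gᴴ * X * g)).trace.re)
        ((g * gᴴ) * X).trace.re 0 := by
      have h3 : (gᴴ * X * g).trace = ((g * gᴴ) * X).trace := by
        rw [trace_mul_comm, ← Matrix.mul_assoc]
      have h4 : HasDerivAt (fun z : ℝ => 1 + z * ((g * gᴴ) * X).trace.re) (((g * gᴴ) * X).trace.re) 0 := by
        simpa using ((hasDerivAt_id (0:ℝ)).mul_const (((g * gᴴ) * X).trace.re)).const_add 1
      have h5 := h4.log (by simp)
      simp only [zero_mul, add_zero, div_one] at h5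
      convert h5 using 3 with z
      rw [trace_add, Complex.add_re, htr, trace_smul, smul_eq_mul, Complex.re_ofReal_mul, h3]
    unfold PhiE Phi
    refine HasDerivAt.add (HasDerivAt.sub ?_ (d1.const_mul t))
      (HasDerivAt.const_mul ε (HasDerivAt.sub (d3.const_mul _) d1))
    have := HasDerivAt.sum (u := Finset.univ) (fun a _ => (d2 a).const_mul (c a))
    convert this using 1
    ext z; simp
  set Y : Matrix (Fin r) (Fin r) ℂ := ∑ a, (c a : ℂ) • Pr (g * N a)
    - (((t + ε : ℝ) : ℂ) • 1 - ((ε * r : ℝ) : ℂ) • (g * gᴴ)) with hY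
  have hYh : Yᴴ = Y := by
    rw [hY]
    simp only [conjTranspose_sub, conjTranspose_sum, conjTranspose_smul, Pr_herm, conjTranspose_one,
      conjTranspose_mul, conjTranspose_conjTranspose, RCLike.star_def, Complex.conj_ofReal]
  have h1 := hder Y hYh
  have h2 : (Yᴴ * Y).trace.re = 0 := by
    rw [hYh, ← h1]
    nth_rewrite 1 [hY]
    rw [Matrix.sub_mul, Matrix.sub_mul, Finset.sum_mul, trace_sub, trace_sub, trace_sum]
    simp only [Matrix.smul_mul, trace_smul, Matrix.one_mul, Complex.sub_re, Complex.re_sum, smul_eq_mul,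
      Complex.re_ofReal_mul]
    ring
  have h3 : Y = 0 := by
    have h4 := trace_gram Y
    rw [h2] at h4
    ext i j
    have h5 := (Finset.sum_eq_zero_iff_of_nonneg (fun j _ => by positivity)).1 h4.symm j (Finset.mem_univ _)
    have h6 := (Finset.sum_eq_zero_iff_of_nonneg (fun j _ => by positivity)).1 h5 i (Finset.mem_univ _)
    simpa using h6
  exact sub_eq_zero.1 h3

lemma approx (hr : 0 < r) (hN : ∀ a, Function.Injective (N a).mulVecLin) (hc : ∀ a, 0 ≤ c a)
    (hss : ∀ V : Submodule ℂ (Fin r → ℂ),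
      ∑ a, c a * (finrank ℂ ↥(V ⊓ LinearMap.range (N a).mulVecLin) : ℝ) ≤ t * finrank ℂ V)
    (hT : ∑ a, c a * (n a : ℝ) = t * r) {ε : ℝ} (hε : 0 < ε) :
    ∃ g : Matrix (Fin r) (Fin r) ℂ, IsUnit g.det ∧
      ∀ i j, ‖(∑ a, (c a : ℂ) • Pr (g * N a) - (t : ℂ) • 1) i j‖ ≤ ε * (1 + r * r) := by
  obtain ⟨C, hC⟩ := lower c N t hN hc hss hT
  obtain ⟨g, hg, htr, hmin⟩ := minim c N t hr hN hT hC hε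
  refine ⟨g, hg, fun i j => ?_⟩
  rw [critical c N t hN hg htr hmin]
  have h1 : (((t + ε : ℝ) : ℂ) • (1 : Matrix (Fin r) (Fin r) ℂ) - ((ε * r : ℝ) : ℂ) • (g * gᴴ) - (t : ℂ) • 1) i j
      = (ε : ℂ) * ((1 : Matrix (Fin r) (Fin r) ℂ) i j - r * (g * gᴴ) i j) := by
    simp only [Matrix.sub_apply, Matrix.smul_apply, smul_eq_mul]
    push_cast; ring
  rw [h1, norm_mul, Complex.norm_real, Real.norm_of_nonneg hε.le]
  refine mul_le_mul_of_nonneg_left ?_ hε.le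
  refine (norm_sub_le _ _).trans (add_le_add ?_ ?_)
  · rw [Matrix.one_apply]; split_ifs <;> simp
  · rw [norm_mul, Complex.norm_natCast]
    refine mul_le_mul_of_nonneg_left ?_ (Nat.cast_nonneg _)
    rw [Matrix.mul_apply]
    refine (norm_sum_le _ _).trans ?_
    refine (Finset.sum_le_sum (g := fun _ => (1:ℝ)) fun k _ => ?_).trans (by simp)
    rw [conjTranspose_apply, norm_mul, norm_star]
    have := entry_le htr i k
    have := entry_le htr j k
    nlinarith [norm_nonneg (g i k), norm_nonneg (g j k)]

end
end KH
end

section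
open Module Matrix
open scoped ComplexOrder
namespace KH

/-- First `k` columns. -/
def cols {r k : ℕ} (h : k ≤ r) (M : Matrix (Fin r) (Fin r) ℂ) : Matrix (Fin r) (Fin k) ℂ :=
  M.submatrix id (Fin.castLE h)

lemma cols_iso {r k : ℕ} (h : k ≤ r) {U : Matrix (Fin r) (Fin r) ℂ} (hU : Uᴴ * U = 1) :
    (cols h U)ᴴ * cols h U = 1 := by
  unfold cols
  rw [conjTranspose_submatrix]
  refine (submatrix_mul_equiv Uᴴ U (Fin.castLE h) (Equiv.refl _) (Fin.castLE h)).trans ?_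
  rw [hU]
  exact submatrix_one _ (Fin.castLE_injective h)

lemma cols_mul {r k : ℕ} (h : k ≤ r) (g M : Matrix (Fin r) (Fin r) ℂ) :
    cols h (g * M) = g * cols h M := by
  ext i j
  simp [cols, Matrix.mul_apply]

lemma cols_inj {r k : ℕ} (h : k ≤ r) {M : Matrix (Fin r) (Fin r) ℂ} (hM : IsUnit M.det) :
    Function.Injective (cols h M).mulVecLin := by
  have h1 : cols h M = M * cols h 1 := by rw [← cols_mul, Matrix.mul_one]
  rw [h1, mulVecLin_mul]
  exact (mulVec_inj hM).comp (iso_inj (cols_iso h (by simp)))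

lemma cols_range {r k : ℕ} (h : k ≤ r) {M : Matrix (Fin r) (Fin r) ℂ} (hM : IsUnit M.det) :
    LinearMap.range (cols h M).mulVecLin = fl M k := by
  apply Submodule.eq_of_le_of_finrank_eq
  · rintro _ ⟨y, rfl⟩
    rw [mulVecLin_apply, mulVec_cols]
    refine Submodule.sum_mem _ fun i _ => Submodule.smul_mem _ _ ?_
    refine ⟨Pi.single (Fin.castLE h i) 1, ?_, ?_⟩
    · intro i' hi'
      rw [Pi.single_eq_of_ne]
      intro he
      rw [he] at hi'
      have := i.2
      simp at hi'
      omega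
    · ext p
      simp [cols]
  · rw [LinearMap.finrank_range_of_inj (cols_inj h hM), finrank_fin_fun, finrank_fl hM h]

lemma Pr_eq {r k : ℕ} {K Q : Matrix (Fin r) (Fin k) ℂ} (hK : Function.Injective K.mulVecLin)
    (hQ : Qᴴ * Q = 1) (h : LinearMap.range K.mulVecLin = LinearMap.range Q.mulVecLin) :
    Pr K = Q * Qᴴ := by
  have hu : IsUnit (Kᴴ * K).det :=
    isUnit_iff_ne_zero.2 (PosDef.conjTranspose_mul_self K hK).det_pos.ne'
  have h1 : Q * Qᴴ * K = K := by
    refine proj_fix hQ K fun k => ?_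
    rw [← h]
    exact ⟨Pi.single k 1, by ext i; simp⟩
  have h2 : ∀ k, ∃ y, K.mulVecLin y = fun i => Q i k := by
    intro k
    have : (fun i => Q i k) ∈ LinearMap.range Q.mulVecLin := ⟨Pi.single k 1, by ext i; simp⟩
    rw [← h] at this
    exact this
  choose y hy using h2
  have h3 : Q = K * Matrix.of (fun i k => y k i) := by
    ext i k
    rw [← congrFun (hy k) i]
    simp [Matrix.mul_apply, mulVec, dotProduct]
  have h4 : Pr K * K = K := by
    unfold Pr
    rw [Matrix.mul_assoc, Matrix.mul_assoc, nonsing_inv_mul _ hu, Matrix.mul_one]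
  have h5 : Pr K * Q = Q := by
    nth_rewrite 1 [h3]
    rw [← Matrix.mul_assoc, h4, ← h3]
  have h6 : Q * Qᴴ * Pr K = Pr K := by
    unfold Pr
    rw [← Matrix.mul_assoc, ← Matrix.mul_assoc, h1]
  have h7 : Pr K * (Q * Qᴴ) = Q * Qᴴ := by rw [← Matrix.mul_assoc, h5]
  have h8 := congrArg conjTranspose h7
  rw [conjTranspose_mul, Pr_herm, conjTranspose_mul, conjTranspose_conjTranspose, h6] at h8
  exact h8

lemma sum_castLE {r k : ℕ} (h : k ≤ r) (f : Fin r → ℂ) :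
    ∑ i : Fin k, f (Fin.castLE h i) = ∑ i : Fin r, if (i : ℕ) < k then f i else 0 := by
  classical
  rw [← Finset.sum_filter]
  refine Finset.sum_bij (fun i _ => Fin.castLE h i) ?_ ?_ ?_ ?_
  · intro i _; simp
  · intro i _ j _ hij; exact Fin.castLE_injective h hij
  · intro i hi
    simp only [Finset.mem_filter, Finset.mem_univ, true_and] at hi
    exact ⟨⟨i, hi⟩, Finset.mem_univ _, rfl⟩
  · intro i _; rfl

lemma sum_proj {r : ℕ} (L : Fin r → ℝ) (U : Matrix (Fin r) (Fin r) ℂ) :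
    ∑ j : Fin r, (cw L j : ℂ) • (cols (Nat.succ_le_of_lt j.2) U * (cols (Nat.succ_le_of_lt j.2) U)ᴴ)
      = U * diagonal (fun i => (L i : ℂ)) * Uᴴ := by
  ext p q
  have h1 : ∀ j : Fin r, (cols (Nat.succ_le_of_lt j.2) U * (cols (Nat.succ_le_of_lt j.2) U)ᴴ) p q
      = ∑ i : Fin r, if i ≤ j then U p i * star (U q i) else 0 := by
    intro j
    rw [Matrix.mul_apply]
    refine (sum_castLE (Nat.succ_le_of_lt j.2) (fun i => U p i * star (U q i))).trans ?_
    refine Finset.sum_congr rfl fun i _ => ?_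
    simp only [Fin.le_def, Nat.lt_succ_iff]
  rw [Matrix.sum_apply, Matrix.mul_apply]
  simp only [Matrix.smul_apply, mul_diagonal, conjTranspose_apply, smul_eq_mul]
  simp only [h1, Finset.mul_sum]
  rw [Finset.sum_comm]
  refine Finset.sum_congr rfl fun i _ => ?_
  rw [← cw_tele L i]
  push_cast
  rw [Finset.mul_sum, Finset.sum_mul]
  refine Finset.sum_congr rfl fun j _ => ?_
  split_ifs <;> simp <;> ring

lemma approx_unitary {s r : ℕ} (hr : 0 < r) (Λ : Fin s → Fin r → ℝ) (t : ℝ) (hc : ∀ l j, 0 ≤ cw (Λ l) j)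
    (hT : TT Λ = (r : ℝ) * t) (M : Fin s → Matrix (Fin r) (Fin r) ℂ) (hM : ∀ l, IsUnit (M l).det)
    (hss : ∀ V, dg Λ M V ≤ t * finrank ℂ V) {ε : ℝ} (hε : 0 < ε) :
    ∃ U : Fin s → Matrix (Fin r) (Fin r) ℂ, (∀ l, (U l)ᴴ * U l = 1) ∧
      ∀ i j, ‖(∑ l, U l * diagonal (fun i => (Λ l i : ℂ)) * (U l)ᴴ - (t : ℂ) • 1) i j‖ ≤ ε * (1 + r * r) := by
  have h1 := approx (ι := Fin s × Fin r) (n := fun p => (p.2 : ℕ) + 1) (fun p => cw (Λ p.1) p.2)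
    (fun p => cols (Nat.succ_le_of_lt p.2.2) (M p.1)) t hr
    (fun p => cols_inj _ (hM p.1)) (fun p => hc _ _) (by
      intro V
      refine le_trans (le_of_eq ?_) (hss V)
      unfold dg deg
      refine Finset.sum_congr rfl fun p _ => ?_
      rw [cols_range _ (hM p.1)]) (by
      rw [mul_comm, ← hT, ← dg_top Λ M hM]
      unfold dg deg
      refine Finset.sum_congr rfl fun p _ => ?_
      rw [top_inf_eq, finrank_fl (hM p.1) (Nat.succ_le_of_lt p.2.2)]) hε
  obtain ⟨g, hg, hgε⟩ := h1
  have hgM : ∀ l, IsUnit (g * M l).det := fun l => by rw [det_mul]; exact hg.mul (hM l)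
  have hU : ∀ l, ∃ U : Matrix (Fin r) (Fin r) ℂ, Uᴴ * U = 1 ∧ IsUnit U.det ∧
      ∀ j : Fin r, fl U (j + 1) = fl (g * M l) (j + 1) := by
    intro l
    exact fl_eq_flag ⟨fun j => fl (g * M l) (j + 1), fun i j h => fl_mono _ (by simpa using h),
      fun j => finrank_fl (hgM l) (Nat.succ_le_of_lt j.2)⟩
  choose U hU1 hU2 hU3 using hU
  refine ⟨U, hU1, ?_⟩
  have h2 : ∑ l, U l * diagonal (fun i => (Λ l i : ℂ)) * (U l)ᴴ
      = ∑ p : Fin s × Fin r, ((cw (Λ p.1) p.2 : ℝ) : ℂ) • Pr (g * cols (Nat.succ_le_of_lt p.2.2) (M p.1)) := by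
    rw [Fintype.sum_prod_type]
    refine Finset.sum_congr rfl fun l _ => ?_
    rw [← sum_proj]
    refine Finset.sum_congr rfl fun j _ => ?_
    congr 1
    symm
    rw [← cols_mul]
    refine Pr_eq (cols_inj _ (hgM l)) (cols_iso _ (hU1 l)) ?_
    rw [cols_range _ (hgM l), cols_range _ (hU2 l)]
    exact (hU3 l j).symm
  rw [h2]
  exact hgε

lemma exact_unitary {s r : ℕ} (hr : 0 < r) (Λ : Fin s → Fin r → ℝ) (t : ℝ) (hc : ∀ l j, 0 ≤ cw (Λ l) j)
    (hT : TT Λ = (r : ℝ) * t) (M : Fin s → Matrix (Fin r) (Fin r) ℂ) (hM : ∀ l, IsUnit (M l).det)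
    (hss : ∀ V, dg Λ M V ≤ t * finrank ℂ V) :
    ∃ U : Fin s → Matrix (Fin r) (Fin r) ℂ, (∀ l, (U l)ᴴ * U l = 1) ∧
      ∑ l, U l * diagonal (fun i => (Λ l i : ℂ)) * (U l)ᴴ = (t : ℂ) • 1 := by
  set K : Set (Fin s → Matrix (Fin r) (Fin r) ℂ) := Set.pi Set.univ fun _ => {U | Uᴴ * U = 1} with hK
  have hKc : IsCompact K := isCompact_univ_pi fun _ => iso_compact r r
  set f : (Fin s → Matrix (Fin r) (Fin r) ℂ) → ℝ := fun U =>
    ∑ i, ∑ j, ‖(∑ l, U l * diagonal (fun i => (Λ l i : ℂ)) * (U l)ᴴ - (t : ℂ) • 1) i j‖ with hf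
  have hfc : Continuous f := by
    have h0 : Continuous fun U : Fin s → Matrix (Fin r) (Fin r) ℂ =>
        ∑ l, U l * diagonal (fun i => (Λ l i : ℂ)) * (U l)ᴴ - (t : ℂ) • 1 := by
      refine Continuous.sub (continuous_finsetSum _ fun l _ => ?_) continuous_const
      exact ((continuous_apply l).matrix_mul continuous_const).matrix_mul
        (continuous_apply l).matrix_conjTranspose
    refine continuous_finsetSum _ fun i _ => continuous_finsetSum _ fun j _ => ?_
    exact (h0.matrix_elem i j).norm
  have hne : K.Nonempty := ⟨fun _ => 1, fun l _ => by simp⟩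
  obtain ⟨U, hU, hmin⟩ := hKc.exists_isMinOn hne hfc.continuousOn
  have hUl : ∀ l, (U l)ᴴ * U l = 1 := fun l => hU l (Set.mem_univ _)
  refine ⟨U, hUl, ?_⟩
  have hle : ∀ ε : ℝ, 0 < ε → f U ≤ ε * ((r * r) * (1 + r * r)) := by
    intro ε hε
    obtain ⟨W, hW, hWε⟩ := approx_unitary hr Λ t hc hT M hM hss hε
    refine (hmin (show W ∈ K from fun l _ => hW l)).trans ?_
    refine (Finset.sum_le_sum fun i _ => Finset.sum_le_sum fun j _ => hWε i j).trans ?_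
    simp only [Finset.sum_const, Finset.card_univ, Fintype.card_fin, nsmul_eq_mul]
    apply le_of_eq; ring
  have hf0 : f U ≤ 0 := by
    by_contra hpos
    push Not at hpos
    have hr' : (0:ℝ) < r := by exact_mod_cast hr
    have hB : (0:ℝ) < (r * r) * (1 + r * r) := by positivity
    have := hle (f U / (2 * ((r * r) * (1 + r * r)))) (by positivity)
    have h2 : f U / (2 * ((r * r) * (1 + r * r) : ℝ)) * ((r * r) * (1 + r * r)) = f U / 2 := by
      field_simp
    rw [h2] at this
    linarith
  have hf00 : f U = 0 := le_antisymm hf0 (by positivity)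
  rw [← sub_eq_zero]
  ext i j
  have h5 := (Finset.sum_eq_zero_iff_of_nonneg (fun j _ => by positivity)).1 hf00 i (Finset.mem_univ _)
  have h6 := (Finset.sum_eq_zero_iff_of_nonneg (fun j _ => by positivity)).1 h5 j (Finset.mem_univ _)
  simpa using norm_eq_zero.1 h6

end KH
end

section
open Module Matrix
open scoped ComplexOrder
namespace KH

lemma exists_perm {r : ℕ} (f g : Fin r → ℂ)
    (h : Multiset.map f Finset.univ.val = Multiset.map g Finset.univ.val) :
    ∃ e : Equiv.Perm (Fin r), ∀ i, f i = g (e i) := by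
  classical
  have hcard : ∀ y, Fintype.card {i // f i = y} = Fintype.card {i // g i = y} := by
    intro y
    have h1 : ∀ k : Fin r → ℂ, Fintype.card {i // k i = y} = Multiset.count y (Multiset.map k Finset.univ.val) := by
      intro k
      rw [Multiset.count_map, Fintype.card_subtype, Finset.card_def, Finset.filter_val]
      simp only [eq_comm]
    rw [h1, h1, h]
  let φ : ∀ y, {i // f i = y} ≃ {i // g i = y} := fun y => Fintype.equivOfCardEq (hcard y)
  let e : Equiv.Perm (Fin r) := (Equiv.sigmaFiberEquiv f).symm.trans
    ((Equiv.sigmaCongrRight φ).trans (Equiv.sigmaFiberEquiv g))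
  refine ⟨e, fun i => ?_⟩
  exact ((φ (f i) ⟨i, rfl⟩).2).symm

lemma diag_perm {r : ℕ} {A : Matrix (Fin r) (Fin r) ℂ} (hA : A.IsHermitian) (L : Fin r → ℝ)
    {U : Matrix (Fin r) (Fin r) ℂ} (hU : Uᴴ * U = 1)
    (h : A = U * diagonal (fun i => (L i : ℂ)) * Uᴴ) :
    ∃ e : Equiv.Perm (Fin r), ∀ i, L i = hA.eigenvalues (e i) := by
  have h1 : A.charpoly = ∏ i, (Polynomial.X - Polynomial.C (L i : ℂ)) := by
    rw [h, charpoly_mul_comm, ← Matrix.mul_assoc, hU, Matrix.one_mul, charpoly_diagonal]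
  have h2 : A.charpoly.roots = Multiset.map (fun i => (L i : ℂ)) Finset.univ.val := by
    rw [h1, Polynomial.roots_prod]
    · simp
    · simp [Finset.prod_ne_zero_iff, Polynomial.X_sub_C_ne_zero]
  rw [hA.roots_charpoly_eq_eigenvalues] at h2
  obtain ⟨e, he⟩ := exists_perm _ _ h2.symm
  refine ⟨e, fun i => ?_⟩
  have := he i
  exact Complex.ofReal_injective this

lemma conj_herm {r : ℕ} (L : Fin r → ℝ) (U : Matrix (Fin r) (Fin r) ℂ) :
    (U * diagonal (fun i => (L i : ℂ)) * Uᴴ).IsHermitian := by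
  unfold IsHermitian
  rw [conjTranspose_mul, conjTranspose_mul, conjTranspose_conjTranspose, diagonal_conjTranspose,
    Matrix.mul_assoc]
  congr 3
  ext i; simp

lemma kirwan_iff {s r : ℕ} (Λ : Fin s → Fin r → ℝ) (t : ℝ) (hΛ : ∀ l, Antitone (Λ l)) :
    KirwanMem Λ t ↔ ∃ U : Fin s → Matrix (Fin r) (Fin r) ℂ, (∀ l, (U l)ᴴ * U l = 1) ∧
      ∑ l, U l * diagonal (fun i => (Λ l i : ℂ)) * (U l)ᴴ = (t : ℂ) • 1 := by
  constructor
  · rintro ⟨-, A, hA, hsum, he⟩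
    have : ∀ l, ∃ U : Matrix (Fin r) (Fin r) ℂ, Uᴴ * U = 1 ∧
        A l = U * diagonal (fun i => (Λ l i : ℂ)) * Uᴴ := by
      intro l
      obtain ⟨e, he⟩ := he l
      obtain ⟨U, h1, -, h3⟩ := spec (hA l)
      refine ⟨U.submatrix id e, ?_, ?_⟩
      · rw [conjTranspose_submatrix]
        refine (submatrix_mul_equiv Uᴴ U e (Equiv.refl _) e).trans ?_
        rw [h1]
        exact submatrix_one_equiv e
      · have h4 : diagonal (fun i => (Λ l i : ℂ))
            = (diagonal (fun i => ((hA l).eigenvalues i : ℂ))).submatrix e e := by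
          rw [submatrix_diagonal_equiv]
          congr 1; ext i; simp [he]
        rw [h4, conjTranspose_submatrix, submatrix_mul_equiv, submatrix_mul_equiv, submatrix_id_id]
        exact h3
    choose U hU hUA using this
    refine ⟨U, hU, ?_⟩
    rw [← hsum]
    exact Finset.sum_congr rfl fun l _ => (hUA l).symm
  · rintro ⟨U, hU, hsum⟩
    exact ⟨hΛ, _, fun l => conj_herm (Λ l) (U l), hsum, fun l => diag_perm _ _ (hU l) rfl⟩

lemma trace_conj {r : ℕ} (L : Fin r → ℝ) {U : Matrix (Fin r) (Fin r) ℂ} (hU : Uᴴ * U = 1) :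
    (U * diagonal (fun i => (L i : ℂ)) * Uᴴ).trace = ((∑ i, L i : ℝ) : ℂ) := by
  rw [trace_mul_comm, ← Matrix.mul_assoc, hU, Matrix.one_mul, trace_diagonal]
  push_cast; rfl

lemma nec_TT {s r : ℕ} (Λ : Fin s → Fin r → ℝ) (t : ℝ) (U : Fin s → Matrix (Fin r) (Fin r) ℂ)
    (hU : ∀ l, (U l)ᴴ * U l = 1)
    (hsum : ∑ l, U l * diagonal (fun i => (Λ l i : ℂ)) * (U l)ᴴ = (t : ℂ) • 1) : TT Λ = r * t := by
  have h := congrArg trace hsum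
  rw [trace_sum, trace_smul, trace_one, Fintype.card_fin] at h
  simp only [fun l => trace_conj (Λ l) (hU l)] at h
  rw [← Complex.ofReal_sum, smul_eq_mul] at h
  unfold TT
  rw [mul_comm]
  exact_mod_cast h

lemma nec_aux {r d : ℕ} (L : Fin r → ℝ) (hL : Antitone L) {U : Matrix (Fin r) (Fin r) ℂ}
    (hU : Uᴴ * U = 1) {R : Matrix (Fin r) (Fin d) ℂ} (hR : Rᴴ * R = 1) (J : Fin d → Fin r)
    (h : ∀ k, (fun i => R i k) ∈ fl U (J k + 1)) :
    ∑ k, L (J k) ≤ (R * Rᴴ * (U * diagonal (fun i => (L i : ℂ)) * Uᴴ)).trace.re := by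
  have hU' : U * Uᴴ = 1 := mul_eq_one_comm.1 hU
  set W := Uᴴ * R with hW
  have hWW : Wᴴ * W = 1 := by
    rw [hW, conjTranspose_mul, conjTranspose_conjTranspose, Matrix.mul_assoc, ← Matrix.mul_assoc U, hU',
      Matrix.one_mul, hR]
  have h1 : (R * Rᴴ * (U * diagonal (fun i => (L i : ℂ)) * Uᴴ)).trace
      = (Wᴴ * diagonal (fun i => (L i : ℂ)) * W).trace := by
    rw [Matrix.mul_assoc, trace_mul_comm]
    congr 1
    rw [hW, conjTranspose_mul, conjTranspose_conjTranspose]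
    simp only [Matrix.mul_assoc]
  rw [h1, trace, Complex.re_sum]
  refine Finset.sum_le_sum fun k _ => ?_
  have h2 : (diag (Wᴴ * diagonal (fun i => (L i : ℂ)) * W) k).re = ∑ i, L i * ‖W i k‖ ^ 2 := by
    rw [diag_apply, Matrix.mul_apply, Complex.re_sum]
    refine Finset.sum_congr rfl fun i _ => ?_
    rw [mul_diagonal, conjTranspose_apply, RCLike.star_def, mul_comm _ (L i : ℂ), mul_assoc,
      Complex.conj_mul', ← Complex.ofReal_pow, ← Complex.ofReal_mul, Complex.ofReal_re]
  have h3 : ∑ i, ‖W i k‖ ^ 2 = 1 := by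
    have h4 := congrFun (congrFun hWW k) k
    rw [Matrix.mul_apply, Matrix.one_apply_eq] at h4
    have h5 : ∑ i, Wᴴ k i * W i k = ((∑ i, ‖W i k‖ ^ 2 : ℝ) : ℂ) := by
      push_cast
      refine Finset.sum_congr rfl fun i _ => ?_
      rw [conjTranspose_apply, RCLike.star_def, Complex.conj_mul']
    rw [h5] at h4
    exact_mod_cast h4
  have h0 : ∀ i, J k < i → W i k = 0 := by
    intro i hi
    obtain ⟨y, hy, hyR⟩ := h k
    have h6 : W i k = (Uᴴ.mulVec (fun i => R i k)) i := rfl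
    rw [h6, ← hyR, mulVecLin_apply, mulVec_mulVec, hU, one_mulVec]
    exact hy i hi
  rw [h2]
  calc L (J k) = ∑ i, L (J k) * ‖W i k‖ ^ 2 := by rw [← Finset.mul_sum, h3, mul_one]
    _ ≤ _ := by
      refine Finset.sum_le_sum fun i _ => ?_
      rcases le_or_gt i (J k) with hi | hi
      · exact mul_le_mul_of_nonneg_right (hL hi) (by positivity)
      · rw [h0 i hi]; simp

lemma nec_TJ {s r d : ℕ} (Λ : Fin s → Fin r → ℝ) (hΛ : ∀ l, Antitone (Λ l)) (t : ℝ)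
    (U : Fin s → Matrix (Fin r) (Fin r) ℂ) (hU : ∀ l, (U l)ᴴ * U l = 1)
    (hsum : ∑ l, U l * diagonal (fun i => (Λ l i : ℂ)) * (U l)ᴴ = (t : ℂ) • 1)
    (J : Fin s → Fin d → Fin r) (hJ : Intersecting J) : TJ J Λ ≤ d * t := by
  have hdet : ∀ l, IsUnit (U l).det := by
    intro l
    have := congrArg Matrix.det (mul_eq_one_comm.1 (hU l))
    rw [det_mul, det_one] at this
    exact IsUnit.of_mul_eq_one _ this
  obtain ⟨V, hV, hVJ⟩ := hJ fun l => ⟨fun j => fl (U l) (j + 1),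
    fun i j h => fl_mono _ (by simpa using h), fun j => finrank_fl (hdet l) (Nat.succ_le_of_lt j.2)⟩
  obtain ⟨R0, hR0, hR0V⟩ := adapt (fun _ : Fin d => V) (fun k => by rw [hV]; exact k.2)
  have hR : ∀ l, ∃ R : Matrix (Fin r) (Fin d) ℂ, Rᴴ * R = 1 ∧
      ∀ k, (fun i => R i k) ∈ V ⊓ fl (U l) (J l k + 1) := fun l => adapt _ (hVJ l)
  have hle : ∀ l, ∑ k, Λ l (J l k)
      ≤ (R0 * R0ᴴ * (U l * diagonal (fun i => (Λ l i : ℂ)) * (U l)ᴴ)).trace.re := by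
    intro l
    obtain ⟨R, hR1, hR2⟩ := hR l
    rw [proj_eq hR0 hR1 V hV hR0V (fun k => (hR2 k).1)]
    exact nec_aux (Λ l) (hΛ l) (hU l) hR1 (J l) (fun k => (hR2 k).2)
  unfold TJ
  refine (Finset.sum_le_sum fun l _ => hle l).trans (le_of_eq ?_)
  rw [← Complex.re_sum, ← trace_sum, ← Finset.mul_sum, hsum, Matrix.mul_smul, Matrix.mul_one, trace_smul,
    trace_mul_comm, hR0, trace_one, Fintype.card_fin, smul_eq_mul, Complex.re_ofReal_mul,
    Complex.natCast_re, mul_comm]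

lemma suff {s r : ℕ} (hs : 2 ≤ s) (hr : 1 ≤ r) (σ : Equiv.Perm (Fin s))
    (Λ : Fin s → Fin r → ℝ) (t : ℝ) (hΛ : ∀ l, Antitone (Λ l))
    (hσ : (fun l => Λ (σ⁻¹ l)) = Λ) (hT : TT Λ = (r : ℝ) * t)
    (hH : ∀ (d : ℕ), 1 ≤ d → d < r →
          ∀ J : Fin s → Fin d → Fin r, (∀ l, StrictMono (J l)) →
            (fun l => J (σ⁻¹ l)) = J → Intersecting J → edim J = 0 →
            TJ J Λ ≤ (d : ℝ) * t) :
    ∃ U : Fin s → Matrix (Fin r) (Fin r) ℂ, (∀ l, (U l)ᴴ * U l = 1) ∧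
      ∑ l, U l * diagonal (fun i => (Λ l i : ℂ)) * (U l)ᴴ = (t : ℂ) • 1 := by
  set C : ℝ := ∑ l, ∑ i, |Λ l i| with hC
  have hCle : ∀ l i, 0 ≤ Λ l i + C := by
    intro l i
    have h1 : |Λ l i| ≤ ∑ i, |Λ l i| :=
      Finset.single_le_sum (f := fun i => |Λ l i|) (fun _ _ => abs_nonneg _) (Finset.mem_univ i)
    have h2 : ∑ i, |Λ l i| ≤ C :=
      Finset.single_le_sum (f := fun l => ∑ i, |Λ l i|) (fun _ _ => by positivity) (Finset.mem_univ l)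
    linarith [neg_abs_le (Λ l i)]
  set Λ' : Fin s → Fin r → ℝ := fun l i => Λ l i + C with hΛ'
  set t' : ℝ := t + s * C with ht'
  have hT' : TT Λ' = (r : ℝ) * t' := by
    have : TT Λ' = TT Λ + s * (r * C) := by
      unfold TT
      simp [hΛ', Finset.sum_add_distrib]
    rw [this, hT, ht']; ring
  have hc' : ∀ l j, 0 ≤ cw (Λ' l) j := fun l j =>
    cw_nonneg (fun a b h => by simpa [hΛ'] using hΛ l h) (fun i => hCle l i) j
  have hσ' : (fun l => Λ' (σ⁻¹ l)) = Λ' := by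
    ext l i
    have := congrFun (congrFun hσ l) i
    simp only [hΛ']
    simpa using this
  obtain ⟨M, hM, hss⟩ := exists_semistable (by omega) σ Λ' t' hc' hσ' hT' (by
    intro d hd hdr J hJ hJσ hJI hJe
    have h1 := hH d hd hdr J hJ hJσ hJI hJe
    have : TJ J Λ' = TJ J Λ + s * (d * C) := by
      unfold TJ
      simp [hΛ', Finset.sum_add_distrib]
    rw [this, ht']; nlinarith)
  obtain ⟨U, hU, hsum⟩ := exact_unitary hr Λ' t' hc' hT' M hM hss
  refine ⟨U, hU, ?_⟩
  have h1 : ∀ l, U l * diagonal (fun i => (Λ' l i : ℂ)) * (U l)ᴴ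
      = U l * diagonal (fun i => (Λ l i : ℂ)) * (U l)ᴴ + (C : ℂ) • 1 := by
    intro l
    have h2 : diagonal (fun i => (Λ' l i : ℂ)) = diagonal (fun i => (Λ l i : ℂ)) + (C : ℂ) • 1 := by
      rw [← diagonal_one, ← diagonal_smul, diagonal_add]
      congr 1; ext i; simp [hΛ']
    rw [h2, Matrix.mul_add, Matrix.add_mul, Matrix.mul_smul, Matrix.smul_mul, Matrix.mul_one,
      mul_eq_one_comm.1 (hU l)]
  simp only [h1, Finset.sum_add_distrib, Finset.sum_const, Finset.card_univ, Fintype.card_fin] at hsum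
  rw [← eq_sub_iff_add_eq] at hsum
  rw [hsum, ht', ← Nat.cast_smul_eq_nsmul ℂ, smul_smul, ← sub_smul]
  congr 1
  push_cast
  ring

end KH
end

/-- For `σ`-stable `(Λ,t) ∈ E(r,s)`: `(Λ,t) ∈ 𝒦(r,s)` iff `T(Λ) = r t` and
`T_𝐉(Λ) ≤ d t` for all `d ∈ [r-1]` and all `σ`-stable
`𝐉 ∈ Intersecting⁰(d,r,s)^σ`. -/
theorem kirwan_sym_horn (s r : ℕ) (hs : 2 ≤ s) (hr : 1 ≤ r)
    (σ : Equiv.Perm (Fin s))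
    (Λ : Fin s → Fin r → ℝ) (t : ℝ) (hΛ : ∀ l, Antitone (Λ l))
    (hσ : (fun l => Λ (σ⁻¹ l)) = Λ) :
    KirwanMem Λ t ↔
      (TT Λ = (r : ℝ) * t ∧
        ∀ (d : ℕ), 1 ≤ d → d < r →
          ∀ J : Fin s → Fin d → Fin r, (∀ l, StrictMono (J l)) →
            (fun l => J (σ⁻¹ l)) = J → Intersecting J → edim J = 0 →
            TJ J Λ ≤ (d : ℝ) * t) := by
  rw [KH.kirwan_iff Λ t hΛ]
  constructor
  · rintro ⟨U, hU, hsum⟩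
    exact ⟨KH.nec_TT Λ t U hU hsum, fun d _ _ J _ _ hJ _ => KH.nec_TJ Λ hΛ t U hU hsum J hJ⟩
  · rintro ⟨hT, hH⟩
    exact KH.suff hs hr σ Λ t hΛ hσ hT hH
end

section
/- (σ-stable Horn inequalities.) Let σ ∈ 𝔖_s and assume 𝐈 ∈ Intersecting(r,n,s)^σ. Then for all d ∈ [r] and all 𝐉 ∈ Intersecting(d,r,s)^σ, one has edim(𝐈𝐉) ≥ edim 𝐉. -/
open Module

noncomputable section

open IntermediateField.algebraAdjoinAdjoin in

theorem exists_derivation_aux {ι : Type} (v : ι → ℂ) (hv : IsTranscendenceBasis ℚ v) (a : ι → ℂ) :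
    ∃ D : Derivation ℚ ℂ ℂ, ∀ i, D (v i) = a i := by
  classical
  let i1 : Algebra (MvPolynomial ι ℚ) ℂ := (MvPolynomial.aeval v).toAlgebra
  have : IsScalarTower ℚ (MvPolynomial ι ℚ) ℂ :=
    IsScalarTower.of_algebraMap_eq' (by
      ext x
      exact ((MvPolynomial.aeval v).commutes x).symm)
  have hmap : ∀ p, algebraMap (MvPolynomial ι ℚ) ℂ p = MvPolynomial.aeval v p := fun p => rfl
  let i2 : Algebra (MvPolynomial ι ℚ) (Algebra.adjoin ℚ (Set.range v)) :=
    (hv.1.aevalEquiv : MvPolynomial ι ℚ →+* Algebra.adjoin ℚ (Set.range v)).toAlgebra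
  have t2 : IsScalarTower (MvPolynomial ι ℚ) (Algebra.adjoin ℚ (Set.range v)) ℂ :=
    IsScalarTower.of_algebraMap_eq (fun p => by
      rw [hmap]
      exact (hv.1.algebraMap_aevalEquiv p).symm)
  let e : MvPolynomial ι ℚ ≃ₐ[MvPolynomial ι ℚ] Algebra.adjoin ℚ (Set.range v) :=
    AlgEquiv.ofBijective (Algebra.ofId _ _) hv.1.aevalEquiv.bijective
  have f1 : Algebra.FormallyEtale (MvPolynomial ι ℚ) (Algebra.adjoin ℚ (Set.range v)) :=
    Algebra.FormallyEtale.of_equiv e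
  have f2 : Algebra.FormallyEtale (Algebra.adjoin ℚ (Set.range v))
      (IntermediateField.adjoin ℚ (Set.range v)) :=
    .of_isLocalization (nonZeroDivisors _)
  have alg := hv.isAlgebraic_field
  have f3 : Algebra.FormallyEtale (IntermediateField.adjoin ℚ (Set.range v)) ℂ :=
    Algebra.FormallyEtale.of_isSeparable _ _
  have f4 : Algebra.FormallyEtale (Algebra.adjoin ℚ (Set.range v)) ℂ :=
    .comp _ (IntermediateField.adjoin ℚ (Set.range v)) _
  have f5 : Algebra.FormallyEtale (MvPolynomial ι ℚ) ℂ :=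
    .comp _ (Algebra.adjoin ℚ (Set.range v)) _
  let d0 : Derivation ℚ (MvPolynomial ι ℚ) ℂ := MvPolynomial.mkDerivation ℚ a
  let l := (LinearMap.liftBaseChange ℂ d0.liftKaehlerDifferential) ∘ₗ
    (KaehlerDifferential.tensorKaehlerEquivOfFormallyEtale ℚ (MvPolynomial ι ℚ) ℂ).symm.toLinearMap
  refine ⟨l.compDer (KaehlerDifferential.D ℚ ℂ), fun i => ?_⟩
  have h1 : v i = algebraMap (MvPolynomial ι ℚ) ℂ (MvPolynomial.X i) := by
    rw [hmap, MvPolynomial.aeval_X]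
  rw [h1]
  simp [l, KaehlerDifferential.tensorKaehlerEquivOfFormallyEtale_symm_D_algebraMap, d0,
    MvPolynomial.mkDerivation_X]

theorem exists_generic (ι : Type) [Finite ι] : ∃ v : ι → ℂ, AlgebraicIndependent ℚ v ∧
    ∀ a : ι → ℂ, ∃ D : Derivation ℚ ℂ ℂ, ∀ i, D (v i) = a i := by
  obtain ⟨B, hB⟩ := exists_isTranscendenceBasis ℚ ℂ
  have hc := IsAlgClosed.cardinal_eq_cardinal_transcendence_basis_of_aleph0_lt' _ hB
    (by simp) (by simpa using Cardinal.aleph0_lt_continuum)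
  have hinf : Infinite B := by
    rw [Cardinal.infinite_iff, ← hc]
    simpa using Cardinal.aleph0_lt_continuum.le
  obtain ⟨n, ⟨e⟩⟩ := Finite.exists_equiv_fin ι
  let f : ι → B := fun i => Infinite.natEmbedding B (e i)
  have hf : Function.Injective f := fun i j h => by
    apply e.injective
    apply Fin.ext
    exact (Infinite.natEmbedding B).injective h
  refine ⟨fun i => f i, hB.1.comp f hf, fun a => ?_⟩
  obtain ⟨D, hD⟩ := exists_derivation_aux _ hB (Function.extend f a 0)
  exact ⟨D, fun i => by rw [hD, hf.extend_apply]⟩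

theorem exists_generic_mat (s n : ℕ) : ∃ g : Fin s → Matrix (Fin n) (Fin n) ℂ,
    (∀ l, IsUnit (g l).det) ∧
    ∀ X : Fin s → Matrix (Fin n) (Fin n) ℂ, ∃ D : Derivation ℚ ℂ ℂ, ∀ l, (g l).map D = X l * g l := by
  obtain ⟨v, hv, hD⟩ := exists_generic (Fin s × (Fin n × Fin n))
  refine ⟨fun l => Matrix.of fun i j => v (l, (i, j)), fun l => ?_, fun X => ?_⟩
  · have h2 : AlgebraicIndependent ℚ (fun p : Fin n × Fin n => v (l, p)) :=
      hv.comp (fun p => (l, p)) (Prod.mk_right_injective l)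
    have h3 := Matrix.mvPolynomialX_mapMatrix_aeval ℚ (Matrix.of fun i j => v (l, (i, j)))
    rw [isUnit_iff_ne_zero]
    beta_reduce
    rw [← h3, ← AlgHom.map_det]
    intro h
    exact Matrix.det_mvPolynomialX_ne_zero (Fin n) ℚ (h2 (by simpa using h))
  · obtain ⟨D, h⟩ := hD (fun p => (X p.1 * (Matrix.of fun i j => v (p.1, (i, j)))) p.2.1 p.2.2)
    refine ⟨D, fun l => ?_⟩
    ext i j
    simpa using h (l, (i, j))

/-- coordinatewise application of a derivation -/
def derV {n : ℕ} (D : Derivation ℚ ℂ ℂ) (u : Fin n → ℂ) : Fin n → ℂ := fun i => D (u i)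

theorem derV_add {n : ℕ} (D : Derivation ℚ ℂ ℂ) (u v : Fin n → ℂ) :
    derV D (u + v) = derV D u + derV D v := by
  ext i; simp [derV]

theorem derV_smul {n : ℕ} (D : Derivation ℚ ℂ ℂ) (c : ℂ) (v : Fin n → ℂ) :
    derV D (c • v) = c • derV D v + D c • v := by
  ext i; simp [derV, mul_comm]

theorem derV_mulVec {n : ℕ} (D : Derivation ℚ ℂ ℂ) (g : Matrix (Fin n) (Fin n) ℂ)
    (u : Fin n → ℂ) :
    derV D (g.mulVec u) = (g.map D).mulVec u + g.mulVec (derV D u) := by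
  ext i
  simp only [derV, Matrix.mulVec, dotProduct, map_sum, Derivation.leibniz, Pi.add_apply,
    Matrix.map_apply, smul_eq_mul, ← Finset.sum_add_distrib]
  refine Finset.sum_congr rfl fun j _ => ?_
  ring

/-- steps of the standard flag -/
def stdF (n : ℕ) (i : Fin n) : Submodule ℂ (Fin n → ℂ) :=
  Submodule.span ℂ (Set.range fun k : Fin ((i : ℕ) + 1) =>
    (Pi.single (Fin.castLE i.2 k) 1 : Fin n → ℂ))

theorem stdF_mono (n : ℕ) : Monotone (stdF n) := by
  intro i j hij
  refine Submodule.span_mono ?_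
  rintro _ ⟨k, rfl⟩
  exact ⟨Fin.castLE (by have : (i : ℕ) ≤ j := hij; omega) k, rfl⟩

theorem stdF_rank (n : ℕ) (i : Fin n) : finrank ℂ (stdF n i) = (i : ℕ) + 1 := by
  have h := (Pi.basisFun ℂ (Fin n)).linearIndependent.comp
    (Fin.castLE (n := (i : ℕ) + 1) i.2) (Fin.castLE_injective _)
  have h2 := finrank_span_eq_card h
  rw [Fintype.card_fin] at h2
  rw [← h2]
  have h3 : stdF n i = Submodule.span ℂ (Set.range ((Pi.basisFun ℂ (Fin n)) ∘
      (Fin.castLE (n := (i : ℕ) + 1) i.2))) := by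
    rw [stdF]
    congr 2
    funext k
    simp
  rw [h3]

theorem finrank_map_of_inj {U U' : Type} [AddCommGroup U] [Module ℂ U] [AddCommGroup U']
    [Module ℂ U'] {f : U →ₗ[ℂ] U'} (hf : Function.Injective f) (A : Submodule ℂ U) :
    finrank ℂ (A.map f) = finrank ℂ A :=
  (LinearEquiv.finrank_eq (Submodule.equivMapOfInjective f hf A)).symm

theorem stdF_der (n : ℕ) (D : Derivation ℚ ℂ ℂ) (i : Fin n) (u : Fin n → ℂ) (hu : u ∈ stdF n i) :
    derV D u ∈ stdF n i := by
  induction hu using Submodule.span_induction with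
  | mem x h =>
    obtain ⟨k, rfl⟩ := h
    convert! Submodule.zero_mem _
    ext j
    simp only [derV, Pi.single_apply, Pi.zero_apply]
    split_ifs <;> simp
  | zero =>
    convert! Submodule.zero_mem _
    ext j
    simp [derV]
  | add x y _ _ hx hy => rw [derV_add]; exact add_mem hx hy
  | smul c x h hx =>
    rw [derV_smul]
    exact add_mem (Submodule.smul_mem _ _ hx) (Submodule.smul_mem _ _ h)

/-- the linear map `V → U / V` induced by a derivation -/
def derMap {n : ℕ} (D : Derivation ℚ ℂ ℂ) (V : Submodule ℂ (Fin n → ℂ)) :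
    V →ₗ[ℂ] (Fin n → ℂ) ⧸ V where
  toFun v := V.mkQ (derV D v)
  map_add' x y := by simp [derV_add]
  map_smul' c x := by
    rw [Submodule.coe_smul, derV_smul, map_add, map_smul]
    have : V.mkQ (D c • (x : Fin n → ℂ)) = 0 := by
      rw [← LinearMap.mem_ker, Submodule.ker_mkQ]
      exact Submodule.smul_mem _ _ x.2
    rw [this]
    simp

theorem main_surj (s n : ℕ) : ∃ E : Fin s → Flagg n, ∀ V : Submodule ℂ (Fin n → ℂ),
    ∀ X : Fin s → ((Fin n → ℂ) →ₗ[ℂ] (Fin n → ℂ)), ∃ φ : V →ₗ[ℂ] (Fin n → ℂ) ⧸ V,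
    ∀ l i (v : V), (v : Fin n → ℂ) ∈ (E l).F i →
      Submodule.factor (le_sup_left : V ≤ V ⊔ (E l).F i) (φ v) =
        (V ⊔ (E l).F i).mkQ (X l v) := by
  obtain ⟨g, hg, hD⟩ := exists_generic_mat s n
  have hinj : ∀ l, Function.Injective (Matrix.mulVecLin (g l)) := fun l =>
    Matrix.mulVec_injective_iff_isUnit.2 ((Matrix.isUnit_iff_isUnit_det _).2 (hg l))
  refine ⟨fun l => ⟨fun i => (stdF n i).map (Matrix.mulVecLin (g l)),
    fun i j hij => Submodule.map_mono (stdF_mono n hij), fun i => ?_⟩, fun V X => ?_⟩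
  · rw [finrank_map_of_inj (hinj l)]
    exact stdF_rank n i
  · obtain ⟨D, h⟩ := hD (fun l => LinearMap.toMatrix' (X l))
    refine ⟨derMap D V, ?_⟩
    rintro l i v ⟨u, hu, huv⟩
    change Submodule.factor _ (V.mkQ (derV D v)) = _
    refine (Submodule.Quotient.eq _).2 ?_
    apply Submodule.mem_sup_right
    refine ⟨derV D u, stdF_der n D i u hu, ?_⟩
    rw [← huv]
    simp only [Matrix.mulVecLin_apply]
    rw [derV_mulVec, h, ← Matrix.mulVec_mulVec]
    rw [LinearMap.toMatrix'_mulVec, LinearMap.id_apply, add_sub_cancel_left]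

theorem jump {U : Type} [AddCommGroup U] [Module ℂ U] [FiniteDimensional ℂ U]
    (V A B : Submodule ℂ U) (hAB : A ≤ B) (h : finrank ℂ B ≤ finrank ℂ A + 1) :
    finrank ℂ ↥(V ⊓ B) ≤ finrank ℂ ↥(V ⊓ A) + 1 := by
  have h1 := Submodule.finrank_sup_add_finrank_inf_eq (V ⊓ B) A
  have h2 : V ⊓ B ⊓ A = V ⊓ A := by rw [inf_assoc, inf_eq_right.2 hAB]
  rw [h2] at h1
  have h3 : finrank ℂ ↥(V ⊓ B ⊔ A) ≤ finrank ℂ B :=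
    Submodule.finrank_mono (sup_le inf_le_right hAB)
  omega

theorem induced_pos {n r : ℕ} (E : Flagg n) (V : Submodule ℂ (Fin n → ℂ)) (I : Fin r → Fin n)
    (hV : ∀ k : Fin r, (k : ℕ) + 1 ≤ finrank ℂ ↥(V ⊓ E.F (I k))) :
    ∃ i : Fin r → Fin n, Monotone i ∧ ∀ k, i k ≤ I k ∧ finrank ℂ ↥(V ⊓ E.F (i k)) = (k : ℕ) + 1 := by
  classical
  have hmin : ∀ k : Fin r, ∃ i : Fin n, (k : ℕ) + 1 ≤ finrank ℂ ↥(V ⊓ E.F i) ∧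
      ∀ j, (k : ℕ) + 1 ≤ finrank ℂ ↥(V ⊓ E.F j) → i ≤ j := by
    intro k
    obtain ⟨i, hi, hi2⟩ := WellFounded.has_min (wellFounded_lt (α := Fin n))
      {i | (k : ℕ) + 1 ≤ finrank ℂ ↥(V ⊓ E.F i)} ⟨I k, hV k⟩
    exact ⟨i, hi, fun j hj => not_lt.1 (hi2 j hj)⟩
  choose i hi1 hi2 using hmin
  refine ⟨i, fun k k' hk => hi2 k _ ?_, fun k => ⟨hi2 k _ (hV k), le_antisymm ?_ (hi1 k)⟩⟩
  · have : (k : ℕ) ≤ k' := hk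
    have := hi1 k'
    omega
  · by_cases h0 : (i k : ℕ) = 0
    · have h1 : finrank ℂ ↥(V ⊓ E.F (i k)) ≤ finrank ℂ (E.F (i k)) :=
        Submodule.finrank_mono inf_le_right
      rw [E.rank_eq] at h1
      omega
    · let p : Fin n := ⟨(i k : ℕ) - 1, by omega⟩
      have hp : p < i k := by
        rw [Fin.lt_def]; simp only [p]; omega
      have h1 := jump V (E.F p) (E.F (i k)) (E.mono hp.le) (by
        rw [E.rank_eq, E.rank_eq]; simp only [p]; omega)
      have h2 : ¬ (k : ℕ) + 1 ≤ finrank ℂ ↥(V ⊓ E.F p) := fun h => absurd (hi2 k p h) (not_le.2 hp)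
      omega

theorem exists_indep {U : Type} [AddCommGroup U] [Module ℂ U] [FiniteDimensional ℂ U] :
    ∀ (d : ℕ) (A : Fin d → Submodule ℂ U), (∀ k : Fin d, (k : ℕ) + 1 ≤ finrank ℂ (A k)) →
      ∃ v : Fin d → U, LinearIndependent ℂ v ∧ ∀ k, v k ∈ A k := by
  intro d
  induction d with
  | zero => intro A _; exact ⟨Fin.elim0, linearIndependent_empty_type, fun k => k.elim0⟩
  | succ d ih =>
    intro A hA
    obtain ⟨v, hv, hvA⟩ := ih (fun k => A k.castSucc) (fun k => hA k.castSucc)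
    have hx : ∃ x ∈ A (Fin.last d), x ∉ Submodule.span ℂ (Set.range v) := by
      by_contra! hcon
      have h1 := Submodule.finrank_mono (show A (Fin.last d) ≤ _ from hcon)
      rw [finrank_span_eq_card hv, Fintype.card_fin] at h1
      have := hA (Fin.last d)
      simp at this
      omega
    obtain ⟨x, hxA, hx⟩ := hx
    refine ⟨Fin.snoc v x, linearIndependent_finSnoc.2 ⟨hv, hx⟩, fun k => ?_⟩
    refine Fin.lastCases ?_ (fun k => ?_) k
    · simpa using hxA
    · simpa using hvA k

theorem exists_map_indep {U : Type} [AddCommGroup U] [Module ℂ U]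
    {ι : Type} (v : ι → U) (hv : LinearIndependent ℂ v) (x : ι → U) :
    ∃ X : U →ₗ[ℂ] U, ∀ k, X (v k) = x k := by
  obtain ⟨X, hX⟩ := LinearMap.exists_extend ((Basis.span hv).constr ℂ x)
  refine ⟨X, fun k => ?_⟩
  have := LinearMap.congr_fun hX (Basis.span hv k)
  rw [Basis.constr_basis] at this
  rw [← this]
  simp [Basis.span_apply]

theorem horn_core (s r n d : ℕ) (I : Fin s → Fin r → Fin n) (hI : ∀ l, StrictMono (I l))
    (hIint : Intersecting I) (J : Fin s → Fin d → Fin r)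
    (hJint : Intersecting J) :
    ∑ l, ∑ k, ((n : ℤ) - r - (I l (J l k) : ℤ) + (J l k : ℤ)) ≤ d * ((n : ℤ) - r) := by
  obtain ⟨E, hE⟩ := main_surj s n
  obtain ⟨V, hVr, hV⟩ := hIint E
  choose i himono hi using fun l => induced_pos (E l) V (I l) (hV l)
  have e : V ≃ₗ[ℂ] (Fin r → ℂ) := LinearEquiv.ofFinrankEq _ _ (by simp [hVr])
  let j : (Fin r → ℂ) →ₗ[ℂ] (Fin n → ℂ) := V.subtype ∘ₗ e.symm.toLinearMap
  have hj : Function.Injective j := V.injective_subtype.comp e.symm.injective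
  have hjr : LinearMap.range j = V := by
    rw [LinearMap.range_comp, LinearEquiv.range, Submodule.map_top, Submodule.range_subtype]
  let F : Fin s → Flagg r := fun l =>
    { F := fun k => ((E l).F (i l k)).comap j
      mono := fun k k' h => Submodule.comap_mono ((E l).mono (himono l h))
      rank_eq := fun k => by
        rw [← finrank_map_of_inj hj, Submodule.map_comap_eq, hjr, (hi l k).2] }
  obtain ⟨W, hWd, hW⟩ := hJint F
  have hind := fun l => exists_indep d (fun k => ((F l).F (J l k)).comap W.subtype) (fun k => by
    have := hW l k
    rwa [← finrank_map_of_inj W.injective_subtype, Submodule.map_comap_eq,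
      Submodule.range_subtype])
  choose v hv hvF using hind
  let jW : W →ₗ[ℂ] (Fin r → ℂ) := W.subtype
  let P : Fin s × Fin d → Submodule ℂ (Fin n → ℂ) := fun p => V ⊔ (E p.1).F (i p.1 (J p.1 p.2))
  let T : (W →ₗ[ℂ] (Fin n → ℂ) ⧸ V) →ₗ[ℂ] (∀ p, (Fin n → ℂ) ⧸ P p) :=
    LinearMap.pi fun p => (Submodule.factor (le_sup_left : V ≤ P p)) ∘ₗ
      LinearMap.applyₗ (v p.1 p.2)
  have hT : Function.Surjective T := by
    intro t
    choose x hx using fun p => Submodule.mkQ_surjective (P p) (t p)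
    have hX := fun l => exists_map_indep (fun k => j (v l k))
      (((hv l).map' W.subtype (LinearMap.ker_eq_bot.2 W.injective_subtype)).map' j
        (LinearMap.ker_eq_bot.2 hj)) (fun k => x (l, k))
    choose X hX using hX
    obtain ⟨φ, hφ⟩ := hE V X
    refine ⟨φ ∘ₗ e.symm.toLinearMap ∘ₗ W.subtype, ?_⟩
    funext p
    have h1 := hφ p.1 (i p.1 (J p.1 p.2)) (e.symm (v p.1 p.2)) (hvF p.1 p.2)
    have h2 : X p.1 (e.symm (v p.1 p.2)) = x p := hX p.1 p.2
    rw [h2, hx] at h1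
    exact h1
  have hfin := T.finrank_range_le
  rw [LinearMap.range_eq_top.2 hT, finrank_top, Module.finrank_pi_fintype,
    Module.finrank_linearMap, hWd] at hfin
  have hQ : ((finrank ℂ ((Fin n → ℂ) ⧸ V) : ℕ) : ℤ) = (n : ℤ) - r := by
    have := V.finrank_quotient_add_finrank
    rw [hVr, Module.finrank_fin_fun] at this
    omega
  have hfin2 : ((∑ p, finrank ℂ ((Fin n → ℂ) ⧸ P p) : ℕ) : ℤ) ≤ d * ((n : ℤ) - r) := by
    rw [← hQ]
    exact_mod_cast hfin
  refine le_trans ?_ hfin2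
  rw [Nat.cast_sum, Fintype.sum_prod_type]
  refine Finset.sum_le_sum fun l _ => Finset.sum_le_sum fun k _ => ?_
  have h1 := (P (l, k)).finrank_quotient_add_finrank
  have h2 := Submodule.finrank_sup_add_finrank_inf_eq V ((E l).F (i l (J l k)))
  rw [(hi l _).2, (E l).rank_eq, hVr] at h2
  rw [Module.finrank_fin_fun] at h1
  have h3 : (i l (J l k) : ℕ) ≤ I l (J l k) := (hi l (J l k)).1
  have h4 : finrank ℂ (P (l, k)) = finrank ℂ ↥(V ⊔ (E l).F (i l (J l k))) := rfl
  omega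

end

/-- **σ-stable Horn inequalities.** If `𝐈 ∈ Intersecting(r,n,s)^σ` then for all
`d ∈ [r]` and all `𝐉 ∈ Intersecting(d,r,s)^σ`, `edim(𝐈𝐉) ≥ edim 𝐉`. -/
theorem horn_inequalities_sym (s r n : ℕ) (hs : 2 ≤ s) (hr : 1 ≤ r) (hrn : r ≤ n)
    (σ : Equiv.Perm (Fin s))
    (I : Fin s → Fin r → Fin n) (hI : ∀ l, StrictMono (I l))
    (hIσ : (fun l => I (σ⁻¹ l)) = I) (hIint : Intersecting I) :
    ∀ (d : ℕ), 1 ≤ d → d ≤ r →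
      ∀ J : Fin s → Fin d → Fin r, (∀ l, StrictMono (J l)) →
        (fun l => J (σ⁻¹ l)) = J → Intersecting J →
        edim J ≤ edim (fun l k => I l (J l k)) := by
  intro d _ _ J _ _ hJint
  have h := horn_core s r n d I hI hIint J hJint
  have key : edim (fun l k => I l (J l k)) - edim J =
      d * ((n : ℤ) - r) - ∑ l, ∑ k, ((n : ℤ) - r - (I l (J l k) : ℤ) + (J l k : ℤ)) := by
    simp only [edim, dimI, Finset.sum_add_distrib, Finset.sum_sub_distrib, Finset.sum_const,
      Finset.card_univ, Fintype.card_fin, nsmul_eq_mul]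
    ring
  linarith
end
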